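/- Let S ⊆ ℝ² be a semialgebraic set that is regular at infinity, i.e., S = S₀ ∪ S₁ where S₀ and S₁ are semialgebraic sets, S₀ is bounded, and S₁ is contained in the closure of its interior (S₁ ⊆ closure(interior S₁) in ℝ²). Then the ring B(S) of polynomials in ℝ[x,y] bounded on S is a finitely generated ℝ-algebra. -/

import Mathlib

/-- A subset of `ℝᵏ` is semialgebraic if it is a finite union of sets of the form
`{x : p(x) = 0, q₁(x) > 0, …, qₘ(x) > 0}` for real polynomials `p, q₁, …, qₘ`. -/
def IsSemialgebraic {k : ℕ} (A : Set (Fin k → ℝ)) : Prop :=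
  ∃ (N : ℕ) (p : Fin N → MvPolynomial (Fin k) ℝ) (m : Fin N → ℕ)
    (q : (i : Fin N) → Fin (m i) → MvPolynomial (Fin k) ℝ),
    A = ⋃ i, {x | MvPolynomial.eval x (p i) = 0 ∧
                  ∀ j, 0 < MvPolynomial.eval x (q i j)}

/-- The `ℝ`-subalgebra `B(S)` of `ℝ[x₁,…,xₙ]` consisting of the polynomials whose
image on `S ⊆ ℝⁿ` is a bounded subset of `ℝ`. -/
noncomputable def polyBdd (n : ℕ) (S : Set (Fin n → ℝ)) :
    Subalgebra ℝ (MvPolynomial (Fin n) ℝ) where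
  carrier := {f | Bornology.IsBounded ((fun x => MvPolynomial.eval x f) '' S)}
  add_mem' := by
    intro a b ha hb
    rw [Set.mem_setOf_eq, isBounded_iff_forall_norm_le] at *
    obtain ⟨Ca, hCa⟩ := ha
    obtain ⟨Cb, hCb⟩ := hb
    refine ⟨Ca + Cb, ?_⟩
    rintro _ ⟨x, hx, rfl⟩
    simp only [map_add]
    calc ‖MvPolynomial.eval x a + MvPolynomial.eval x b‖
        ≤ ‖MvPolynomial.eval x a‖ + ‖MvPolynomial.eval x b‖ := norm_add_le _ _
      _ ≤ Ca + Cb := add_le_add (hCa _ ⟨x, hx, rfl⟩) (hCb _ ⟨x, hx, rfl⟩)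
  mul_mem' := by
    intro a b ha hb
    rw [Set.mem_setOf_eq, isBounded_iff_forall_norm_le] at *
    obtain ⟨Ca, hCa⟩ := ha
    obtain ⟨Cb, hCb⟩ := hb
    refine ⟨max Ca 0 * max Cb 0, ?_⟩
    rintro _ ⟨x, hx, rfl⟩
    simp only [map_mul, norm_mul]
    exact mul_le_mul (le_max_of_le_left (hCa _ ⟨x, hx, rfl⟩))
      (le_max_of_le_left (hCb _ ⟨x, hx, rfl⟩)) (norm_nonneg _) (le_max_right _ _)
  zero_mem' := by
    rw [Set.mem_setOf_eq, isBounded_iff_forall_norm_le]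
    exact ⟨0, by rintro _ ⟨x, hx, rfl⟩; simp⟩
  one_mem' := by
    rw [Set.mem_setOf_eq, isBounded_iff_forall_norm_le]
    exact ⟨1, by rintro _ ⟨x, hx, rfl⟩; simp⟩
  algebraMap_mem' := by
    intro r
    rw [Set.mem_setOf_eq, isBounded_iff_forall_norm_le]
    refine ⟨‖r‖, ?_⟩
    rintro _ ⟨x, hx, rfl⟩
    simp [MvPolynomial.algebraMap_eq]

/-- Artin-Rees for a principal ideal, elementwise. -/
theorem artinRees_dvd {E : Type*} [CommRing E] [IsNoetherianRing E] (t : E) (J : Ideal E) :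
    ∃ c : ℕ, ∀ n : ℕ, ∀ x ∈ J, t ^ (n + c) ∣ x → ∃ y ∈ J, x = t ^ n * y := by
  obtain ⟨c, hc⟩ := Ideal.exists_pow_inf_eq_pow_smul (Ideal.span {t}) (M := E) J
  refine ⟨c, fun n x hx hd => ?_⟩
  have h := hc (n + c) (Nat.le_add_left _ _)
  have hx' : x ∈ (Ideal.span {t}) ^ (n + c) • (⊤ : Submodule E E) ⊓ J := by
    refine ⟨?_, hx⟩
    rw [smul_eq_mul, Ideal.mul_top, Ideal.span_singleton_pow]
    exact Ideal.mem_span_singleton.2 hd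
  rw [h, Nat.add_sub_cancel, Ideal.span_singleton_pow,
    Submodule.ideal_span_singleton_smul, Submodule.mem_smul_pointwise_iff_exists] at hx'
  obtain ⟨y, hy, rfl⟩ := hx'
  exact ⟨y, hy.2, by simp⟩

/-- Multiplication by a nonzerodivisor reflects high divisibility by powers of `t`. -/
theorem exists_pow_dvd_of_pow_dvd_mul {E : Type*} [CommRing E] [IsNoetherianRing E] (t : E)
    {c : E} (hc : ∀ x, c * x = 0 → x = 0) (j : ℕ) :
    ∃ k : ℕ, ∀ x, t ^ k ∣ c * x → t ^ j ∣ x := by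
  obtain ⟨k, hk⟩ := artinRees_dvd t (Ideal.span {c})
  refine ⟨j + k, fun x hx => ?_⟩
  obtain ⟨y, hy, h⟩ := hk j (c * x) (Ideal.mem_span_singleton.2 ⟨x, rfl⟩) hx
  obtain ⟨w, rfl⟩ := Ideal.mem_span_singleton.1 hy
  refine ⟨w, sub_eq_zero.1 (hc _ ?_)⟩
  rw [mul_sub, h]; ring

/-- If a power of `x` is highly divisible by `t` modulo a prime, then so is `x`. -/
def PowDvdReflects {A : Type*} [CommRing A] (t : A) : Prop :=
  ∀ P : Ideal A, P.IsPrime → ∀ n : ℕ, 1 ≤ n → ∀ j : ℕ, ∃ k : ℕ, ∀ x y : A,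
    x ^ n - t ^ k * y ∈ P → ∃ z, x - t ^ j * z ∈ P

theorem exists_pow_dvd_of_pow_dvd_pow {E : Type*} [CommRing E] [IsDomain E] [IsNoetherianRing E]
    (hfin : Module.Finite E (integralClosure E (FractionRing E))) (t : E) (n : ℕ) (hn : 1 ≤ n)
    (j : ℕ) : ∃ k : ℕ, ∀ x, t ^ k ∣ x ^ n → t ^ j ∣ x := by
  classical
  by_cases ht : t = 0
  · refine ⟨1, fun x hx => ?_⟩
    rw [ht, pow_one, zero_dvd_iff] at hx
    rw [pow_eq_zero_iff (by omega)] at hx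
    simp [hx]
  obtain ⟨s, hs⟩ := hfin.fg_top
  obtain ⟨δ, hδ⟩ := IsLocalization.exist_integer_multiples_of_finset (nonZeroDivisors E)
    (s.image (fun z : integralClosure E (FractionRing E) => (z : FractionRing E)))
  have hδ' : ∀ z : integralClosure E (FractionRing E),
      ∃ w : E, algebraMap E (FractionRing E) w = algebraMap E (FractionRing E) δ * z := by
    intro z
    have hz : z ∈ Submodule.span E (s : Set (integralClosure E (FractionRing E))) := by
      rw [hs]; trivial
    induction hz using Submodule.span_induction with
    | mem x hx =>
      obtain ⟨w, hw⟩ := hδ x (Finset.mem_image_of_mem _ hx)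
      exact ⟨w, by rw [hw, Algebra.smul_def]⟩
    | zero => exact ⟨0, by simp⟩
    | add x y _ _ hx hy =>
      obtain ⟨a, ha⟩ := hx
      obtain ⟨b, hb⟩ := hy
      exact ⟨a + b, by rw [map_add, ha, hb]; push_cast; ring⟩
    | smul r x _ hx =>
      obtain ⟨a, ha⟩ := hx
      refine ⟨r * a, ?_⟩
      rw [map_mul, ha, Algebra.smul_def]
      push_cast
      ring
  have hδ0 : (δ : E) ≠ 0 := nonZeroDivisors.ne_zero δ.2
  obtain ⟨m, hm⟩ := exists_pow_dvd_of_pow_dvd_mul t (c := (δ : E))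
    (fun x hx => (mul_eq_zero.1 hx).resolve_left hδ0) j
  refine ⟨m * n, fun x ⟨y, hy⟩ => hm x ?_⟩
  have ht' : algebraMap E (FractionRing E) t ≠ 0 := by simpa using ht
  have hint : IsIntegral E (algebraMap E (FractionRing E) x / algebraMap E (FractionRing E) t ^ m) := by
    refine IsIntegral.of_pow (n := n) (by omega) ?_
    rw [div_pow, ← map_pow, hy, ← pow_mul, map_mul, map_pow,
      mul_div_cancel_left₀ _ (pow_ne_zero _ ht')]
    exact isIntegral_algebraMap
  obtain ⟨w, hw⟩ := hδ' ⟨_, hint⟩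
  refine ⟨w, ?_⟩
  apply IsFractionRing.injective E (FractionRing E)
  rw [map_mul, map_mul, hw, map_pow]
  have := pow_ne_zero m ht'
  field_simp

theorem PowDvdReflects.of_quotients {A : Type*} [CommRing A] [IsNoetherianRing A]
    (h : ∀ P : Ideal A, P.IsPrime →
      Module.Finite (A ⧸ P) (integralClosure (A ⧸ P) (FractionRing (A ⧸ P)))) (t : A) :
    PowDvdReflects t := by
  intro P hP n hn j
  obtain ⟨k, hk⟩ := exists_pow_dvd_of_pow_dvd_pow (h P hP) (Ideal.Quotient.mk P t) n hn j
  refine ⟨k, fun x y hxy => ?_⟩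
  have := hk (Ideal.Quotient.mk P x) ⟨Ideal.Quotient.mk P y, by
    rw [← sub_eq_zero]; simpa using Ideal.Quotient.eq_zero_iff_mem.2 hxy⟩
  obtain ⟨z, hz⟩ := this
  obtain ⟨z, rfl⟩ := Ideal.Quotient.mk_surjective z
  refine ⟨z, Ideal.Quotient.eq_zero_iff_mem.1 ?_⟩
  simp [hz]

section AN
variable {A : Type*} [CommRing A]

/-- The homogeneous form `a ^ n + ∑ αᵢ ρ^(i+1) a^(n-1-i)`. -/
def homForm (n : ℕ) (α : ℕ → A) (ρ a : A) : A :=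
  a ^ n + ∑ i ∈ Finset.range n, α i * ρ ^ (i + 1) * a ^ (n - 1 - i)

theorem homForm_mul (n : ℕ) (α : ℕ → A) (r ρ a : A) :
    homForm n α (r * ρ) (r * a) = r ^ n * homForm n α ρ a := by
  unfold homForm
  rw [mul_add, mul_pow, Finset.mul_sum]
  congr 1
  refine Finset.sum_congr rfl fun i hi => ?_
  have : r ^ n = r ^ (i + 1) * r ^ (n - 1 - i) := by
    rw [← pow_add]; congr 1; have := Finset.mem_range.1 hi; omega
  rw [this, mul_pow, mul_pow]; ring

theorem sub_dvd_homForm_sub (n : ℕ) (α : ℕ → A) (ρ a b : A) :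
    a - b ∣ homForm n α ρ a - homForm n α ρ b := by
  unfold homForm
  rw [add_sub_add_comm, ← Finset.sum_sub_distrib]
  refine dvd_add (sub_dvd_pow_sub_pow _ _ _) (Finset.dvd_sum fun i _ => ?_)
  rw [← mul_sub]
  exact (sub_dvd_pow_sub_pow _ _ _).mul_left _

/-- Multipliers which turn an approximate integral equation for `a / ρ` into an approximate
divisibility by `ρ`. -/
def approxIdeal (t : A) (n : ℕ) (ρ : A) : Ideal A where
  carrier := {u | ∀ j : ℕ, ∃ k : ℕ, ∀ (a : A) (α : ℕ → A), t ^ k ∣ homForm n α ρ a →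
    ∃ w z, u * a = ρ * w + t ^ j * z}
  add_mem' := by
    intro u v hu hv j
    obtain ⟨k, hk⟩ := hu j
    obtain ⟨l, hl⟩ := hv j
    refine ⟨k + l, fun a α h => ?_⟩
    obtain ⟨w, z, h1⟩ := hk a α ((pow_dvd_pow t (by omega)).trans h)
    obtain ⟨w', z', h2⟩ := hl a α ((pow_dvd_pow t (by omega)).trans h)
    exact ⟨w + w', z + z', by rw [add_mul, h1, h2]; ring⟩
  zero_mem' := fun j => ⟨0, fun a α _ => ⟨0, 0, by ring⟩⟩
  smul_mem' := by
    intro c u hu j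
    obtain ⟨k, hk⟩ := hu j
    refine ⟨k, fun a α h => ?_⟩
    obtain ⟨w, z, h1⟩ := hk a α h
    exact ⟨c * w, c * z, by rw [smul_eq_mul, mul_assoc, h1]; ring⟩

theorem exists_mul_pow_of_mem_pow (P : Ideal A) (g ρ : A)
    (hz : ∀ x ∈ P, ρ ∣ g * x) (n : ℕ) : ∀ x ∈ P ^ n, ρ ^ n ∣ g ^ n * x := by
  induction n with
  | zero => intro x _; simp
  | succ n ih =>
    intro x hx
    rw [pow_succ] at hx
    induction hx using Submodule.mul_induction_on' with
    | mem_mul_mem m hm p hp =>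
      rw [pow_succ, pow_succ, show g ^ n * g * (m * p) = (g ^ n * m) * (g * p) by ring]
      exact mul_dvd_mul (ih m hm) (hz p hp)
    | add x _ y _ hx hy => rw [mul_add]; exact dvd_add hx hy

variable [IsDomain A] [IsNoetherianRing A]

theorem approxIdeal_not_le {t : A} (ht : PowDvdReflects t) {n : ℕ} (hn : 1 ≤ n) (P : Ideal A)
    [hP : P.IsPrime] {g ρ : A} (hρ : ρ ≠ 0) (hz : ∀ x ∈ P, ρ ∣ g * x)
    {x₀ v : A} (hx₀ : x₀ ∈ P) (hv : v ∉ P) (hv' : g * x₀ = ρ * v) (m : ℕ) :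
    ∀ ρ' : A, (∀ w ∉ P, w * ρ' ∉ P ^ m) → ¬ approxIdeal t n ρ' ≤ P := by
  induction m with
  | zero =>
    intro ρ' h
    exact absurd (by simp) (h 1 ((Ideal.ne_top_iff_one P).1 hP.ne_top))
  | succ m ih =>
    intro ρ' h
    by_cases hρ' : ρ' ∈ P
    swap
    · intro hle
      exact hρ' (hle (fun j => ⟨0, fun a α _ => ⟨a, 0, by ring⟩⟩))
    obtain ⟨ρ'', h''⟩ := hz ρ' hρ'
    have hkey : x₀ * ρ'' = v * ρ' := by
      apply mul_left_cancel₀ hρ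
      rw [show ρ * (x₀ * ρ'') = x₀ * (ρ * ρ'') by ring, ← h'',
        show x₀ * (g * ρ') = (g * x₀) * ρ' by ring, hv']; ring
    have hIH : ¬ approxIdeal t n ρ'' ≤ P := by
      refine ih ρ'' fun w hw hmem => h (v * w) (fun hh => (hP.mem_or_mem hh).elim hv hw) ?_
      rw [show v * w * ρ' = w * (v * ρ') by ring, ← hkey, pow_succ']
      rw [show w * (x₀ * ρ'') = x₀ * (w * ρ'') by ring]
      exact Ideal.mul_mem_mul hx₀ hmem
    obtain ⟨u, hu, huP⟩ := SetLike.not_le_iff_exists.1 hIH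
    refine fun hle => (fun hh => (hP.mem_or_mem hh).elim huP hv : u * v ∉ P) (hle ?_)
    intro j
    obtain ⟨k'', hk''⟩ := hu j
    obtain ⟨c, hc⟩ := artinRees_dvd t (P ^ n)
    obtain ⟨k1, hk1⟩ := ht P hP n hn (j + (k'' + c))
    refine ⟨k1 + (j + (k'' + c)), fun a α hrel => ?_⟩
    have hmem : homForm n α ρ' a - a ^ n ∈ P := by
      unfold homForm
      rw [add_sub_cancel_left]
      refine Ideal.sum_mem _ fun i _ => ?_
      rw [pow_succ]
      exact Ideal.mul_mem_right _ _ (Ideal.mul_mem_left _ _ (Ideal.mul_mem_left _ _ hρ'))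
    obtain ⟨q, hq⟩ := (pow_dvd_pow t (Nat.le_add_right k1 (j + (k'' + c)))).trans hrel
    obtain ⟨w, hw⟩ := hk1 a q (by rw [← hq, ← neg_sub]; exact neg_mem hmem)
    set a₁ := a - t ^ (j + (k'' + c)) * w with ha₁
    obtain ⟨a₂, ha₂⟩ := hz a₁ hw
    have hd : t ^ (j + (k'' + c)) ∣ homForm n α ρ' a₁ := by
      have h1 := (pow_dvd_pow t (Nat.le_add_left (j + (k'' + c)) k1)).trans hrel
      have h2 := sub_dvd_homForm_sub n α ρ' a a₁
      rw [show a - a₁ = t ^ (j + (k'' + c)) * w by rw [ha₁]; ring] at h2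
      exact (dvd_sub_right h1).1 ((dvd_mul_right _ _).trans h2)
    have hPn : homForm n α ρ' a₁ ∈ P ^ n := by
      unfold homForm
      refine add_mem (Ideal.pow_mem_pow hw n) (Ideal.sum_mem _ fun i hi => ?_)
      rw [mul_assoc]
      refine Ideal.mul_mem_left _ _ ?_
      have hi' : n = (i + 1) + (n - 1 - i) := by have := Finset.mem_range.1 hi; omega
      rw [show P ^ n = P ^ (i + 1) * P ^ (n - 1 - i) by rw [← pow_add, ← hi']]
      exact Ideal.mul_mem_mul (Ideal.pow_mem_pow hρ' _) (Ideal.pow_mem_pow hw _)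
    obtain ⟨y, hy, hy'⟩ := hc (j + k'') _ hPn (by rwa [add_assoc])
    obtain ⟨y', hyy⟩ := exists_mul_pow_of_mem_pow P g ρ hz n y hy
    have hF : homForm n α ρ'' a₂ = t ^ (j + k'') * y' := by
      apply mul_left_cancel₀ (pow_ne_zero n hρ)
      rw [← homForm_mul, ← h'', ← ha₂, homForm_mul, hy']
      linear_combination t ^ (j + k'') * hyy
    obtain ⟨w', z', hwz⟩ := hk'' a₂ α
      (by rw [hF]; exact (pow_dvd_pow t (Nat.le_add_left _ _)).mul_right _)
    have hxa : x₀ * a₂ = v * a₁ := by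
      apply mul_left_cancel₀ hρ
      linear_combination a₁ * hv' - x₀ * ha₂
    refine ⟨v * w', x₀ * z' + t ^ (k'' + c) * u * v * w, ?_⟩
    have ha : a = a₁ + t ^ j * t ^ (k'' + c) * w := by rw [ha₁, pow_add]; ring
    rw [ha]
    linear_combination x₀ * hwz - u * hxa + w' * hkey

theorem exists_mul_eq_and_notMem [IsIntegrallyClosed A] (P : Ideal A) {g ρ : A} (hρ : ρ ≠ 0)
    (hρP : ρ ∈ P) (hz : ∀ x ∈ P, ρ ∣ g * x) (hg : ¬ ρ ∣ g) :
    ∃ x₀ ∈ P, ∃ v ∉ P, g * x₀ = ρ * v := by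
  by_contra! hcon
  set K := FractionRing A
  have hρK : algebraMap A K ρ ≠ 0 := by simpa using hρ
  have hint : IsIntegral A (algebraMap A K g / algebraMap A K ρ) := by
    refine isIntegral_of_smul_mem_submodule (M := K) (Submodule.map (Algebra.linearMap A K) P) ?_
      ((IsNoetherian.noetherian P).map _) _ ?_
    · intro h
      have : algebraMap A K ρ ∈ Submodule.map (Algebra.linearMap A K) P := ⟨ρ, hρP, rfl⟩
      rw [h] at this
      exact hρK (by simpa using this)
    · rintro _ ⟨x, hx, rfl⟩
      obtain ⟨y, hy⟩ := hz x hx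
      have hyP : y ∈ P := by
        by_contra hh
        exact hcon x hx y hh hy
      refine ⟨y, hyP, ?_⟩
      simp only [Algebra.linearMap_apply, smul_eq_mul]
      rw [div_mul_eq_mul_div, eq_div_iff hρK, ← map_mul, ← map_mul, hy, mul_comm]
  obtain ⟨y, hy⟩ := IsIntegrallyClosed.isIntegral_iff.1 hint
  refine hg ⟨y, ?_⟩
  apply IsFractionRing.injective A K
  rw [map_mul, hy, mul_div_cancel₀ _ hρK]

theorem exists_forall_mul_notMem_pow (P : Ideal A) [P.IsPrime] {ρ : A} (hρ : ρ ≠ 0) :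
    ∃ m : ℕ, ∀ w ∉ P, w * ρ ∉ P ^ m := by
  by_contra! hcon
  set O := Localization.AtPrime P
  have h0 : algebraMap A O ρ ∈ ⨅ i : ℕ, IsLocalRing.maximalIdeal O ^ i := by
    rw [Submodule.mem_iInf]
    intro m
    obtain ⟨w, hw, hm⟩ := hcon m
    have h1 : algebraMap A O (w * ρ) ∈ IsLocalRing.maximalIdeal O ^ m := by
      rw [← Localization.AtPrime.map_eq_maximalIdeal, ← Ideal.map_pow]
      exact Ideal.mem_map_of_mem _ hm
    rw [map_mul] at h1
    exact (Ideal.unit_mul_mem_iff_mem _ (IsLocalization.map_units O (⟨w, hw⟩ : P.primeCompl))).1 h1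
  rw [Ideal.iInf_pow_eq_bot_of_isLocalRing _ (IsLocalRing.maximalIdeal.isMaximal O).ne_top,
    Ideal.mem_bot] at h0
  exact hρ ((injective_iff_map_eq_zero _).1
    (IsLocalization.injective O P.primeCompl_le_nonZeroDivisors) _ h0)

/-- An approximate integral equation for `a / ρ` over a normal domain forces `a` to be
approximately divisible by `ρ`. -/
theorem approx_dvd_of_approx_integral [IsIntegrallyClosed A] {t : A} (ht : PowDvdReflects t)
    {n : ℕ} (hn : 1 ≤ n) {ρ : A} (hρ : ρ ≠ 0) (j : ℕ) :
    ∃ k : ℕ, ∀ (a : A) (α : ℕ → A), t ^ k ∣ homForm n α ρ a → ∃ w z, a = ρ * w + t ^ j * z := by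
  set E := A ⧸ Ideal.span {ρ}
  have hmk : ∀ x : A, Ideal.Quotient.mk (Ideal.span {ρ}) x = 0 ↔ ρ ∣ x := fun x => by
    rw [Ideal.Quotient.eq_zero_iff_mem, Ideal.mem_span_singleton]
  have hfin : (associatedPrimes A E).Finite := associatedPrimes.finite A E
  have key : ∃ u ∈ approxIdeal t n ρ, ∀ P ∈ associatedPrimes A E, u ∉ P := by
    by_contra! hcon
    have hsub : ((approxIdeal t n ρ : Ideal A) : Set A) ⊆
        ⋃ P ∈ ((hfin.toFinset : Finset (Ideal A)) : Set (Ideal A)), (P : Set A) := by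
      intro u hu
      obtain ⟨P, hP, huP⟩ := hcon u hu
      exact Set.mem_biUnion (by simpa using hP) huP
    obtain ⟨P, hP, hle⟩ := (Ideal.subset_union_prime (f := id) ⊥ ⊥
      (fun P hP _ _ => ((hfin.mem_toFinset.1 hP).isPrime))).1 hsub
    rw [hfin.mem_toFinset, AssociatedPrimes.mem_iff, isAssociatedPrime_iff] at hP
    obtain ⟨hPp, x, hx⟩ := hP
    obtain ⟨g, rfl⟩ := Ideal.Quotient.mk_surjective x
    have hmem : ∀ y, y ∈ P ↔ ρ ∣ g * y := fun y => by
      rw [hx, Submodule.mem_colon_singleton, Submodule.mem_bot, ← hmk, mul_comm, map_mul]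
      rfl
    have hg : ¬ ρ ∣ g := fun h => hPp.ne_top ((Ideal.eq_top_iff_one _).2
      ((hmem 1).2 (by simpa using h)))
    have hρP : ρ ∈ P := (hmem ρ).2 (dvd_mul_left _ _)
    obtain ⟨x₀, hx₀, v, hv, hv'⟩ := exists_mul_eq_and_notMem P hρ hρP
      (fun y hy => (hmem y).1 hy) hg
    obtain ⟨m, hm⟩ := exists_forall_mul_notMem_pow P hρ
    exact approxIdeal_not_le ht hn P hρ (fun y hy => (hmem y).1 hy) hx₀ hv hv' m ρ hm hle
  obtain ⟨u, hu, huP⟩ := key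
  have hreg : ∀ x : E, Ideal.Quotient.mk (Ideal.span {ρ}) u * x = 0 → x = 0 := by
    intro x hx
    by_contra hx0
    have : u ∈ ⋃ p ∈ associatedPrimes A E, (p : Set A) := by
      rw [biUnion_associatedPrimes_eq_zero_divisors]
      exact ⟨x, hx0, by rw [Algebra.smul_def]; exact hx⟩
    obtain ⟨P, hP, h⟩ := Set.mem_iUnion₂.1 this
    exact huP P hP h
  obtain ⟨k', hk'⟩ := exists_pow_dvd_of_pow_dvd_mul (Ideal.Quotient.mk (Ideal.span {ρ}) t) hreg j
  obtain ⟨k, hk⟩ := hu k'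
  refine ⟨k, fun a α h => ?_⟩
  obtain ⟨w, z, hwz⟩ := hk a α h
  obtain ⟨y, hy⟩ := hk' (Ideal.Quotient.mk _ a) ⟨Ideal.Quotient.mk _ z, by
    rw [← map_mul, hwz, map_add, (hmk (ρ * w)).2 (dvd_mul_right _ _)]; simp⟩
  obtain ⟨y, rfl⟩ := Ideal.Quotient.mk_surjective y
  obtain ⟨w', hw'⟩ := (hmk (a - t ^ j * y)).1 (by rw [map_sub, hy]; simp)
  exact ⟨w', y, by rw [← hw']; ring⟩

end AN

section TFree
variable {Q B ι : Type*} [CommRing Q] [CommRing B] [Algebra Q B] [Fintype ι]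

/-- `c` induces a basis of `B / t B` over `Q / t Q`. -/
structure IsBasisMod (t : Q) (c : ι → B) : Prop where
  span : ∀ b : B, ∃ (q : ι → Q) (b' : B), b = ∑ i, q i • c i + algebraMap Q B t * b'
  indep : ∀ q : ι → Q, algebraMap Q B t ∣ ∑ i, q i • c i → ∀ i, t ∣ q i

variable {t : Q} {c : ι → B}

theorem IsBasisMod.span_pow (h : IsBasisMod t c) (N : ℕ) (b : B) :
    ∃ (q : ι → Q) (b' : B), b = ∑ i, q i • c i + algebraMap Q B t ^ N * b' := by
  induction N with
  | zero => exact ⟨0, b, by simp⟩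
  | succ N ih =>
    obtain ⟨q, b', rfl⟩ := ih
    obtain ⟨q', b'', rfl⟩ := h.span b'
    refine ⟨fun i => q i + t ^ N * q' i, b'', ?_⟩
    simp only [add_smul, Finset.sum_add_distrib, mul_smul, ← Finset.smul_sum]
    rw [Algebra.smul_def (t ^ N), map_pow]; ring

theorem IsBasisMod.indep_pow [IsDomain B] (h : IsBasisMod t c) (ht : algebraMap Q B t ≠ 0)
    (N : ℕ) : ∀ q : ι → Q, algebraMap Q B t ^ N ∣ ∑ i, q i • c i → ∀ i, t ^ N ∣ q i := by
  induction N with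
  | zero => intro q _ i; simp
  | succ N ih =>
    intro q hq i
    choose q' hq' using ih q ((pow_dvd_pow _ (Nat.le_succ N)).trans hq)
    have h1 : ∑ i, q i • c i = algebraMap Q B t ^ N * ∑ i, q' i • c i := by
      rw [Finset.mul_sum]
      refine Finset.sum_congr rfl fun i _ => ?_
      rw [hq' i, mul_smul, Algebra.smul_def (t ^ N), map_pow]
    rw [h1, pow_succ, mul_dvd_mul_iff_left (pow_ne_zero _ ht)] at hq
    rw [hq' i, pow_succ]
    exact mul_dvd_mul_left _ (h.indep _ hq i)

theorem IsBasisMod.dvd_of_dvd_smul (h : IsBasisMod t c) (htp : Prime t) {q : Q} (hq : ¬ t ∣ q)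
    {b : B} (hb : algebraMap Q B t ∣ q • b) : algebraMap Q B t ∣ b := by
  obtain ⟨r, b', rfl⟩ := h.span b
  rw [smul_add, dvd_add_left, Finset.smul_sum] at hb
  · simp_rw [← mul_smul] at hb
    have h1 : ∀ i, t ∣ r i := fun i => (htp.dvd_or_dvd (h.indep _ hb i)).resolve_left hq
    refine dvd_add (Finset.dvd_sum fun i _ => ?_) (dvd_mul_right _ _)
    obtain ⟨s, hs⟩ := h1 i
    rw [hs, mul_smul, Algebra.smul_def]
    exact dvd_mul_right _ _
  · rw [← Algebra.mul_smul_comm]; exact dvd_mul_right _ _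

theorem IsBasisMod.pow_dvd_of_pow_dvd_smul [IsDomain B] (h : IsBasisMod t c) (htp : Prime t)
    (ht : algebraMap Q B t ≠ 0)
    {q : Q} (hq : ¬ t ∣ q) (N : ℕ) : ∀ {b : B}, algebraMap Q B t ^ N ∣ q • b →
      algebraMap Q B t ^ N ∣ b := by
  induction N with
  | zero => intro b _; simp
  | succ N ih =>
    intro b hb
    obtain ⟨b', rfl⟩ := ih ((pow_dvd_pow _ (Nat.le_succ N)).trans hb)
    rw [← Algebra.mul_smul_comm, pow_succ, mul_dvd_mul_iff_left (pow_ne_zero _ ht)] at hb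
    rw [pow_succ]
    exact mul_dvd_mul_left _ (h.dvd_of_dvd_smul htp hq hb)

theorem IsBasisMod.exists_monic_dvd [Nontrivial Q] (h : IsBasisMod t c) (N : ℕ) (f : B) :
    ∃ G : Polynomial Q, G.Monic ∧ G.natDegree = Fintype.card ι ∧
      algebraMap Q B t ^ N ∣ Polynomial.aeval f G := by
  classical
  set I : Ideal B := Ideal.span {algebraMap Q B t ^ N}
  let φ : Module.End Q (B ⧸ I) := (Algebra.lmul Q (B ⧸ I)) (Ideal.Quotient.mk I f)
  have hspan : Submodule.span Q (Set.range fun i => (Ideal.Quotient.mk I (c i))) = ⊤ := by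
    rw [eq_top_iff]
    rintro x -
    obtain ⟨b, rfl⟩ := Ideal.Quotient.mk_surjective x
    obtain ⟨q, b', rfl⟩ := h.span_pow N b
    rw [map_add, map_sum]
    refine add_mem (sum_mem fun i _ => ?_) ?_
    · exact Submodule.smul_mem _ (q i) (Submodule.subset_span (Set.mem_range_self i))
    · rw [Ideal.Quotient.eq_zero_iff_mem.2 (Ideal.mem_span_singleton.2 (dvd_mul_right _ _))]
      exact zero_mem _
  have hfin : Module.Finite Q (B ⧸ I) :=
    ⟨⟨(Set.finite_range _).toFinset, by rw [Set.Finite.coe_toFinset]; exact hspan⟩⟩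
  obtain ⟨G, hG, hdeg, h0⟩ := LinearMap.exists_monic_and_natDegree_eq_and_aeval_eq_zero Q φ
  have hle : G.natDegree ≤ Fintype.card ι := by
    have h1 := Submodule.spanFinrank_span_le_encard (R := Q)
      (Set.range fun i => (Ideal.Quotient.mk I (c i)))
    rw [hspan, ← hdeg, ← Set.image_univ] at h1
    have h2 := h1.trans (Set.encard_image_le _ _)
    rw [Set.encard_univ, ENat.card_eq_coe_fintype_card] at h2
    exact_mod_cast h2
  refine ⟨G * Polynomial.X ^ (Fintype.card ι - G.natDegree), hG.mul (Polynomial.monic_X_pow _),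
    ?_, ?_⟩
  · rw [hG.natDegree_mul (Polynomial.monic_X_pow _), Polynomial.natDegree_X_pow]; omega
  · rw [map_mul]
    refine Dvd.dvd.mul_right ?_ _
    rw [← Ideal.mem_span_singleton]
    apply Ideal.Quotient.eq_zero_iff_mem.1
    have h1 : Polynomial.aeval (Ideal.Quotient.mk I f) G = 0 := by
      rw [Polynomial.aeval_algHom_apply] at h0
      have := congrArg (fun g : Module.End Q (B ⧸ I) => g 1) h0
      simpa using this
    rw [← h1]
    exact (Polynomial.aeval_algHom_apply (Ideal.Quotient.mkₐ Q I) f G).symm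

end TFree

section
variable {A : Type*} [CommRing A] [IsDomain A] [IsNoetherianRing A]  [IsIntegrallyClosed A]
/-- A localization of an integral extension of normal domains at a prime lying over a principal
prime is a discrete valuation ring. -/
theorem localization_isDVR {Q : Type*} [CommRing Q] [IsDomain Q] [IsNoetherianRing Q] [Algebra Q A]
    [FaithfulSMul Q A] [Algebra.IsIntegral Q A] {t : Q} (htp : Prime t) (p : Ideal A) [hp : p.IsPrime]
    (h : p.comap (algebraMap Q A) = Ideal.span {t}) :
    IsDiscreteValuationRing (Localization.AtPrime p) := by
  set O := Localization.AtPrime p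
  have hle := p.primeCompl_le_nonZeroDivisors
  have hinj : Function.Injective (algebraMap A O) := IsLocalization.injective O hle
  have : IsDomain O := IsLocalization.isDomain_localization hle
  have : IsNoetherianRing O := IsLocalization.isNoetherianRing p.primeCompl O inferInstance
  have : IsIntegrallyClosed O := isIntegrallyClosed_of_isLocalization O p.primeCompl hle
  have hQA : Function.Injective (algebraMap Q A) := FaithfulSMul.algebraMap_injective Q A
  have htp' : algebraMap Q A t ∈ p := by
    have : t ∈ p.comap (algebraMap Q A) := by rw [h]; exact Ideal.mem_span_singleton_self t
    exact this
  have hne : IsLocalRing.maximalIdeal O ≠ ⊥ := by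
    intro hb
    have : algebraMap A O (algebraMap Q A t) ∈ IsLocalRing.maximalIdeal O := by
      rw [← Localization.AtPrime.map_eq_maximalIdeal]
      exact Ideal.mem_map_of_mem _ htp'
    rw [hb, Ideal.mem_bot] at this
    exact htp.ne_zero (hQA (by rw [hinj (this.trans (map_zero _).symm), map_zero]))
  have hnf : ¬ IsField O := fun hh => hne (IsLocalRing.isField_iff_maximalIdeal_eq.1 hh)
  have htfae : IsDiscreteValuationRing O ↔
      IsIntegrallyClosed O ∧ ∃! P : Ideal O, P ≠ ⊥ ∧ P.IsPrime :=
    (IsDiscreteValuationRing.TFAE O hnf).out 0 3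
  refine htfae.2 ⟨inferInstance,
    IsLocalRing.maximalIdeal O, ⟨hne, inferInstance⟩, ?_⟩
  rintro P ⟨hP0, hP⟩
  have hPle : P ≤ IsLocalRing.maximalIdeal O := IsLocalRing.le_maximalIdeal hP.ne_top
  set P' := P.comap (algebraMap A O)
  have hP'p : P' ≤ p := by
    intro x hx
    have := hPle hx
    rw [← Localization.AtPrime.map_eq_maximalIdeal] at this
    exact (IsLocalization.AtPrime.to_map_mem_maximal_iff O p x).1
      (by rwa [Localization.AtPrime.map_eq_maximalIdeal] at this)
  have hP'0 : P' ≠ ⊥ := by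
    intro hb
    apply hP0
    rw [← IsLocalization.map_under p.primeCompl O P]
    change Ideal.map _ P' = ⊥
    rw [hb, Ideal.map_bot]
  have hPP : P' = p := by
    by_contra hne'
    obtain ⟨x, hx, hx'⟩ := SetLike.exists_of_lt (lt_of_le_of_ne hP'p hne')
    have hlt := Ideal.comap_lt_comap_of_integral_mem_sdiff (R := Q) hP'p
      (x := x) ⟨hx, hx'⟩ (Algebra.IsIntegral.isIntegral x)
    rw [h] at hlt
    have h0 : P'.comap (algebraMap Q A) ≠ ⊥ := fun hh =>
      hP'0 (Ideal.eq_bot_of_comap_eq_bot hh)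
    set P₀ := P'.comap (algebraMap Q A)
    have htP : t ∉ P₀ := fun hh => hlt.not_ge ((Ideal.span_singleton_le_iff_mem _).2 hh)
    obtain ⟨y, hy, hy0⟩ := Submodule.exists_mem_ne_zero_of_ne_bot h0
    have hdiv : ∀ n : ℕ, ∀ z ∈ P₀, t ^ n ∣ z := by
      intro n
      induction n with
      | zero => intro z _; simp
      | succ n ih =>
        intro z hz
        obtain ⟨w, rfl⟩ := Ideal.mem_span_singleton.1 (hlt.le hz)
        have hw : w ∈ P₀ := ((hP.comap _).comap _ |>.mem_or_mem hz).resolve_left htP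
        rw [pow_succ']
        exact mul_dvd_mul_left _ (ih w hw)
    obtain ⟨n, hn⟩ := FiniteMultiplicity.of_not_isUnit htp.not_isUnit hy0
    exact hn (hdiv _ y hy)
  rw [← IsLocalization.map_under p.primeCompl O P]
  change Ideal.map _ P' = _
  rw [hPP, Localization.AtPrime.map_eq_maximalIdeal]
end

section Approx
variable {Q A B ι : Type*} [CommRing Q] [IsDomain Q] [IsNoetherianRing Q] [IsIntegrallyClosed Q]
  [CommRing A] [IsDomain A] [IsIntegrallyClosed A] [Algebra Q A] [Module.Finite Q A]
  [FaithfulSMul Q A] [CommRing B] [IsDomain B] [Algebra Q B] [Algebra A B] [IsScalarTower Q A B]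
  [FaithfulSMul A B] [Fintype ι] {t : Q} {c : ι → B}

theorem exists_approx_of_not_le (htp : Prime t)
    (hfrac : ∀ b : B, ∃ y : A, y ≠ 0 ∧ ∃ x : A, algebraMap A B y * b = algebraMap A B x)
    (N : ℕ) (I : Ideal A)
    (hI : ∀ p : Ideal A, p.IsPrime →
      (∀ b : B, ∃ g ∉ p, ∃ u, algebraMap A B g * b = algebraMap A B u) → ¬ I ≤ p) :
    ∃ a ∈ I, ∃ q : Q, ¬ t ∣ q ∧ algebraMap Q B t ^ N ∣ algebraMap Q B q - algebraMap A B a := by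
  rcases Nat.eq_zero_or_pos N with rfl | hN
  · exact ⟨0, zero_mem _, 1, fun h => htp.not_isUnit (isUnit_of_dvd_one h), by simp⟩
  have hAB : Function.Injective (algebraMap A B) := FaithfulSMul.algebraMap_injective A B
  have hQA : Function.Injective (algebraMap Q A) := FaithfulSMul.algebraMap_injective Q A
  have : IsNoetherianRing A := IsNoetherianRing.of_finite Q A
  have : Algebra.IsIntegral Q A := inferInstance
  set J : Ideal A := (Ideal.span {algebraMap Q B t ^ N}).comap (algebraMap A B)
  have hJ : ∀ x, x ∈ J ↔ algebraMap Q B t ^ N ∣ algebraMap A B x := fun x => by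
    rw [Ideal.mem_comap, Ideal.mem_span_singleton]
  have htprime : (Ideal.span {t}).IsPrime := (Ideal.span_singleton_prime htp.ne_zero).2 htp
  set S := Algebra.algebraMapSubmonoid A (Ideal.span {t}).primeCompl
  have hnd : ¬ Disjoint ((I ⊔ J : Ideal A) : Set A) S := by
    intro hdis
    obtain ⟨p, hp, hle, hpS⟩ := Ideal.exists_le_prime_disjoint _ S hdis
    have hpt : p.comap (algebraMap Q A) = Ideal.span {t} := by
      apply le_antisymm
      · intro x hx
        by_contra hxt
        exact Set.disjoint_left.1 hpS hx ⟨x, hxt, rfl⟩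
      · rw [Ideal.span_singleton_le_iff_mem, Ideal.mem_comap]
        have : algebraMap Q A t ^ N ∈ J := by
          rw [hJ, map_pow, ← IsScalarTower.algebraMap_apply]
        exact hp.mem_of_pow_mem _ (hle (Ideal.mem_sup_right this))
    have hdvr := localization_isDVR htp p hpt
    set O := Localization.AtPrime p
    have hle' := p.primeCompl_le_nonZeroDivisors
    have : IsDomain O := IsLocalization.isDomain_localization hle'
    have hinj : Function.Injective (algebraMap A O) := IsLocalization.injective O hle'
    refine hI p hp (fun b => ?_) (le_sup_left.trans hle)
    obtain ⟨y, hy, x, hx⟩ := hfrac b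
    rcases ValuationRing.dvd_total (algebraMap A O y) (algebraMap A O x) with ⟨z, hz⟩ | ⟨z, hz⟩ <;>
      obtain ⟨⟨u, s⟩, rfl⟩ := IsLocalization.mk'_surjective p.primeCompl z
    · refine ⟨s, s.2, u, ?_⟩
      have h1 : x * s = y * u := by
        apply hinj
        rw [map_mul, hz, map_mul, mul_assoc, IsLocalization.mk'_spec]
      apply mul_left_cancel₀ (fun h => hy (hAB (by rw [h, map_zero])) : algebraMap A B y ≠ 0)
      rw [← map_mul (algebraMap A B) y u, ← h1, map_mul, ← hx]; ring
    · have h1 : y * s = x * u := by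
        apply hinj
        rw [map_mul, hz, map_mul, mul_assoc, IsLocalization.mk'_spec]
      have h2 : algebraMap A B u * b = algebraMap A B s := by
        apply mul_left_cancel₀ (fun h => hy (hAB (by rw [h, map_zero])) : algebraMap A B y ≠ 0)
        rw [← map_mul (algebraMap A B) y s, h1, map_mul, ← hx]; ring
      by_cases hu : u ∈ p
      swap
      · exact ⟨u, hu, s, h2⟩
      exfalso
      have hum : algebraMap A O u ∈ IsLocalRing.maximalIdeal O := by
        rw [← Localization.AtPrime.map_eq_maximalIdeal]
        exact Ideal.mem_map_of_mem _ hu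
      obtain ⟨ϖ, hϖ⟩ := IsDiscreteValuationRing.exists_irreducible O
      have ht0 : algebraMap A O (algebraMap Q A t ^ N) ≠ 0 := by
        intro h
        have h' := hinj (h.trans (map_zero _).symm)
        rw [← map_pow] at h'
        exact pow_ne_zero N htp.ne_zero (hQA (h'.trans (map_zero _).symm))
      obtain ⟨m, hm⟩ := IsDiscreteValuationRing.associated_pow_irreducible ht0 hϖ
      have hdvd : algebraMap A O (algebraMap Q A t ^ N) ∣ algebraMap A O (u ^ m) := by
        rw [map_pow (algebraMap A O) u m]
        refine hm.dvd.trans (pow_dvd_pow_of_dvd ?_ m)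
        rw [hϖ.maximalIdeal_eq] at hum
        exact Ideal.mem_span_singleton.1 hum
      obtain ⟨z, hz⟩ := hdvd
      obtain ⟨⟨v, w⟩, rfl⟩ := IsLocalization.mk'_surjective p.primeCompl z
      have h3 : u ^ m * w = algebraMap Q A t ^ N * v := by
        apply hinj
        rw [map_mul, hz, map_mul, mul_assoc, IsLocalization.mk'_spec]
      have h4 : (s : A) ^ m * w ∈ J := by
        rw [hJ]
        refine ⟨algebraMap A B v * b ^ m, ?_⟩
        rw [map_mul, map_pow, ← h2]
        have := congrArg (algebraMap A B) h3
        rw [map_mul, map_mul, map_pow, map_pow, ← IsScalarTower.algebraMap_apply] at this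
        linear_combination b ^ m * this
      have h5 := hle (Ideal.mem_sup_right h4)
      rcases hp.mem_or_mem h5 with h6 | h6
      · exact s.2 (hp.mem_of_pow_mem _ h6)
      · exact w.2 h6
  rw [Set.not_disjoint_iff] at hnd
  obtain ⟨_, hx, q, hq, rfl⟩ := hnd
  obtain ⟨a, ha, j, hj, hsum⟩ := Submodule.mem_sup.1 hx
  refine ⟨a, ha, q, fun h => hq (Ideal.mem_span_singleton.2 h), ?_⟩
  rw [IsScalarTower.algebraMap_apply Q A B q, ← hsum, map_add, add_sub_cancel_left]
  exact (hJ j).1 hj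

theorem exists_approx_mul_integral (htp : Prime t)
    (hfrac : ∀ b : B, ∃ y : A, y ≠ 0 ∧ ∃ x : A, algebraMap A B y * b = algebraMap A B x)
    (N : ℕ) (b : B) : ∃ (a : A) (q : Q) (u : A), ¬ t ∣ q ∧
      algebraMap Q B t ^ N ∣ algebraMap Q B q - algebraMap A B a ∧
      algebraMap A B a * b = algebraMap A B u := by
  let I : Ideal A :=
    { carrier := {a | ∃ u, algebraMap A B a * b = algebraMap A B u}
      add_mem' := by
        rintro x y ⟨u, hu⟩ ⟨v, hv⟩
        exact ⟨u + v, by rw [map_add, map_add, ← hu, ← hv]; ring⟩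
      zero_mem' := ⟨0, by simp⟩
      smul_mem' := by
        rintro x y ⟨u, hu⟩
        exact ⟨x * u, by rw [smul_eq_mul, map_mul, map_mul, ← hu]; ring⟩ }
  obtain ⟨a, ⟨u, hu⟩, q, hq, h⟩ := exists_approx_of_not_le (B := B) htp hfrac N I (by
    intro p hp hb hle
    obtain ⟨g, hg, u, hu⟩ := hb b
    exact hg (hle ⟨u, hu⟩))
  exact ⟨a, q, u, hq, h, hu⟩

theorem exists_approx_mul_pow_dvd (htp : Prime t)
    (hfrac : ∀ b : B, ∃ y : A, y ≠ 0 ∧ ∃ x : A, algebraMap A B y * b = algebraMap A B x)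
    (N : ℕ) : ∃ (a : A) (q : Q), ¬ t ∣ q ∧
      algebraMap Q B t ^ N ∣ algebraMap Q B q - algebraMap A B a ∧
      ∀ x : A, algebraMap Q B t ^ N ∣ algebraMap A B x → algebraMap Q A t ^ N ∣ a * x := by
  have hAB : Function.Injective (algebraMap A B) := FaithfulSMul.algebraMap_injective A B
  have : IsNoetherianRing A := IsNoetherianRing.of_finite Q A
  set J : Ideal A := (Ideal.span {algebraMap Q B t ^ N}).comap (algebraMap A B)
  have hJ : ∀ x, x ∈ J ↔ algebraMap Q B t ^ N ∣ algebraMap A B x := fun x => by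
    rw [Ideal.mem_comap, Ideal.mem_span_singleton]
  obtain ⟨a, ha, q, hq, h⟩ := exists_approx_of_not_le (B := B) htp hfrac N
    ((Ideal.span {algebraMap Q A t ^ N}).colon (J : Set A)) (by
    intro p hp hb hle
    obtain ⟨s, hs⟩ := IsNoetherian.noetherian J
    have hmem : ∀ x ∈ J, ∃ g ∉ p, algebraMap Q A t ^ N ∣ g * x := by
      intro x hx
      obtain ⟨b, hb'⟩ := (hJ x).1 hx
      obtain ⟨g, hg, u, hu⟩ := hb b
      refine ⟨g, hg, u, hAB ?_⟩
      rw [map_mul, map_mul, map_pow, ← IsScalarTower.algebraMap_apply, hb', ← hu]; ring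
    choose! g hg hgx using hmem
    have hs' : ∀ x ∈ s, x ∈ J := fun x hx => by rw [← hs]; exact Submodule.subset_span hx
    have hprod : ∏ x ∈ s, g x ∉ p := by
      rw [Ideal.IsPrime.prod_mem_iff]
      rintro ⟨x, hx, h⟩
      exact hg x (hs' x hx) h
    apply hprod
    apply hle
    rw [Submodule.mem_colon]
    intro x hx
    rw [← hs] at hx
    induction hx using Submodule.span_induction with
    | mem x hx =>
      rw [smul_eq_mul, Ideal.mem_span_singleton]
      exact (hgx x (hs' x hx)).trans (mul_dvd_mul_right (Finset.dvd_prod_of_mem g hx) x)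
    | zero => simp
    | add x y _ _ hx hy => rw [smul_add]; exact add_mem hx hy
    | smul r x _ hx => rw [smul_comm]; exact Submodule.smul_mem _ r hx)
  refine ⟨a, q, hq, h, fun x hx => ?_⟩
  have := Submodule.mem_colon.1 ha x ((hJ x).2 hx)
  exact Ideal.mem_span_singleton.1 this

end Approx

section FiniteNormalization
attribute [local instance] FractionRing.liftAlgebra

theorem finite_integralClosure_of_finiteType (k E : Type*) [Field k] [CharZero k] [CommRing E]
    [IsDomain E] [Algebra k E] [Algebra.FiniteType k E] :
    Module.Finite E (integralClosure E (FractionRing E)) := by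
  obtain ⟨s, g, hg, hfin⟩ := exists_finite_inj_algHom_of_fg k E
  let _ : Algebra (MvPolynomial (Fin s) k) E := g.toRingHom.toAlgebra
  have : FaithfulSMul (MvPolynomial (Fin s) k) E :=
    (faithfulSMul_iff_algebraMap_injective _ E).2 hg
  have : Module.Finite (MvPolynomial (Fin s) k) E := hfin
  have : Module.IsTorsionFree (MvPolynomial (Fin s) k) E :=
    Module.isTorsionFree_iff_faithfulSMul.2 inferInstance
  have : IsIntegralClosure (integralClosure E (FractionRing E)) (MvPolynomial (Fin s) k)
      (FractionRing E) := by
    refine ⟨Subtype.val_injective, fun {x} => ⟨fun hx => ⟨⟨x, hx.tower_top⟩, rfl⟩, ?_⟩⟩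
    rintro ⟨y, rfl⟩
    exact isIntegral_trans (R := MvPolynomial (Fin s) k) _ y.2
  have : Module.Finite (MvPolynomial (Fin s) k) (integralClosure E (FractionRing E)) :=
    IsIntegralClosure.finite (MvPolynomial (Fin s) k) (FractionRing (MvPolynomial (Fin s) k))
      (FractionRing E) _
  exact Module.Finite.of_restrictScalars_finite (MvPolynomial (Fin s) k) _ _

theorem powDvdReflects_of_finiteType (k : Type*) {A : Type*} [Field k] [CharZero k] [CommRing A]
    [Algebra k A] [Algebra.FiniteType k A] (t : A) : PowDvdReflects t := by
  have := Algebra.FiniteType.isNoetherianRing k A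
  exact .of_quotients (fun P _ => finite_integralClosure_of_finiteType k (A ⧸ P)) t

end FiniteNormalization

section DualElements
attribute [local instance] FractionRing.liftAlgebra
variable (Q A : Type*) [CommRing Q] [IsDomain Q] [IsNoetherianRing Q] [IsIntegrallyClosed Q]
  [CommRing A] [IsDomain A] [IsIntegrallyClosed A] [Algebra Q A] [Module.Finite Q A]
  [Module.IsTorsionFree Q A] [CharZero Q]

theorem exists_trace_dual_elements : ∃ (n : ℕ) (b e : Fin n → A) (D : Q), D ≠ 0 ∧
    (∀ x : A, D • x = ∑ j, Algebra.intTrace Q A (x * b j) • e j) ∧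
    ∀ x : A, D * Algebra.intTrace Q A x = ∑ j, Algebra.intTrace Q A (x * e j * b j) := by
  classical
  set K := FractionRing Q
  set L := FractionRing A
  have : IsIntegralClosure A Q L := IsIntegralClosure.of_isIntegrallyClosed _ _ _
  have : CharZero K := charZero_of_injective_algebraMap (IsFractionRing.injective Q K)
  obtain ⟨s, b₀, hb₀⟩ := FiniteDimensional.exists_is_basis_integral Q K L
  set β := b₀.reindex s.equivFin with hβ
  have hβint : ∀ j, IsIntegral Q (β j) := fun j => by
    rw [hβ, Module.Basis.reindex_apply]; exact hb₀ _
  set δ := β.traceDual with hδ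
  obtain ⟨D, hD, hint⟩ := exists_integral_multiples Q K (Finset.univ.image δ)
  have hδint : ∀ j, IsIntegral Q (D • δ j) := fun j =>
    hint _ (Finset.mem_image_of_mem _ (Finset.mem_univ j))
  choose b hb using fun j => (IsIntegralClosure.isIntegral_iff (A := A)).1 (hβint j)
  choose e he using fun j => (IsIntegralClosure.isIntegral_iff (A := A)).1 (hδint j)
  have hKL : Function.Injective (algebraMap A L) := IsFractionRing.injective A L
  have hQK : Function.Injective (algebraMap Q K) := IsFractionRing.injective Q K
  have htr : ∀ x, algebraMap Q K (Algebra.intTrace Q A x) = Algebra.trace K L (algebraMap A L x) :=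
    Algebra.algebraMap_intTrace_fractionRing
  have hsm : ∀ (q : Q) (x : L), q • x = algebraMap Q K q • x := fun q x => by
    rw [algebraMap_smul]
  refine ⟨_, b, e, D, hD, fun x => hKL ?_, fun x => hQK ?_⟩
  · have h := δ.sum_repr (algebraMap A L x)
    simp only [hδ, Module.Basis.traceDual_repr_apply, Algebra.traceForm_apply] at h
    rw [map_sum, Algebra.smul_def, map_mul, ← IsScalarTower.algebraMap_apply, ← Algebra.smul_def,
      ← h, Finset.smul_sum]
    refine Finset.sum_congr rfl fun j _ => ?_
    rw [Algebra.smul_def (_ : Q) (e j), map_mul (algebraMap A L), ← IsScalarTower.algebraMap_apply,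
      he, ← Algebra.smul_def (Algebra.intTrace Q A (x * b j)),
      hsm (Algebra.intTrace Q A (x * b j)), htr,
      map_mul (algebraMap A L), hb, smul_comm]
  · rw [map_mul, map_sum, htr, Algebra.trace_eq_matrix_trace δ, Matrix.trace, Finset.mul_sum]
    refine Finset.sum_congr rfl fun j _ => ?_
    rw [Matrix.diag_apply, Algebra.leftMulMatrix_eq_repr_mul, hδ,
      Module.Basis.traceDual_repr_apply, Algebra.traceForm_apply, htr,
      map_mul (algebraMap A L), map_mul (algebraMap A L), he, hb,
      hsm, mul_smul_comm, smul_mul_assoc, map_smul, smul_eq_mul]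

end DualElements

section Conductor
variable {Q A B ι : Type*} [CommRing Q] [IsDomain Q] [IsNoetherianRing Q] [IsIntegrallyClosed Q]
  [CommRing A] [IsDomain A] [IsIntegrallyClosed A] [Algebra Q A] [Module.Finite Q A]
  [FaithfulSMul Q A] [CommRing B] [IsDomain B] [Algebra Q B] [Algebra A B] [IsScalarTower Q A B]
  [FaithfulSMul A B] [Fintype ι] {t : Q} {c : ι → B}

theorem exists_common_approx (htp : Prime t)
    (hfrac : ∀ b : B, ∃ y : A, y ≠ 0 ∧ ∃ x : A, algebraMap A B y * b = algebraMap A B x)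
    (N : ℕ) (c : ι → B) : ∃ (r : Q) (c' : ι → A), ¬ t ∣ r ∧
      ∀ i, algebraMap Q B t ^ N ∣ algebraMap Q B r * c i - algebraMap A B (c' i) := by
  classical
  choose a q u hq hqa hu using fun i => exists_approx_mul_integral htp hfrac N (c i)
  refine ⟨∏ i, q i, fun i => algebraMap Q A (∏ j ∈ Finset.univ.erase i, q j) * u i, ?_,
    fun i => ?_⟩
  · rw [htp.dvd_finsetProd_iff]
    rintro ⟨i, -, hi⟩
    exact hq i hi
  · obtain ⟨z, hz⟩ := hqa i
    refine ⟨algebraMap Q B (∏ j ∈ Finset.univ.erase i, q j) * z * c i, ?_⟩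
    rw [← Finset.mul_prod_erase _ _ (Finset.mem_univ i), map_mul, map_mul, ← hu,
      ← IsScalarTower.algebraMap_apply]
    linear_combination (algebraMap Q B (∏ j ∈ Finset.univ.erase i, q j) * c i) * hz

theorem exists_conductor_approx [CharZero Q] (htp : Prime t) (hc : IsBasisMod t c)
    (hfrac : ∀ b : B, ∃ y : A, y ≠ 0 ∧ ∃ x : A, algebraMap A B y * b = algebraMap A B x) :
    ∃ D : Q, D ≠ 0 ∧ ∀ N : ℕ, ∃ α : A,
      algebraMap Q B t ^ N ∣ algebraMap Q B D - algebraMap A B α ∧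
      ∀ y : A, algebraMap Q B t ^ N ∣ algebraMap A B y →
        algebraMap Q A t ^ N ∣ algebraMap Q A D * (α * y) := by
  have hAB : Function.Injective (algebraMap A B) := FaithfulSMul.algebraMap_injective A B
  have hQA : Function.Injective (algebraMap Q A) := FaithfulSMul.algebraMap_injective Q A
  have htB : algebraMap Q B t ≠ 0 := by
    rw [IsScalarTower.algebraMap_apply Q A B]
    exact fun h => htp.ne_zero (hQA ((hAB (h.trans (map_zero _).symm)).trans (map_zero _).symm))
  obtain ⟨n, b, e, D, hD, hT1, hT2⟩ := exists_trace_dual_elements Q A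
  set T := Algebra.intTrace Q A
  refine ⟨D ^ 2, pow_ne_zero 2 hD, fun N => ?_⟩
  obtain ⟨a, q, hq, ⟨z, hz⟩, ha⟩ := exists_approx_mul_pow_dvd htp hfrac N
  obtain ⟨r, c', hr, hc'⟩ := exists_common_approx htp hfrac N c
  choose zc hzc using hc'
  choose p ze hp using fun j => hc.span_pow N (algebraMap A B (e j))
  choose Y zY hY using fun l i => hc.span_pow N (algebraMap A B (b l) * c i)
  simp only [Algebra.smul_def] at hp hY hT1
  have hdvd : ∀ x y : A, algebraMap Q A t ^ N * x = y → ∀ b', t ^ N ∣ T (y * b') := by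
    rintro x _ rfl b'
    rw [← map_pow, mul_assoc, ← Algebra.smul_def, map_smul]
    exact dvd_mul_right _ _
  have h1 : ∀ l, t ^ N ∣ r * (D * T (a * b l)) - ∑ i, ∑ j, T (a * b l * c' i * b j) * p j i := by
    intro l
    rw [hT2, Finset.sum_comm, Finset.mul_sum, ← Finset.sum_sub_distrib]
    refine Finset.dvd_sum fun j _ => ?_
    obtain ⟨w, hw⟩ := ha (algebraMap Q A r * e j - ∑ i, algebraMap Q A (p j i) * c' i) (by
      refine ⟨algebraMap Q B r * ze j + ∑ i, algebraMap Q B (p j i) * zc i, ?_⟩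
      have h2 : ∑ i, algebraMap Q B (p j i) * algebraMap A B (c' i) =
          algebraMap Q B r * ∑ i, algebraMap Q B (p j i) * c i -
            algebraMap Q B t ^ N * ∑ i, algebraMap Q B (p j i) * zc i := by
        rw [Finset.mul_sum, Finset.mul_sum, ← Finset.sum_sub_distrib]
        refine Finset.sum_congr rfl fun i _ => ?_
        linear_combination - algebraMap Q B (p j i) * hzc i
      simp only [map_sub, map_mul, map_sum, ← IsScalarTower.algebraMap_apply, hp, h2]
      ring)
    have := hdvd w _ hw.symm (b l * b j)
    have h3 : T (a * (algebraMap Q A r * e j - ∑ i, algebraMap Q A (p j i) * c' i) *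
        (b l * b j)) = r * T (a * b l * e j * b j) - ∑ i, T (a * b l * c' i * b j) * p j i := by
      have : a * (algebraMap Q A r * e j - ∑ i, algebraMap Q A (p j i) * c' i) *
        (b l * b j) = r • (a * b l * e j * b j) - ∑ i, p j i • (a * b l * c' i * b j) := by
        simp only [Algebra.smul_def]
        rw [mul_sub, sub_mul, Finset.mul_sum, Finset.sum_mul]
        congr 1
        · ring
        · exact Finset.sum_congr rfl fun i _ => by ring
      rw [this, map_sub, map_smul, map_sum, smul_eq_mul]
      congr 1
      exact Finset.sum_congr rfl fun i _ => by rw [map_smul, smul_eq_mul, mul_comm]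
    rwa [h3] at this
  have h2 : ∀ l i m, t ^ N ∣ D * q * r * Y l i m - ∑ j, T (a * b l * c' i * b j) * p j m := by
    intro l i
    apply hc.indep_pow htB N
    have h4 := congrArg (algebraMap A B) (hT1 (a * b l * c' i))
    simp only [map_mul, map_sum, ← IsScalarTower.algebraMap_apply, hp] at h4
    simp only [Algebra.smul_def, map_sub, map_mul, map_sum, sub_mul, Finset.sum_sub_distrib]
    have h5 : ∑ m, (∑ j, algebraMap Q B (T (a * b l * c' i * b j)) * algebraMap Q B (p j m)) * c m
        = ∑ j, algebraMap Q B (T (a * b l * c' i * b j)) * ∑ m, algebraMap Q B (p j m) * c m := by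
      simp only [Finset.sum_mul, Finset.mul_sum]
      rw [Finset.sum_comm]
      exact Finset.sum_congr rfl fun _ _ => Finset.sum_congr rfl fun _ _ => by ring
    simp only [mul_add, Finset.sum_add_distrib] at h4
    rw [h5]
    have h6 : ∑ m, algebraMap Q B D * algebraMap Q B q * algebraMap Q B r *
        algebraMap Q B (Y l i m) * c m = algebraMap Q B D * algebraMap Q B q * algebraMap Q B r *
        ∑ m, algebraMap Q B (Y l i m) * c m := by
      rw [Finset.mul_sum]
      exact Finset.sum_congr rfl fun _ _ => by ring
    have h7 : ∑ j, algebraMap Q B (T (a * b l * c' i * b j)) * (algebraMap Q B t ^ N * ze j) =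
        algebraMap Q B t ^ N * ∑ j, algebraMap Q B (T (a * b l * c' i * b j)) * ze j := by
      rw [Finset.mul_sum]
      exact Finset.sum_congr rfl fun _ _ => by ring
    rw [h7] at h4
    rw [h6]
    set s1 := ∑ j, algebraMap Q B (T (a * b l * c' i * b j)) * ∑ m, algebraMap Q B (p j m) * c m
    set s2 := ∑ j, algebraMap Q B (T (a * b l * c' i * b j)) * ze j
    have h8 := hY l i
    have h9 := hzc i
    set s3 := ∑ m, algebraMap Q B (Y l i m) * c m
    refine ⟨s2 - algebraMap Q B D * algebraMap Q B q * algebraMap Q B r * zY l i +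
      algebraMap Q B D * algebraMap A B (b l) * (algebraMap Q B q * zc i +
        z * algebraMap A B (c' i)), ?_⟩
    linear_combination h4 - algebraMap Q B D * algebraMap Q B q * algebraMap Q B r * h8 +
      algebraMap Q B D * algebraMap A B (b l) * (algebraMap Q B q * h9 +
        hz * algebraMap A B (c' i))
  set y : Fin n → Q := fun l => ∑ i, Y l i i
  have h3 : ∀ l, t ^ N ∣ D * T (a * b l) - q * (D * y l) := by
    intro l
    apply htp.pow_dvd_of_dvd_mul_left N hr
    have h4 : t ^ N ∣ ∑ i, (D * q * r * Y l i i - ∑ j, T (a * b l * c' i * b j) * p j i) :=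
      Finset.dvd_sum fun i _ => h2 l i i
    rw [Finset.sum_sub_distrib, ← Finset.mul_sum] at h4
    have h5 := dvd_sub (h1 l) h4
    convert h5 using 1
    ring
  choose w hw using h3
  have h4 : algebraMap Q A D ^ 2 * a - algebraMap Q A q * ∑ l, algebraMap Q A (D * y l) * e l =
      algebraMap Q A t ^ N * ∑ l, algebraMap Q A (w l) * e l := by
    rw [sq, mul_assoc, hT1 a, Finset.mul_sum, Finset.mul_sum, Finset.mul_sum,
      ← Finset.sum_sub_distrib]
    refine Finset.sum_congr rfl fun l _ => ?_
    have := congrArg (algebraMap Q A) (hw l)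
    simp only [map_sub, map_mul, map_pow] at this ⊢
    linear_combination e l * this
  set α := ∑ l, algebraMap Q A (D * y l) * e l
  set w' := ∑ l, algebraMap Q A (w l) * e l
  refine ⟨α, ?_, fun x hx => ?_⟩
  · apply hc.pow_dvd_of_pow_dvd_smul htp htB hq N
    have h5 := congrArg (algebraMap A B) h4
    simp only [map_sub, map_mul, map_pow, ← IsScalarTower.algebraMap_apply] at h5
    refine ⟨algebraMap Q B D ^ 2 * z + algebraMap A B w', ?_⟩
    rw [Algebra.smul_def, map_pow]
    linear_combination algebraMap Q B D ^ 2 * hz + h5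
  · obtain ⟨v, hv⟩ := ha x hx
    have h5 : algebraMap Q A q * (α * x) = algebraMap Q A t ^ N *
        (algebraMap Q A D ^ 2 * v - w' * x) := by
      linear_combination algebraMap Q A D ^ 2 * hv - x * h4
    have h6 : ∀ j, t ^ N ∣ T (α * x * b j) := by
      intro j
      apply htp.pow_dvd_of_dvd_mul_left N hq
      have := hdvd _ _ h5.symm (b j)
      rwa [mul_assoc, ← Algebra.smul_def, map_smul, smul_eq_mul] at this
    rw [map_pow, sq, mul_assoc, hT1 (α * x)]
    refine Dvd.dvd.mul_left (Finset.dvd_sum fun j _ => Dvd.dvd.mul_right ?_ _) _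
    rw [← map_pow]
    exact map_dvd _ (h6 j)

end Conductor

section Core
variable {Q A B ι : Type*} [CommRing Q] [IsDomain Q] [IsNoetherianRing Q] [IsIntegrallyClosed Q]
  [CommRing A] [IsDomain A] [IsIntegrallyClosed A] [Algebra Q A] [Module.Finite Q A]
  [FaithfulSMul Q A] [CommRing B] [IsDomain B] [Algebra Q B] [Algebra A B] [IsScalarTower Q A B]
  [FaithfulSMul A B] [Fintype ι] {t : Q} {c : ι → B}

theorem exists_pow_eq_mul_not_dvd (htp : Prime t) {D : Q} (hD : D ≠ 0) :
    ∃ (δ : ℕ) (D' : Q), ¬ t ∣ D' ∧ D = t ^ δ * D' := by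
  have hfin : FiniteMultiplicity t D := FiniteMultiplicity.of_not_isUnit htp.not_isUnit hD
  obtain ⟨D', h1, h2⟩ := hfin.exists_eq_pow_mul_and_not_dvd
  exact ⟨_, D', h2, h1⟩

theorem exists_approx_one [CharZero Q] (htp : Prime t) (hc : IsBasisMod t c)
    (hfrac : ∀ b : B, ∃ y : A, y ≠ 0 ∧ ∃ x : A, algebraMap A B y * b = algebraMap A B x)
    (hA : PowDvdReflects (algebraMap Q A t)) (κ : ℕ) :
    ∃ (N : ℕ) (e : A), algebraMap Q B t ∣ 1 - algebraMap A B e ∧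
      ∀ y : A, algebraMap Q B t ^ N ∣ algebraMap A B y → algebraMap Q A t ^ κ ∣ e * y := by
  have hAB : Function.Injective (algebraMap A B) := FaithfulSMul.algebraMap_injective A B
  have hQA : Function.Injective (algebraMap Q A) := FaithfulSMul.algebraMap_injective Q A
  have : IsNoetherianRing A := IsNoetherianRing.of_finite Q A
  have htB : algebraMap Q B t ≠ 0 := by
    rw [IsScalarTower.algebraMap_apply Q A B]
    exact fun h => htp.ne_zero (hQA ((hAB (h.trans (map_zero _).symm)).trans (map_zero _).symm))
  obtain ⟨D, hD, hα⟩ := exists_conductor_approx (A := A) htp hc hfrac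
  obtain ⟨δ, D', hD', hDD⟩ := exists_pow_eq_mul_not_dvd htp hD
  set DA := algebraMap Q A D with hDA
  have hDA0 : DA ≠ 0 := fun h => hD (hQA (h.trans (map_zero _).symm))
  obtain ⟨k₀, hk₀⟩ := exists_pow_dvd_of_pow_dvd_mul (algebraMap Q A t) (c := DA ^ 2)
    (fun x hx => (mul_eq_zero.1 hx).resolve_left (pow_ne_zero 2 hDA0)) κ
  set j := max (2 * δ + 1) k₀
  obtain ⟨k, hk⟩ := approx_dvd_of_approx_integral hA (n := 2) (by norm_num)
    (ρ := DA ^ 2) (pow_ne_zero 2 hDA0) j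
  obtain ⟨α, hα1, hα2⟩ := hα (max k j)
  obtain ⟨e, w, he⟩ := hk (DA * α) (fun i => if i = 0 then -1 else 0) (by
    have h := hα2 (DA - α) (by
      rwa [map_sub, hDA, ← IsScalarTower.algebraMap_apply])
    have h1 : homForm 2 (fun i => if i = 0 then (-1 : A) else 0) (DA ^ 2) (DA * α) =
        - DA * (DA * (α * (DA - α))) := by
      simp [homForm]; ring
    rw [h1]
    exact Dvd.dvd.mul_left ((pow_dvd_pow _ (le_max_left _ _)).trans h) _)
  refine ⟨max k j, e, ?_, fun y hy => ?_⟩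
  · have hd : algebraMap Q B t ^ (2 * δ + 1) ∣
        algebraMap Q B D ^ 2 * (1 - algebraMap A B e) := by
      have h1 := congrArg (algebraMap A B) he
      simp only [map_add, map_mul, map_pow, hDA, ← IsScalarTower.algebraMap_apply] at h1
      have h2 : algebraMap Q B D ^ 2 * (1 - algebraMap A B e) =
          algebraMap Q B D * (algebraMap Q B D - algebraMap A B α) +
            algebraMap Q B t ^ j * algebraMap A B w := by
        linear_combination h1
      rw [h2]
      refine dvd_add (Dvd.dvd.mul_left ((pow_dvd_pow _ ?_).trans hα1) _)
        (Dvd.dvd.mul_right (pow_dvd_pow _ ?_) _)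
      · exact (le_max_left _ _).trans (le_max_right _ _)
      · exact le_max_left _ _
    have h3 : algebraMap Q B D ^ 2 * (1 - algebraMap A B e) =
        algebraMap Q B t ^ (2 * δ) * (D' ^ 2 • (1 - algebraMap A B e)) := by
      rw [hDD, map_mul, map_pow, Algebra.smul_def, map_pow]; ring
    rw [h3, pow_succ, mul_dvd_mul_iff_left (pow_ne_zero _ htB)] at hd
    exact hc.dvd_of_dvd_smul htp (fun h => hD' (htp.dvd_of_dvd_pow h)) hd
  · apply hk₀
    have h1 := hα2 y hy
    have h2 : DA ^ 2 * (e * y) = DA * (α * y) - algebraMap Q A t ^ j * (w * y) := by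
      linear_combination - y * he
    rw [h2]
    refine dvd_sub ((pow_dvd_pow _ ?_).trans h1) (Dvd.dvd.mul_right (pow_dvd_pow _ ?_) _)
    · exact (le_max_right _ _).trans (le_max_right _ _)
    · exact le_max_right _ _

theorem algebraMap_homForm_eq {n : ℕ} {f : B} {d h : A} (H : Polynomial Q) (hH : H.Monic)
    (hn : H.natDegree = n) (hf : algebraMap A B d * f = algebraMap A B h) :
    algebraMap A B (homForm n (fun i => algebraMap Q A (H.coeff (n - 1 - i))) d h) =
      algebraMap A B d ^ n * Polynomial.aeval f H := by
  have hlead : H.coeff n = 1 := by rw [← hn]; exact hH.coeff_natDegree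
  rw [homForm, map_add, map_pow, ← hf, map_sum, Polynomial.aeval_eq_sum_range, hn,
    Finset.sum_range_succ, hlead, one_smul, mul_add, add_comm, mul_pow]
  congr 1
  rw [← Finset.sum_range_reflect, Finset.mul_sum]
  refine Finset.sum_congr rfl fun i hi => ?_
  have hi' := Finset.mem_range.1 hi
  have h1 : n - 1 - (n - 1 - i) = i := by omega
  have h2 : algebraMap A B d ^ n = algebraMap A B d ^ (n - 1 - i + 1) * algebraMap A B d ^ i := by
    rw [← pow_add]; congr 1; omega
  rw [h1, map_mul, map_mul, map_pow, map_pow, ← hf, ← IsScalarTower.algebraMap_apply,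
    Algebra.smul_def, mul_pow]
  rw [h2]; ring

theorem exists_approx_one_mul_mem [CharZero Q] (htp : Prime t) (hc : IsBasisMod t c)
    (hfrac : ∀ b : B, ∃ y : A, y ≠ 0 ∧ ∃ x : A, algebraMap A B y * b = algebraMap A B x)
    (hA : PowDvdReflects (algebraMap Q A t)) (f : B) :
    ∃ e u : A, algebraMap Q B t ∣ 1 - algebraMap A B e ∧
      algebraMap A B e * f = algebraMap A B u := by
  have hAB : Function.Injective (algebraMap A B) := FaithfulSMul.algebraMap_injective A B
  have : IsNoetherianRing A := IsNoetherianRing.of_finite Q A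
  obtain ⟨d, hd, h, hf⟩ := hfrac f
  obtain ⟨c₀, hc₀⟩ := artinRees_dvd (algebraMap Q A t) (Ideal.span {d, h})
  set n := Fintype.card ι + 1
  obtain ⟨k, hk⟩ := approx_dvd_of_approx_integral hA (n := n) (by omega) hd (1 + c₀)
  obtain ⟨N, e, he1, he2⟩ := exists_approx_one htp hc hfrac hA k
  obtain ⟨G, hG, hGn, hGd⟩ := hc.exists_monic_dvd N f
  set H := G * Polynomial.X
  have hH : H.Monic := hG.mul Polynomial.monic_X
  have hHn : H.natDegree = n := by
    rw [hG.natDegree_mul Polynomial.monic_X, hGn, Polynomial.natDegree_X]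
  have hHd : algebraMap Q B t ^ N ∣ Polynomial.aeval f H := by
    rw [map_mul]; exact hGd.mul_right _
  have hform := he2 _ (by
    rw [algebraMap_homForm_eq H hH hHn hf]
    exact hHd.mul_left _)
  set α : ℕ → A := fun i => algebraMap Q A (H.coeff (n - 1 - i))
  have hscale : homForm n (fun i => e ^ (i + 1) * α i) d (e * h) = e ^ n * homForm n α d h := by
    rw [homForm, homForm, mul_add, mul_pow, Finset.mul_sum]
    congr 1
    refine Finset.sum_congr rfl fun i hi => ?_
    have hi' := Finset.mem_range.1 hi
    have h2 : e ^ n = e ^ (n - 1 - i) * e ^ (i + 1) := by rw [← pow_add]; congr 1; omega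
    rw [h2]; ring
  obtain ⟨w, z, hwz⟩ := hk (e * h) (fun i => e ^ (i + 1) * α i) (by
    rw [hscale, pow_succ, mul_assoc]
    exact hform.mul_left _)
  obtain ⟨y, hy, hyx⟩ := hc₀ 1 (e * h - d * w) (sub_mem
    (Ideal.mul_mem_left _ _ (Ideal.subset_span (by simp)))
    (Ideal.mul_mem_right _ _ (Ideal.subset_span (by simp)))) ⟨z, by linear_combination hwz⟩
  obtain ⟨w₁, w₂, rfl⟩ := Ideal.mem_span_pair.1 hy
  refine ⟨e - algebraMap Q A t * w₂, w + algebraMap Q A t * w₁, ?_, ?_⟩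
  · rw [map_sub, map_mul, ← IsScalarTower.algebraMap_apply, ← sub_add]
    exact dvd_add he1 (dvd_mul_right _ _)
  · apply mul_left_cancel₀ (fun h => hd (hAB (by rw [h, map_zero])) : algebraMap A B d ≠ 0)
    rw [mul_left_comm, hf, ← map_mul, ← map_mul]
    congr 1
    linear_combination hyx

theorem finiteType_of_isBasisMod [CharZero Q] (k : Type*) [Field k] [Algebra k A] [Algebra k B]
    [IsScalarTower k A B] [Algebra.FiniteType k A]
    (htp : Prime t) (hc : IsBasisMod t c)
    (hfrac : ∀ b : B, ∃ y : A, y ≠ 0 ∧ ∃ x : A, algebraMap A B y * b = algebraMap A B x)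
    (hA : PowDvdReflects (algebraMap Q A t)) (F : Finset B)
    (hF : ∀ b : B, ∃ N : ℕ, algebraMap Q B t ^ N * b ∈ Algebra.adjoin k (F : Set B)) :
    Algebra.FiniteType k B := by
  classical
  have hAB : Function.Injective (algebraMap A B) := FaithfulSMul.algebraMap_injective A B
  have : IsNoetherianRing A := IsNoetherianRing.of_finite Q A
  have htB : algebraMap Q B t ≠ 0 := by
    rw [IsScalarTower.algebraMap_apply Q A B]
    exact fun h => htp.ne_zero (FaithfulSMul.algebraMap_injective Q A
      ((hAB (h.trans (map_zero _).symm)).trans (map_zero _).symm))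
  set J : Ideal A := (Ideal.span {algebraMap Q B t}).comap (algebraMap A B)
  have hJ : ∀ x, x ∈ J ↔ algebraMap Q B t ∣ algebraMap A B x := fun x => by
    rw [Ideal.mem_comap, Ideal.mem_span_singleton]
  obtain ⟨s, hs⟩ := IsNoetherian.noetherian J
  have hsJ : ∀ x ∈ s, x ∈ J := fun x hx => by rw [← hs]; exact Submodule.subset_span hx
  choose! g hg using fun x hx => (hJ x).1 (hsJ x hx)
  choose e₀ u₀ he₀ hu₀ using exists_approx_one_mul_mem htp hc hfrac hA
  set E := F ∪ s.image g
  set e := ∏ x ∈ E, e₀ x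
  have he1 : algebraMap Q B t ∣ 1 - algebraMap A B e := by
    rw [← Ideal.mem_span_singleton, ← Ideal.Quotient.eq_zero_iff_mem, map_sub, sub_eq_zero,
      map_prod, map_prod, map_one]
    refine (Finset.prod_eq_one fun x _ => ?_).symm
    rw [← sub_eq_zero, ← map_one (Ideal.Quotient.mk _), ← map_sub,
      Ideal.Quotient.eq_zero_iff_mem, Ideal.mem_span_singleton, ← neg_sub, dvd_neg]
    exact he₀ x
  have heE : ∀ x ∈ E, ∃ u, algebraMap A B e * x = algebraMap A B u := by
    intro x hx
    refine ⟨(∏ y ∈ E.erase x, e₀ y) * u₀ x, ?_⟩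
    rw [map_mul, ← hu₀, ← mul_assoc, ← map_mul, mul_comm (∏ y ∈ E.erase x, e₀ y),
      Finset.mul_prod_erase E e₀ hx]
  have heJ : ∀ y ∈ J, algebraMap Q A t ∣ e * y := by
    intro y hy
    rw [← hs] at hy
    induction hy using Submodule.span_induction with
    | mem x hx =>
      obtain ⟨u, hu⟩ := heE (g x)
        (Finset.mem_union_right _ (Finset.mem_image_of_mem g hx))
      refine ⟨u, hAB ?_⟩
      rw [map_mul, map_mul, hg x hx, ← hu, ← IsScalarTower.algebraMap_apply]; ring
    | zero => simp
    | add x y _ _ hx hy => rw [mul_add]; exact dvd_add hx hy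
    | smul r x _ hx => rw [smul_eq_mul, mul_left_comm]; exact hx.mul_left _
  have hpow : ∀ N (b : B), (∃ a, algebraMap Q B t ^ N * b = algebraMap A B a) →
      ∃ a, algebraMap A B e ^ N * b = algebraMap A B a := by
    intro N
    induction N with
    | zero => intro b h; simpa using h
    | succ N ih =>
      rintro b ⟨a, ha⟩
      obtain ⟨a', ha'⟩ := heJ a ((hJ a).2 ⟨_, by rw [← ha, pow_succ', mul_assoc]⟩)
      obtain ⟨x, hx⟩ := ih (algebraMap A B e * b) ⟨a', by
        apply mul_left_cancel₀ htB
        have := congrArg (algebraMap A B) ha'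
        rw [map_mul, map_mul, ← IsScalarTower.algebraMap_apply, ← ha] at this
        rw [← this]; ring⟩
      exact ⟨x, by rw [← hx]; ring⟩
  have hadj : ∀ x ∈ Algebra.adjoin k (F : Set B),
      ∃ M a, algebraMap A B e ^ M * x = algebraMap A B a := by
    intro x hx
    induction hx using Algebra.adjoin_induction with
    | mem x hx =>
      obtain ⟨u, hu⟩ := heE x (Finset.mem_union_left _ hx)
      exact ⟨1, u, by rw [pow_one, hu]⟩
    | algebraMap r => exact ⟨0, algebraMap k A r, by simp [← IsScalarTower.algebraMap_apply]⟩
    | add x y _ _ hx hy =>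
      obtain ⟨M, a, ha⟩ := hx
      obtain ⟨M', a', ha'⟩ := hy
      refine ⟨M + M', e ^ M' * a + e ^ M * a', ?_⟩
      rw [map_add, map_mul, map_mul, ← ha, ← ha', map_pow, map_pow]; ring
    | mul x y _ _ hx hy =>
      obtain ⟨M, a, ha⟩ := hx
      obtain ⟨M', a', ha'⟩ := hy
      refine ⟨M + M', a * a', ?_⟩
      rw [map_mul, ← ha, ← ha']; ring
  obtain ⟨β, hβ⟩ := he1
  set C := Algebra.adjoin A (↑(insert β F) : Set B)
  have hβC : β ∈ C := Algebra.subset_adjoin (by simp)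
  have hAC : ∀ a, algebraMap A B a ∈ C := fun a => C.algebraMap_mem a
  have hFC : ∀ x ∈ Algebra.adjoin k (F : Set B), x ∈ C := by
    intro x hx
    induction hx using Algebra.adjoin_induction with
    | mem x hx => exact Algebra.subset_adjoin (by simp [Finset.mem_coe.1 hx])
    | algebraMap r => rw [IsScalarTower.algebraMap_apply k A B]; exact hAC _
    | add x y _ _ hx hy => exact add_mem hx hy
    | mul x y _ _ hx hy => exact mul_mem hx hy
  have htop : C = ⊤ := by
    rw [eq_top_iff]
    rintro b -
    obtain ⟨N, hN⟩ := hF b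
    obtain ⟨M, a, ha⟩ := hadj _ hN
    obtain ⟨a', ha'⟩ := hpow N (algebraMap A B e ^ M * b) ⟨a, by rw [← ha]; ring⟩
    have htC : algebraMap Q B t ∈ C := by
      rw [IsScalarTower.algebraMap_apply Q A B]; exact hAC _
    have hcop : IsCoprime ((⟨algebraMap Q B t, htC⟩ : C) ^ N)
        ((⟨algebraMap A B e, hAC e⟩ : C) ^ (N + M)) := by
      refine IsCoprime.pow ⟨⟨β, hβC⟩, 1, Subtype.ext ?_⟩
      simp only [one_mul]
      change β * algebraMap Q B t + algebraMap A B e = 1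
      linear_combination - hβ
    obtain ⟨u, v, huv⟩ := hcop
    have huv' : (u : B) * algebraMap Q B t ^ N + v * algebraMap A B e ^ (N + M) = 1 :=
      congrArg Subtype.val huv
    have : b = u * (algebraMap Q B t ^ N * b) + v * (algebraMap A B a') := by
      rw [← ha']
      linear_combination - b * huv'
    rw [this]
    exact add_mem (mul_mem u.2 (hFC _ hN)) (mul_mem v.2 (hAC _))
  have : Algebra.FiniteType A B := ⟨⟨insert β F, htop⟩⟩
  exact Algebra.FiniteType.trans (S := A) inferInstance this

end Core

section CoreIntegralClosure
attribute [local instance] FractionRing.liftAlgebra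
variable {Q B ι : Type*} [CommRing Q] [IsDomain Q] [IsNoetherianRing Q] [IsIntegrallyClosed Q]
  [CommRing B] [IsDomain B] [IsIntegrallyClosed B] [Algebra Q B] [FaithfulSMul Q B]
  [Algebra.IsAlgebraic Q B] [Fintype ι] {t : Q} {c : ι → B}

theorem finiteDimensional_fractionRing_of_adjoin (k : Type*) [Field k] [Algebra k Q] [Algebra k B]
    [IsScalarTower k Q B] (ht : t ≠ 0) (F : Finset B)
    (hF : ∀ b : B, ∃ N : ℕ, algebraMap Q B t ^ N * b ∈ Algebra.adjoin k (F : Set B)) :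
    FiniteDimensional (FractionRing Q) (FractionRing B) := by
  classical
  have hQB : Function.Injective (algebraMap Q B) := FaithfulSMul.algebraMap_injective Q B
  have hBL : Function.Injective (algebraMap B (FractionRing B)) := IsFractionRing.injective _ _
  have : Algebra.IsAlgebraic (FractionRing Q) (FractionRing B) :=
    (IsFractionRing.comap_isAlgebraic_iff (A := Q) (K := FractionRing Q)).1
      (have := IsLocalization.isAlgebraic (S := FractionRing B) (nonZeroDivisors B)
       Algebra.IsAlgebraic.trans Q B (FractionRing B))
  set M := IntermediateField.adjoin (FractionRing Q)
    ((F.image (algebraMap B (FractionRing B)) : Finset (FractionRing B)) : Set (FractionRing B))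
  have hM : FiniteDimensional (FractionRing Q) M :=
    IntermediateField.finiteDimensional_adjoin fun x _ =>
      (Algebra.IsAlgebraic.isAlgebraic x).isIntegral
  have hQM : ∀ q : Q, algebraMap B (FractionRing B) (algebraMap Q B q) ∈ M := by
    intro q
    rw [← IsScalarTower.algebraMap_apply, IsScalarTower.algebraMap_apply Q (FractionRing Q)]
    exact M.algebraMap_mem _
  have hFM : ∀ x ∈ Algebra.adjoin k (F : Set B), algebraMap B (FractionRing B) x ∈ M := by
    intro x hx
    induction hx using Algebra.adjoin_induction with
    | mem x hx =>
      exact IntermediateField.subset_adjoin _ _ (by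
        simpa using hx)
    | algebraMap r => rw [IsScalarTower.algebraMap_apply k Q B]; exact hQM _
    | add x y _ _ hx hy => rw [map_add]; exact add_mem hx hy
    | mul x y _ _ hx hy => rw [map_mul]; exact mul_mem hx hy
  have hBM : ∀ b : B, algebraMap B (FractionRing B) b ∈ M := by
    intro b
    obtain ⟨N, hN⟩ := hF b
    have h1 := hFM _ hN
    rw [map_mul, map_pow] at h1
    have h2 : algebraMap B (FractionRing B) (algebraMap Q B t) ^ N ≠ 0 :=
      pow_ne_zero _ fun h => ht (hQB ((hBL (h.trans (map_zero _).symm)).trans (map_zero _).symm))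
    have h3 := mul_mem (inv_mem (pow_mem (hQM t) N)) h1
    rwa [inv_mul_cancel_left₀ h2] at h3
  have htop : M = ⊤ := by
    rw [eq_top_iff]
    rintro x -
    obtain ⟨a, b, -, rfl⟩ := IsFractionRing.div_surjective (A := B) x
    exact div_mem (hBM a) (hBM b)
  rw [htop] at hM
  exact Module.Finite.equiv (IntermediateField.topEquiv (F := FractionRing Q)
    (E := FractionRing B)).toLinearEquiv

theorem finiteType_of_isBasisMod_of_isIntegrallyClosed (k : Type*) [Field k] [CharZero k]
    [Algebra k Q] [Algebra k B] [IsScalarTower k Q B] [Algebra.FiniteType k Q]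
    (htp : Prime t) (hc : IsBasisMod t c) (F : Finset B)
    (hF : ∀ b : B, ∃ N : ℕ, algebraMap Q B t ^ N * b ∈ Algebra.adjoin k (F : Set B)) :
    Algebra.FiniteType k B := by
  have hfd := finiteDimensional_fractionRing_of_adjoin k htp.ne_zero F hF
  have : CharZero Q := charZero_of_injective_algebraMap (algebraMap k Q).injective
  have : CharZero (FractionRing Q) :=
    charZero_of_injective_algebraMap (IsFractionRing.injective Q (FractionRing Q))
  set A := integralClosure Q B
  have : IsIntegralClosure A Q (FractionRing B) := by
    refine ⟨?_, fun {x} => ⟨fun hx => ?_, ?_⟩⟩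
    · exact (IsFractionRing.injective B (FractionRing B)).comp Subtype.val_injective
    · obtain ⟨y, rfl⟩ := (isIntegrallyClosed_iff (FractionRing B)).1 inferInstance
        (hx.tower_top (A := B))
      exact ⟨⟨y, (isIntegral_algebraMap_iff (IsFractionRing.injective B (FractionRing B))).1 hx⟩,
        rfl⟩
    · rintro ⟨y, rfl⟩
      exact (isIntegral_algebraMap_iff (IsFractionRing.injective B (FractionRing B))).2 y.2
  have : Module.Finite Q A :=
    IsIntegralClosure.finite Q (FractionRing Q) (FractionRing B) A
  have : IsFractionRing A (FractionRing B) :=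
    IsIntegralClosure.isFractionRing_of_finite_extension Q (FractionRing Q) (FractionRing B) A
  have : IsIntegrallyClosed A := (isIntegrallyClosed_iff (FractionRing B)).2 fun {x} hx =>
    ⟨IsIntegralClosure.mk' A x (isIntegral_trans (R := Q) (A := A) x hx),
      IsIntegralClosure.algebraMap_mk' A x _⟩
  have : FaithfulSMul A B := (faithfulSMul_iff_algebraMap_injective A B).2 Subtype.val_injective
  have : FaithfulSMul Q A := (faithfulSMul_iff_algebraMap_injective Q A).2 fun x y h =>
    FaithfulSMul.algebraMap_injective Q B (congrArg Subtype.val h)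
  have : Algebra.FiniteType k A :=
    Algebra.FiniteType.trans (S := Q) inferInstance inferInstance
  refine finiteType_of_isBasisMod (A := A) k htp hc (fun b => ?_)
    (powDvdReflects_of_finiteType k _) F hF
  obtain ⟨y, hy, hyb⟩ := (Algebra.IsAlgebraic.isAlgebraic (R := Q) b).exists_integral_multiple
  refine ⟨algebraMap Q A y, fun h => hy (FaithfulSMul.algebraMap_injective Q A
    (h.trans (map_zero _).symm)), ⟨⟨y • b, hyb⟩, ?_⟩⟩
  rw [← IsScalarTower.algebraMap_apply, ← Algebra.smul_def]
  rfl

end CoreIntegralClosure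

section FunctionField
open Polynomial
variable {k F : Type*} [Field k] [Field F] [Algebra k F] [Algebra.EssFiniteType k F]

attribute [local instance] FractionRing.liftAlgebra in
theorem finiteDimensional_fractionRing_of_essFiniteType (A : Type*) [CommRing A] [IsDomain A]
    [Algebra k A] [Algebra A F] [IsScalarTower k A F] [FaithfulSMul A F]
    [Algebra.IsAlgebraic A F] : Module.Finite (FractionRing A) F := by
  have : Algebra.IsAlgebraic (FractionRing A) F :=
    (IsFractionRing.comap_isAlgebraic_iff (A := A) (K := FractionRing A)).1 inferInstance
  have : IsScalarTower k (FractionRing A) F := by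
    refine IsScalarTower.of_algebraMap_eq fun x => ?_
    rw [IsScalarTower.algebraMap_apply k A (FractionRing A), ← IsScalarTower.algebraMap_apply A,
      ← IsScalarTower.algebraMap_apply k A]
  have : Algebra.EssFiniteType (FractionRing A) F := .of_comp k _ _
  exact Algebra.finite_of_essFiniteType_of_isAlgebraic

/-- Two valuation rings containing a Dedekind domain with fraction field `F` and having the same
center on it coincide. -/
theorem ValuationSubring.le_of_center_eq {N : Type*} [CommRing N] [IsDedekindDomain N]
    [Algebra N F] [IsFractionRing N F] {O O' : ValuationSubring F}
    (hO : ∀ n : N, algebraMap N F n ∈ O) (hO' : ∀ n : N, algebraMap N F n ∈ O')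
    (h : ∀ n : N, algebraMap N F n ∈ O.nonunits ↔ algebraMap N F n ∈ O'.nonunits)
    (hne : ∃ n : N, n ≠ 0 ∧ algebraMap N F n ∈ O.nonunits) : O ≤ O' := by
  let p : Ideal N := (IsLocalRing.maximalIdeal O).comap
    ((algebraMap N F).codRestrict O.toSubring hO)
  have hp : p.IsPrime := Ideal.comap_isPrime _ _
  have hmem : ∀ n : N, n ∈ p ↔ algebraMap N F n ∈ O.nonunits := by
    intro n
    rw [ValuationSubring.mem_nonunits_iff_exists_mem_maximalIdeal]
    constructor
    · intro hn
      exact ⟨hO n, hn⟩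
    · rintro ⟨_, hn⟩
      exact hn
  obtain ⟨n₀, hn₀, hn₀'⟩ := hne
  have hp0 : p ≠ ⊥ := fun h0 => hn₀ (by
    have := (hmem n₀).2 hn₀'
    rwa [h0, Ideal.mem_bot] at this)
  have : IsDiscreteValuationRing (Localization.AtPrime p) :=
    IsLocalization.AtPrime.isDiscreteValuationRing_of_dedekind_domain N hp0 _
  have key : ∀ n d : N, ∃ a b : N, b ∉ p ∧ (n * b = d * a ∨ d * b = n * a) := by
    intro n d
    obtain ⟨c, hc⟩ := ValuationRing.cond (algebraMap N (Localization.AtPrime p) n)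
      (algebraMap N (Localization.AtPrime p) d)
    obtain ⟨⟨a, b⟩, hab⟩ := IsLocalization.surj p.primeCompl c
    have hinj : Function.Injective (algebraMap N (Localization.AtPrime p)) :=
      IsLocalization.injective _ p.primeCompl_le_nonZeroDivisors
    refine ⟨a, b, b.2, ?_⟩
    rcases hc with hc | hc
    · right
      apply hinj
      rw [map_mul, map_mul, ← hab, ← hc]; ring
    · left
      apply hinj
      rw [map_mul, map_mul, ← hab, ← hc]; ring
  intro x hx
  obtain ⟨n, d, hd, rfl⟩ := IsFractionRing.div_surjective (A := N) x
  have hinj := IsFractionRing.injective N F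
  have hunit : ∀ b : N, b ∉ p → algebraMap N F b ≠ 0 ∧ (algebraMap N F b)⁻¹ ∈ O' := by
    intro b hb
    have h0 : algebraMap N F b ≠ 0 := fun h0 => hb (by
      rw [(map_eq_zero_iff _ hinj).1 h0]; exact p.zero_mem)
    refine ⟨h0, ?_⟩
    rw [hmem, h, ValuationSubring.mem_nonunits_iff, not_lt] at hb
    rw [← ValuationSubring.valuation_le_one_iff, map_inv₀]
    exact inv_le_one_of_one_le₀ hb
  have hd0 : algebraMap N F d ≠ 0 := fun h0 =>
    nonZeroDivisors.ne_zero hd ((map_eq_zero_iff _ hinj).1 h0)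
  obtain ⟨a, b, hb, hab | hab⟩ := key n d
  · have := hunit b hb
    have e : algebraMap N F n / algebraMap N F d = algebraMap N F a * (algebraMap N F b)⁻¹ := by
      rw [← div_eq_mul_inv, div_eq_div_iff hd0 this.1, ← map_mul, ← map_mul, hab, mul_comm]
    rw [e]
    exact O'.mul_mem _ _ (hO' a) this.2
  · by_cases ha : a ∈ p
    · exfalso
      have hb' := (hunit b hb).1
      rw [hmem, ValuationSubring.mem_nonunits_iff] at hb ha
      apply hb
      have e : algebraMap N F b = algebraMap N F n / algebraMap N F d * algebraMap N F a := by
        rw [div_mul_eq_mul_div, eq_div_iff hd0, ← map_mul, ← map_mul, mul_comm, hab]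
      rw [e, map_mul]
      exact mul_lt_one_of_nonneg_of_lt_one_right ((O.valuation_le_one_iff _).2 hx) zero_le ha
    · have := hunit a ha
      have e : algebraMap N F n / algebraMap N F d = algebraMap N F b * (algebraMap N F a)⁻¹ := by
        rw [← div_eq_mul_inv, div_eq_div_iff hd0 this.1, ← map_mul, ← map_mul, ← hab, mul_comm]
      rw [e]
      exact O'.mul_mem _ _ (hO' b) this.2

attribute [local instance] FractionRing.liftAlgebra in
theorem finite_integralClosure_of_essFiniteType [CharZero k] (A : Type*) [CommRing A]
    [IsDedekindDomain A] [Algebra k A] [Algebra A F] [IsScalarTower k A F] [FaithfulSMul A F]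
    [Algebra.IsAlgebraic A F] :
    Module.Finite A (integralClosure A F) ∧ IsDedekindDomain (integralClosure A F) ∧
      IsFractionRing (integralClosure A F) F := by
  have := finiteDimensional_fractionRing_of_essFiniteType (k := k) (F := F) A
  have : CharZero A := charZero_of_injective_algebraMap (algebraMap k A).injective
  have : CharZero (FractionRing A) :=
    charZero_of_injective_algebraMap (IsFractionRing.injective A (FractionRing A))
  exact ⟨IsIntegralClosure.finite A (FractionRing A) F _,
    integralClosure.isDedekindDomain A (FractionRing A) F,
    IsIntegralClosure.isFractionRing_of_finite_extension A (FractionRing A) F _⟩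

theorem ValuationSubring.integralClosure_le {A : Type*} [CommRing A] [Algebra A F]
    {O : ValuationSubring F} (hO : ∀ a : A, algebraMap A F a ∈ O) {x : F} (hx : IsIntegral A x) :
    x ∈ O := by
  let g : A →+* O := (algebraMap A F).codRestrict O.toSubring hO
  have h1 : IsIntegral O x := by
    obtain ⟨p, hp, hpx⟩ := hx
    refine ⟨p.map g, hp.map _, ?_⟩
    rw [Polynomial.eval₂_map]
    exact hpx
  obtain ⟨y, rfl⟩ := (IsIntegrallyClosed.isIntegral_iff (R := O)).1 h1
  exact y.2

theorem finite_setOf_valuationSubring_mem_nonunits [CharZero k] (A : Type*) [CommRing A]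
    [IsDedekindDomain A] [Algebra k A] [Algebra A F] [IsScalarTower k A F] [FaithfulSMul A F]
    [Algebra.IsAlgebraic A F] {a : A} (ha : a ≠ 0) :
    {O : ValuationSubring F | (∀ x : A, algebraMap A F x ∈ O) ∧
      algebraMap A F a ∈ O.nonunits}.Finite := by
  obtain ⟨-, hD, hfr⟩ := finite_integralClosure_of_essFiniteType (k := k) (F := F) A
  set N := integralClosure A F
  have hAN : Function.Injective (algebraMap A N) := by
    refine Function.Injective.of_comp (f := algebraMap N F) ?_
    rw [← RingHom.coe_comp, ← IsScalarTower.algebraMap_eq]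
    exact FaithfulSMul.algebraMap_injective A F
  have ha' : algebraMap A N a ≠ 0 := (map_ne_zero_iff _ hAN).2 ha
  have hNF : algebraMap N F (algebraMap A N a) = algebraMap A F a := by
    rw [← IsScalarTower.algebraMap_apply]
  have hfin : {p : Ideal N | p.IsPrime ∧ algebraMap A N a ∈ p}.Finite := by
    refine (Ideal.finite_minimalPrimes_of_isNoetherianRing N
      (Ideal.span {algebraMap A N a})).subset ?_
    rintro p ⟨hp, hap⟩
    refine ⟨⟨hp, (Ideal.span_singleton_le_iff_mem _).2 hap⟩, ?_⟩
    rintro q ⟨hq, haq⟩ hqp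
    have hq0 : q ≠ ⊥ := fun h => ha' (by
      rw [h, Ideal.span_singleton_le_iff_mem] at haq; exact haq)
    exact ((hq.isMaximal hq0).eq_of_le hp.ne_top hqp).ge
  refine Set.Finite.of_injOn (f := fun O => {n : N | algebraMap N F n ∈ O.nonunits})
    (t := (fun p : Ideal N => (p : Set N)) '' {p : Ideal N | p.IsPrime ∧ algebraMap A N a ∈ p})
    ?_ ?_ (hfin.image _)
  · rintro O ⟨hO, haO⟩
    have hON : ∀ n : N, algebraMap N F n ∈ O := fun n => O.integralClosure_le hO n.2
    have hmem : ∀ n : N, n ∈ (IsLocalRing.maximalIdeal O).comap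
        ((algebraMap N F).codRestrict O.toSubring hON) ↔ algebraMap N F n ∈ O.nonunits := by
      intro n
      rw [ValuationSubring.mem_nonunits_iff_exists_mem_maximalIdeal]
      exact ⟨fun hn => ⟨hON n, hn⟩, fun ⟨_, hn⟩ => hn⟩
    refine ⟨_, ⟨Ideal.comap_isPrime ((algebraMap N F).codRestrict O.toSubring hON)
      (IsLocalRing.maximalIdeal O), ?_⟩, ?_⟩
    · rw [hmem, hNF]; exact haO
    · ext n; exact hmem n
  · rintro O ⟨hO, haO⟩ O' ⟨hO', haO'⟩ h
    have h' : ∀ n : N, algebraMap N F n ∈ O.nonunits ↔ algebraMap N F n ∈ O'.nonunits :=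
      fun n => Set.ext_iff.1 h n
    have hON : ∀ n : N, algebraMap N F n ∈ O := fun n => O.integralClosure_le hO n.2
    have hON' : ∀ n : N, algebraMap N F n ∈ O' := fun n => O'.integralClosure_le hO' n.2
    exact le_antisymm
      (ValuationSubring.le_of_center_eq hON hON' h' ⟨_, ha', by rwa [hNF]⟩)
      (ValuationSubring.le_of_center_eq hON' hON (fun n => (h' n).symm)
        ⟨_, ha', by rwa [hNF]⟩)

/-- In a function field of one variable, only finitely many valuation rings (containing the
constants) are poles of a given element. -/
theorem finite_setOf_valuationSubring_notMem [CharZero k] {y : F}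
    (hy : Transcendental k y → Algebra.IsAlgebraic (Algebra.adjoin k {y⁻¹}) F) :
    {O : ValuationSubring F | (∀ c : k, algebraMap k F c ∈ O) ∧ y ∉ O}.Finite := by
  by_cases hyt : Transcendental k y
  · have hyi : Transcendental k y⁻¹ := fun h => hyt (by simpa using h.inv)
    have halg := hy hyt
    let : Algebra k[X] F := (aeval y⁻¹ : k[X] →ₐ[k] F).toAlgebra
    have hmap : ∀ p : k[X], algebraMap k[X] F p = aeval y⁻¹ p := fun _ => rfl
    have : IsScalarTower k k[X] F := .of_algebraMap_eq fun c => by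
      rw [hmap, Polynomial.algebraMap_eq, aeval_C]
    have : FaithfulSMul k[X] F := by
      rw [faithfulSMul_iff_algebraMap_injective]
      exact transcendental_iff_injective.1 hyi
    have : Algebra.IsAlgebraic k[X] F := by
      let : Algebra k[X] (Algebra.adjoin k {y⁻¹}) :=
        ((aeval y⁻¹ : k[X] →ₐ[k] F).codRestrict (Algebra.adjoin k {y⁻¹})
          (fun p => aeval_mem_adjoin_singleton k _)).toAlgebra
      have : IsScalarTower k[X] (Algebra.adjoin k {y⁻¹}) F := .of_algebraMap_eq fun p => rfl
      have hs : Function.Surjective (algebraMap k[X] (Algebra.adjoin k {y⁻¹})) := by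
        rintro ⟨x, hx⟩
        rw [Algebra.adjoin_singleton_eq_range_aeval] at hx
        obtain ⟨p, rfl⟩ := hx
        exact ⟨p, rfl⟩
      have hint : Algebra.IsIntegral k[X] (Algebra.adjoin k {y⁻¹}) :=
        ⟨fun x => (algebraMap k[X] (Algebra.adjoin k {y⁻¹})).isIntegral_of_surjective hs x⟩
      exact Algebra.IsAlgebraic.trans k[X] (Algebra.adjoin k {y⁻¹}) F
    refine (finite_setOf_valuationSubring_mem_nonunits (k := k) (F := F) k[X]
      (X_ne_zero)).subset ?_
    rintro O ⟨hO, hyO⟩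
    have hX : algebraMap k[X] F X ∈ O.nonunits := by
      rw [hmap, aeval_X, ValuationSubring.inv_mem_nonunits_iff]
      exact Or.inr hyO
    refine ⟨fun p => ?_, hX⟩
    rw [hmap, aeval_eq_sum_range]
    refine O.toSubring.sum_mem fun i _ => ?_
    rw [Algebra.smul_def]
    refine O.mul_mem _ _ (hO _) (O.toSubring.pow_mem ?_ _)
    rw [hmap, aeval_X] at hX
    exact O.nonunits_subset hX
  · convert! Set.finite_empty
    ext O
    simp only [Set.mem_ofPred_eq, Set.mem_empty_iff_false, iff_false, not_and, not_not]
    intro hO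
    exact O.integralClosure_le hO (not_not.1 hyt : IsAlgebraic k y).isIntegral

omit [Algebra.EssFiniteType k F] in
theorem exists_valuationSubring_of_not_isIntegral {A : Subalgebra k F} {x : F}
    (hx : ¬ IsIntegral A x) : ∃ O : ValuationSubring F, (∀ a ∈ A, a ∈ O) ∧ x ∉ O := by
  by_contra! h
  apply hx
  have h1 : x ∈ (⨅ V : {V : ValuationSubring F // (A : Set F) ⊆ V.toSubring}, V.1.toSubring) := by
    rw [Subring.mem_iInf]
    exact fun V => h V.1 fun a ha => V.2 ha
  rw [iInf_valuationSubring_superset] at h1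
  have h2 : IsIntegral (Subring.closure (A : Set F)) x := h1
  have hle : Subring.closure (A : Set F) ≤ A.toSubring := Subring.closure_le.2 fun a ha => ha
  exact h2.map_of_comp_eq (Subring.inclusion hle) (RingHom.id F) (by ext; rfl)

omit [Algebra.EssFiniteType k F] in
theorem isAlgebraic_of_isIntegral_adjoin_singleton {s x : F} (hs : IsAlgebraic k s)
    (hx : IsIntegral (Algebra.adjoin k {s}) x) : IsAlgebraic k x := by
  have : Algebra.IsIntegral k (Algebra.adjoin k {s}) :=
    Algebra.IsIntegral.adjoin (by simpa using hs.isIntegral)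
  exact (isIntegral_trans (R := k) x hx).isAlgebraic

end FunctionField

/-- A discrete additive valuation on a `k`-algebra, nonnegative and with a residue map to a
function field `F` of one variable over `k`. -/
structure Place (k B F : Type*) [Field k] [CommRing B] [Algebra k B] [Field F] [Algebra k F] where
  /-- the valuation -/
  v : AddValuation B ℕ∞
  eq_zero_of_v : ∀ b, v b = ⊤ → b = 0
  /-- the residue map -/
  ρ : B →ₐ[k] F
  ρ_eq_zero : ∀ b, ρ b = 0 ↔ v b ≠ 0
  /-- an element over which all residues are integral -/
  y : F
  isIntegral_ρ : ∀ b, IsIntegral (Algebra.adjoin k {y}) (ρ b)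
  isAlgebraic : ∀ s : F, Transcendental k s → Algebra.IsAlgebraic (Algebra.adjoin k {s}) F
  exists_transcendental : ∃ a c, v a = v c ∧ c ≠ 0 ∧ ∀ a₁ c₁, v a₁ = 0 → v c₁ = 0 →
    a * c₁ = c * a₁ → Transcendental k (ρ a₁ / ρ c₁)

section Places
open Polynomial
variable {k B V : Type*} [Field k] [CommRing B] [IsDomain B] [Algebra k B]
  {F : V → Type*} [∀ v, Field (F v)] [∀ v, Algebra k (F v)] 
  (P : ∀ v, Place k B (F v)) {t : B}

/-- divisibility by powers of `t` is controlled by the places -/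
def ControlsDvd (t : B) : Prop :=
  ∀ (N : ℕ) (b : B), (∀ v, N • (P v).v t ≤ (P v).v b) → t ^ N ∣ b

theorem Place.exists_mul_eq {P : ∀ v, Place k B (F v)} (ht : t ≠ 0) (hP : ControlsDvd P t) {v : V}
    {N : ℕ} {β : B}
    (hβ : ∀ w, w ≠ v → N • (P w).v t ≤ (P w).v β) {α : ℕ} (hα : (P v).v β + α = N • (P v).v t)
    (n : ℕ) (z : B) (hz : ((α * n : ℕ) : ℕ∞) ≤ (P v).v z) :
    ∃ q, t ^ (N * n) * q = β ^ n * z ∧ (P v).v q + (α * n : ℕ) = (P v).v z := by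
  obtain ⟨q, hq⟩ := hP (N * n) (β ^ n * z) (by
    intro w
    rw [AddValuation.map_mul, AddValuation.map_pow]
    by_cases hw : w = v
    · subst hw
      rw [mul_comm, mul_smul, ← hα, smul_add]
      gcongr
      simpa [mul_comm] using hz
    · rw [mul_comm, mul_smul]
      exact le_add_right (nsmul_le_nsmul_right (hβ w hw) n))
  refine ⟨q, hq.symm, ?_⟩
  have h1 := congrArg (P v).v hq
  rw [AddValuation.map_mul, AddValuation.map_mul, AddValuation.map_pow, AddValuation.map_pow,
    mul_comm N n, mul_smul, ← hα] at h1
  have hfin : (P v).v β ≠ ⊤ := by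
    intro h
    rw [h, top_add] at hα
    have h2 : (P v).v (t ^ N) = ⊤ := by rw [AddValuation.map_pow, hα]
    exact pow_ne_zero _ ht ((P v).eq_zero_of_v _ h2)
  lift (P v).v β to ℕ using hfin with b
  have h3 : n • (b : ℕ∞) ≠ ⊤ := by
    rw [nsmul_eq_mul]; exact_mod_cast ENat.natCast_ne_top (n * b)
  refine ENat.add_right_injective_of_ne_top h3 ?_
  simp only
  rw [h1, smul_add, nsmul_eq_mul n (α : ℕ∞)]
  push_cast
  ring

variable (t) in
/-- no place can be omitted -/
def IsMinimalPlaces : Prop :=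
  ∀ v, ∃ (N : ℕ) (β : B), (∀ w, w ≠ v → N • (P w).v t ≤ (P w).v β) ∧
    (P v).v β < N • (P v).v t

variable {P}

omit [IsDomain B] in
theorem IsMinimalPlaces.exists_add_eq (hmin : IsMinimalPlaces P t) (ht : t ≠ 0) (v : V) :
    ∃ (N : ℕ) (β : B) (α : ℕ), 0 < α ∧ (∀ w, w ≠ v → N • (P w).v t ≤ (P w).v β) ∧
      (P v).v β + α = N • (P v).v t := by
  obtain ⟨N, β, h1, h2⟩ := hmin v
  have h3 : (P v).v t ≠ ⊤ := fun h => ht ((P v).eq_zero_of_v _ h)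
  refine ⟨N, β, ?_⟩
  lift (P v).v β to ℕ using (h2.trans_le le_top).ne with b
  lift (P v).v t to ℕ using h3 with m hm
  rw [nsmul_eq_mul] at h2 ⊢
  norm_cast at h2 ⊢
  exact ⟨N * m - b, by omega, h1, by omega⟩

theorem Place.exists_transcendental_ρ (ht : t ≠ 0) (hP : ControlsDvd P t)
    (hmin : IsMinimalPlaces P t) (v : V) : ∃ x, Transcendental k ((P v).ρ x) := by
  obtain ⟨a, c, hac, hc, H⟩ := (P v).exists_transcendental
  obtain ⟨N, β, α, hα0, hβ, hα⟩ := hmin.exists_add_eq ht v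
  have hγ : (P v).v c ≠ ⊤ := fun h => hc ((P v).eq_zero_of_v _ h)
  obtain ⟨γ, hγ'⟩ := ENat.ne_top_iff_exists.1 hγ
  have e1 : (P v).v (c ^ α) = ((α * γ : ℕ) : ℕ∞) := by
    rw [AddValuation.map_pow, ← hγ']; push_cast; simp
  have e2 : (P v).v (a * c ^ (α - 1)) = ((α * γ : ℕ) : ℕ∞) := by
    rw [← e1, AddValuation.map_mul, hac, ← AddValuation.map_mul, ← pow_succ',
      Nat.sub_add_cancel hα0]
  obtain ⟨c₁, hc₁, hc₁'⟩ := Place.exists_mul_eq ht hP hβ hα γ _ e1.ge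
  obtain ⟨a₁, ha₁, ha₁'⟩ := Place.exists_mul_eq ht hP hβ hα γ _ e2.ge
  rw [e1] at hc₁'
  rw [e2] at ha₁'
  have hfin : ((α * γ : ℕ) : ℕ∞) ≠ ⊤ := ENat.natCast_ne_top _
  have hc0 : (P v).v c₁ = 0 := ENat.add_left_injective_of_ne_top hfin (by
    simp only; rw [hc₁', zero_add])
  have ha0 : (P v).v a₁ = 0 := ENat.add_left_injective_of_ne_top hfin (by
    simp only; rw [ha₁', zero_add])
  have := H a₁ c₁ ha0 hc0 (by
    apply mul_left_cancel₀ (pow_ne_zero (N * γ) ht)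
    rw [mul_left_comm, hc₁, mul_left_comm _ c, ha₁]
    nth_rewrite 1 [← Nat.sub_add_cancel hα0]
    rw [pow_succ]; ring)
  by_contra! hx
  refine this ?_
  rw [div_eq_mul_inv]
  exact (not_not.1 (hx a₁)).mul (not_not.1 (hx c₁)).inv

omit [IsDomain B] in
theorem Place.exists_isIntegral_ρ [CharZero k] [Finite V] [∀ v, Algebra.EssFiniteType k (F v)] :
    ∃ s : B, ∀ v x, IsIntegral (Algebra.adjoin k {(P v).ρ s}) ((P v).ρ x) := by
  classical
  let poles : (v : V) → Set (ValuationSubring (F v)) :=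
    fun v => {O | (∀ c : k, algebraMap k (F v) c ∈ O) ∧ (P v).y ∉ O}
  have hpoles : ∀ v, (poles v).Finite := fun v => finite_setOf_valuationSubring_notMem fun h =>
    (P v).isAlgebraic _ fun h' => h (by simpa using h'.inv)
  let W : (v : V) → poles v → Subspace k B := fun v O =>
    { carrier := {b | (P v).ρ b ∈ O.1}
      add_mem' := fun {a b} ha hb => by
        change (P v).ρ (a + b) ∈ O.1
        rw [map_add]; exact O.1.add_mem _ _ ha hb
      zero_mem' := by
        change (P v).ρ 0 ∈ O.1
        rw [map_zero]; exact O.1.zero_mem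
      smul_mem' := fun c b hb => by
        change (P v).ρ (c • b) ∈ O.1
        rw [map_smul, Algebra.smul_def]
        exact O.1.mul_mem _ _ (O.2.1 c) hb }
  have hfin : (⋃ v, Set.range (W v)).Finite := by
    refine Set.finite_iUnion fun v => ?_
    have := (hpoles v).to_subtype
    exact Set.finite_range _
  have hcov := Subspace.biUnion_ne_univ_of_top_notMem (k := k) (E := B)
    (s := hfin.toFinset.erase ⊤) (by simp)
  obtain ⟨s, hs⟩ := (Set.ne_univ_iff_exists_notMem _).1 hcov
  refine ⟨s, fun v x => ?_⟩
  by_contra hx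
  obtain ⟨O, hO, hxO⟩ := exists_valuationSubring_of_not_isIntegral hx
  have hk : ∀ c : k, algebraMap k (F v) c ∈ O := fun c => hO _ (Subalgebra.algebraMap_mem _ c)
  have hy : (P v).y ∉ O := by
    intro hy
    refine hxO (O.integralClosure_le (A := Algebra.adjoin k {(P v).y}) ?_ ((P v).isIntegral_ρ x))
    rintro ⟨a, ha⟩
    change a ∈ O
    induction ha using Algebra.adjoin_induction with
    | mem a ha => rw [Set.mem_singleton_iff.1 ha]; exact hy
    | algebraMap c => exact hk c
    | add a b _ _ ha hb => exact O.add_mem _ _ ha hb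
    | mul a b _ _ ha hb => exact O.mul_mem _ _ ha hb
  apply hs
  refine Set.mem_biUnion (x := W v ⟨O, hk, hy⟩) ?_ ?_
  · rw [Finset.mem_coe, Finset.mem_erase]
    refine ⟨fun h => hxO ?_, ?_⟩
    · have : x ∈ W v ⟨O, hk, hy⟩ := by rw [h]; exact Submodule.mem_top
      exact this
    · rw [Set.Finite.mem_toFinset]
      exact Set.mem_iUnion.2 ⟨v, ⟨_, rfl⟩⟩
  · exact hO _ (Algebra.self_mem_adjoin_singleton k _)

end Places

theorem isNoetherian_quotient_of_linearMap {S B M : Type*} [CommRing S] [AddCommGroup B]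
    [Module S B] [AddCommGroup M] [Module S M] [IsNoetherian S M] {I I' : Submodule S B}
    (h : I' ≤ I) (g : I →ₗ[S] M) (hg : ∀ x : I, g x = 0 → (x : B) ∈ I')
    (hI : IsNoetherian S (B ⧸ I)) : IsNoetherian S (B ⧸ I') := by
  have h1 : IsNoetherian S (I ⧸ LinearMap.ker g) :=
    isNoetherian_of_injective ((LinearMap.ker g).liftQ g le_rfl)
      (LinearMap.ker_eq_bot.1 (Submodule.ker_liftQ_eq_bot _ _ _ le_rfl))
  have h2 : IsNoetherian S (I ⧸ I'.comap I.subtype) :=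
    isNoetherian_of_surjective (Submodule.factor (p := LinearMap.ker g) (p' := I'.comap I.subtype)
      fun x hx => hg x hx) (LinearMap.range_eq_top.2 (Submodule.factor_surjective _))
  refine isNoetherian_of_range_eq_ker ((I'.comap I.subtype).mapQ I' I.subtype le_rfl)
    (Submodule.factor h) ?_
  ext x
  induction x using Submodule.Quotient.induction_on with | _ x => ?_
  constructor
  · rintro ⟨z, hz⟩
    induction z using Submodule.Quotient.induction_on with | _ z => ?_
    rw [Submodule.mapQ_apply] at hz
    rw [LinearMap.mem_ker, ← hz]
    exact (Submodule.Quotient.mk_eq_zero _).2 z.2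
  · intro hx
    have : x ∈ I := (Submodule.Quotient.mk_eq_zero _).1 hx
    exact ⟨Submodule.Quotient.mk ⟨x, this⟩, rfl⟩

section Places
open Polynomial
variable {k B V : Type*} [Field k] [CharZero k] [CommRing B] [IsDomain B] [Algebra k B]
  {F : V → Type*} [∀ v, Field (F v)] [∀ v, Algebra k (F v)] [∀ v, Algebra.EssFiniteType k (F v)]
  {P : ∀ v, Place k B (F v)} {t : B} [Algebra k[X] B] [IsScalarTower k k[X] B]

omit [IsDomain B] in
theorem Place.isNoetherian_quotient_ker (v : V)
    (hs : ∀ x, IsIntegral (Algebra.adjoin k {(P v).ρ (algebraMap k[X] B X)}) ((P v).ρ x))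
    (hst : Transcendental k ((P v).ρ (algebraMap k[X] B X))) :
    IsNoetherian k[X] (B ⧸ (RingHom.ker (P v).ρ)) := by
  set s := algebraMap k[X] B X with hsdef
  let ψ : k[X] →ₐ[k] F v := (P v).ρ.comp (IsScalarTower.toAlgHom k k[X] B)
  have hψ : ψ = aeval ((P v).ρ s) := by
    ext; simp [ψ, hsdef]
  let : Algebra k[X] (F v) := ψ.toAlgebra
  have hmap : ∀ p, algebraMap k[X] (F v) p = (P v).ρ (algebraMap k[X] B p) := fun p => rfl
  have : IsScalarTower k k[X] (F v) := .of_algebraMap_eq fun c => (ψ.commutes c).symm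
  have : FaithfulSMul k[X] (F v) := by
    rw [faithfulSMul_iff_algebraMap_injective]
    change Function.Injective ψ
    rw [hψ]
    exact transcendental_iff_injective.1 hst
  let : Algebra k[X] (Algebra.adjoin k {(P v).ρ s}) :=
    (ψ.codRestrict (Algebra.adjoin k {(P v).ρ s})
      (fun p => by rw [hψ]; exact aeval_mem_adjoin_singleton k _)).toAlgebra
  have : IsScalarTower k[X] (Algebra.adjoin k {(P v).ρ s}) (F v) := .of_algebraMap_eq fun p => rfl
  have hsur : Function.Surjective (algebraMap k[X] (Algebra.adjoin k {(P v).ρ s})) := by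
    rintro ⟨x, hx⟩
    rw [Algebra.adjoin_singleton_eq_range_aeval, ← hψ] at hx
    obtain ⟨p, rfl⟩ := hx
    exact ⟨p, rfl⟩
  have hint : Algebra.IsIntegral k[X] (Algebra.adjoin k {(P v).ρ s}) :=
    ⟨fun x => (algebraMap k[X] (Algebra.adjoin k {(P v).ρ s})).isIntegral_of_surjective hsur x⟩
  have := (P v).isAlgebraic _ hst
  have : Algebra.IsAlgebraic k[X] (F v) :=
    Algebra.IsAlgebraic.trans k[X] (Algebra.adjoin k {(P v).ρ s}) (F v)
  obtain ⟨hfin, -, -⟩ := finite_integralClosure_of_essFiniteType (k := k) (F := F v) k[X]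
  have hN : IsNoetherian k[X] (integralClosure k[X] (F v)) :=
    isNoetherian_of_isNoetherianRing_of_finite k[X] _
  let g : B →ₗ[k[X]] integralClosure k[X] (F v) :=
    { toFun := fun x => ⟨(P v).ρ x, isIntegral_trans (R := k[X]) _ (hs x)⟩
      map_add' := fun x y => Subtype.ext (map_add _ _ _)
      map_smul' := fun p x => Subtype.ext (by
        change (P v).ρ (p • x) = p • (P v).ρ x
        rw [Algebra.smul_def, Algebra.smul_def, map_mul, hmap]) }
  have hg : ∀ x, g x = 0 ↔ x ∈ RingHom.ker (P v).ρ := fun x => by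
    rw [RingHom.mem_ker]
    exact Subtype.ext_iff
  let g' : (B ⧸ (RingHom.ker (P v).ρ)) →ₗ[k[X]] integralClosure k[X] (F v) :=
    ((RingHom.ker (P v).ρ).restrictScalars k[X]).liftQ g fun x hx => (hg x).2 hx
  refine isNoetherian_of_injective g' ?_
  rw [← LinearMap.ker_eq_bot]
  exact Submodule.ker_liftQ_eq_bot ((RingHom.ker (P v).ρ).restrictScalars k[X]) g _
    fun x hx => (hg x).1 hx

variable (k) in
/-- elements of valuation at least `n` -/
def Place.level {F : Type*} [Field F] [Algebra k F] (P : Place k B F) (n : ℕ) :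
    Submodule k[X] B where
  carrier := {b | (n : ℕ∞) ≤ P.v b}
  add_mem' := fun ha hb => P.v.map_le_add ha hb
  zero_mem' := by simp
  smul_mem' := fun p b hb => by
    change (n : ℕ∞) ≤ P.v (p • b)
    rw [Algebra.smul_def, AddValuation.map_mul]
    exact le_add_left hb

omit [CharZero k] [∀ (v : V), Algebra.EssFiniteType k (F v)] [IsScalarTower k k[X] B] in
theorem Place.isNoetherian_quotient_level (ht : t ≠ 0) (hP : ControlsDvd P t)
    (hmin : IsMinimalPlaces P t) (v : V)
    (hN : IsNoetherian k[X] (B ⧸ (RingHom.ker (P v).ρ))) (n : ℕ) :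
    IsNoetherian k[X] (B ⧸ (P v).level k n) := by
  induction n with
  | zero =>
    have : (P v).level k 0 = ⊤ := by
      rw [eq_top_iff]; intro x _; exact (by simp : ((0 : ℕ) : ℕ∞) ≤ (P v).v x)
    rw [this]
    infer_instance
  | succ n ih =>
    have hle : (P v).level k (n + 1) ≤ (P v).level k n := fun x hx =>
      le_trans (by exact_mod_cast n.le_succ) (show ((n + 1 : ℕ) : ℕ∞) ≤ _ from hx)
    have hsucc : ∀ x, (n : ℕ∞) ≤ (P v).v x → (P v).v x ≠ n → x ∈ (P v).level k (n + 1) := by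
      intro x h1 h2
      change ((n + 1 : ℕ) : ℕ∞) ≤ (P v).v x
      push_cast
      exact Order.add_one_le_of_lt (lt_of_le_of_ne h1 h2.symm)
    by_cases hex : ∃ g, (P v).v g = n
    · obtain ⟨g, hg⟩ := hex
      obtain ⟨N, β, α, hα0, hβ, hα⟩ := hmin.exists_add_eq ht v
      have hz : ∀ x : (P v).level k n, ((α * n : ℕ) : ℕ∞) ≤ (P v).v (x * g ^ (α - 1)) := by
        intro x
        rw [AddValuation.map_mul, AddValuation.map_pow, hg]
        refine le_trans ?_ (add_le_add (show (n : ℕ∞) ≤ _ from x.2) le_rfl)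
        obtain ⟨α', rfl⟩ : ∃ α', α = α' + 1 := ⟨α - 1, by omega⟩
        simp only [nsmul_eq_mul, Nat.add_sub_cancel]
        norm_cast
        exact le_of_eq (by ring)
      choose q hq hqv using fun x : (P v).level k n =>
        Place.exists_mul_eq ht hP hβ hα n _ (hz x)
      have ht' := pow_ne_zero (N * n) ht
      let f : (P v).level k n →ₗ[k[X]] (B ⧸ (RingHom.ker (P v).ρ)) :=
        { toFun := fun x => Ideal.Quotient.mk _ (q x)
          map_add' := fun x y => by
            rw [← map_add]
            congr 1
            apply mul_left_cancel₀ ht'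
            rw [hq, mul_add, hq, hq, Submodule.coe_add]; ring
          map_smul' := fun p x => by
            have : q (p • x) = p • q x := by
              apply mul_left_cancel₀ ht'
              rw [hq, mul_smul_comm, hq, Submodule.coe_smul, smul_mul_assoc, mul_smul_comm]
            rw [this]; rfl }
      refine isNoetherian_quotient_of_linearMap hle f (fun x hx => ?_) ih
      have h1 : (P v).ρ (q x) = 0 := Ideal.Quotient.eq_zero_iff_mem.1 hx
      rw [(P v).ρ_eq_zero] at h1
      refine hsucc x x.2 fun hxn => h1 ?_
      have h2 := hqv x
      rw [AddValuation.map_mul, AddValuation.map_pow, hg, hxn] at h2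
      refine ENat.add_left_injective_of_ne_top (ENat.natCast_ne_top (α * n)) ?_
      simp only
      rw [h2, zero_add]
      obtain ⟨α', rfl⟩ : ∃ α', α = α' + 1 := ⟨α - 1, by omega⟩
      simp only [nsmul_eq_mul, Nat.add_sub_cancel]
      norm_cast
      ring
    · push Not at hex
      have : (P v).level k (n + 1) = (P v).level k n :=
        le_antisymm hle fun x hx => hsucc x hx (hex x)
      rw [this]; exact ih

end Places

section TorsionFreeReduction
open Polynomial
universe u
variable {k B : Type u} [Field k] [CommRing B] [IsDomain B] [Algebra k B]

/-- If `B / t B` is finite and torsion free over `k[s]`, then `B` is a finitely generated algebra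
as soon as it is so after inverting `t`. -/
theorem finiteType_of_isTorsionFree_quotient [CharZero k] [IsIntegrallyClosed B] {t : B}
    (htr : Algebra.trdeg k B ≤ 2) (htu : ¬ IsUnit t) (ht : t ≠ 0) (s : B)
    (hfin : ∃ G : Finset B, ∀ b, ∃ p : B → k[X], t ∣ b - ∑ g ∈ G, aeval s (p g) * g)
    (htf : ∀ (p : k[X]) (b : B), p ≠ 0 → t ∣ aeval s p * b → t ∣ b)
    (E : Finset B) (hE : ∀ b : B, ∃ N : ℕ, t ^ N * b ∈ Algebra.adjoin k (E : Set B)) :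
    Algebra.FiniteType k B := by
  let : Algebra k[X] B := (aeval s : k[X] →ₐ[k] B).toAlgebra
  have hmap : ∀ p : k[X], algebraMap k[X] B p = aeval s p := fun _ => rfl
  have : IsScalarTower k k[X] B := .of_algebraMap_eq fun c => by
    rw [hmap, Polynomial.algebraMap_eq, aeval_C]
  set I : Ideal B := Ideal.span {t} with hI
  have hmem : ∀ b, b ∈ I ↔ t ∣ b := fun b => Ideal.mem_span_singleton
  have hmk : ∀ (p : k[X]) (b : B), p • (Ideal.Quotient.mk I b) = Ideal.Quotient.mk I (p • b) :=
    fun _ _ => rfl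
  have : Module.Finite k[X] (B ⧸ I) := by
    obtain ⟨G, hG⟩ := hfin
    classical
    refine ⟨⟨G.image (Ideal.Quotient.mk I), ?_⟩⟩
    rw [eq_top_iff]
    rintro x -
    obtain ⟨b, rfl⟩ := Ideal.Quotient.mk_surjective x
    obtain ⟨p, hp⟩ := hG b
    have h1 : Ideal.Quotient.mk I b = ∑ g ∈ G, p g • Ideal.Quotient.mk I g := by
      simp_rw [hmk, ← map_sum]
      rw [Ideal.Quotient.eq, hmem]
      simpa only [Algebra.smul_def, hmap] using hp
    rw [h1]
    exact Submodule.sum_mem _ fun g hg => Submodule.smul_mem _ _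
      (Submodule.subset_span (by simpa using ⟨g, hg, rfl⟩))
  have : Module.IsTorsionFree k[X] (B ⧸ I) := by
    refine ⟨fun p hp => ?_⟩
    have hp0 : p ≠ 0 := hp.ne_zero
    rw [isSMulRegular_iff_right_eq_zero_of_smul]
    intro x hx
    obtain ⟨b, rfl⟩ := Ideal.Quotient.mk_surjective x
    rw [hmk, Ideal.Quotient.eq_zero_iff_mem, hmem, Algebra.smul_def, hmap] at hx
    rw [Ideal.Quotient.eq_zero_iff_mem, hmem]
    exact htf p b hp0 hx
  have bas := Module.Free.chooseBasis k[X] (B ⧸ I)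
  set ι := Module.Free.ChooseBasisIndex k[X] (B ⧸ I)
  choose c hc using fun i => Ideal.Quotient.mk_surjective (I := I) (bas i)
  let : Algebra k[X][X] B := (aeval t : k[X][X] →ₐ[k[X]] B).toAlgebra
  have hmap' : ∀ p : k[X][X], algebraMap k[X][X] B p = aeval t p := fun _ => rfl
  have : IsScalarTower k k[X][X] B := .of_algebraMap_eq fun r => by
    rw [hmap', IsScalarTower.algebraMap_apply k k[X] k[X][X], Polynomial.algebraMap_eq (R := k[X]),
      aeval_C, ← IsScalarTower.algebraMap_apply]
  have hX : algebraMap k[X][X] B X = t := by rw [hmap', aeval_X]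
  have hC : ∀ (p : k[X]) (b : B), (C p : k[X][X]) • b = p • b := fun p b => by
    rw [Algebra.smul_def, hmap', aeval_C, Algebra.smul_def]
  have hdivX : ∀ (q : k[X][X]), algebraMap k[X][X] B q =
      algebraMap k[X] B (q.coeff 0) + t * algebraMap k[X][X] B q.divX := fun q => by
    conv_lhs => rw [← X_mul_divX_add q, map_add, map_mul, hX, hmap' (C _), aeval_C]
    ring
  have hbasis : IsBasisMod (X : k[X][X]) c := by
    constructor
    · intro b
      have h1 : Ideal.Quotient.mk I b =
          Ideal.Quotient.mk I (∑ i, (bas.repr (Ideal.Quotient.mk I b) i) • c i) := by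
        rw [map_sum]
        simp_rw [← hmk, hc]
        exact (bas.sum_repr _).symm
      rw [Ideal.Quotient.eq, hmem] at h1
      obtain ⟨b', hb'⟩ := h1
      refine ⟨fun i => C (bas.repr (Ideal.Quotient.mk I b) i), b', ?_⟩
      simp_rw [hC, hX]
      rw [← hb']; ring
    · intro q hq i
      rw [X_dvd_iff]
      have h1 : t ∣ ∑ i, (q i).coeff 0 • c i := by
        rw [hX] at hq
        have h2 : ∑ i, q i • c i = ∑ i, (q i).coeff 0 • c i +
            t * ∑ i, (q i).divX • c i := by
          rw [Finset.mul_sum, ← Finset.sum_add_distrib]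
          refine Finset.sum_congr rfl fun i _ => ?_
          rw [Algebra.smul_def, hdivX, Algebra.smul_def, Algebra.smul_def]; ring
        rw [h2] at hq
        exact (dvd_add_left (dvd_mul_right _ _)).1 hq
      have h3 : ∑ i, (q i).coeff 0 • bas i = 0 := by
        simp_rw [← hc, hmk, ← map_sum]
        rwa [Ideal.Quotient.eq_zero_iff_mem, hmem]
      exact Fintype.linearIndependent_iff.1 bas.linearIndependent _ h3 i
  have hfaith : FaithfulSMul k[X][X] B := by
    rw [faithfulSMul_iff_algebraMap_injective, injective_iff_map_eq_zero]
    have key : ∀ n (q : k[X][X]), q.natDegree ≤ n → algebraMap k[X][X] B q = 0 → q = 0 := by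
      intro n
      induction n with
      | zero =>
        intro q hq h
        rw [eq_C_of_natDegree_le_zero hq] at h ⊢
        rw [hmap', aeval_C, hmap] at h
        by_contra hne
        have h1 := htf (q.coeff 0) 1 (fun h0 => hne (by rw [h0, C_0])) (by rw [h]; simp)
        exact htu (isUnit_of_dvd_one h1)
      | succ n ih =>
        intro q hq h
        have h0 : q.coeff 0 = 0 := by
          by_contra hne
          rw [hdivX, hmap] at h
          have h1 := htf (q.coeff 0) 1 hne ⟨-algebraMap k[X][X] B q.divX, by
            rw [mul_one]; linear_combination h⟩
          exact htu (isUnit_of_dvd_one h1)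
        rw [hdivX, h0, map_zero, zero_add] at h
        have h2 := ih q.divX (by rw [natDegree_divX_eq_natDegree_tsub_one]; omega)
          ((mul_eq_zero.1 h).resolve_left ht)
        rw [← X_mul_divX_add q, h0, h2]; simp
    exact fun q => key _ q le_rfl
  have halg : Algebra.IsAlgebraic k[X][X] B := by
    rw [← trdeg_eq_zero_iff]
    have h1 := trdeg_add_eq k k[X] (A := k[X][X])
    have h2 := trdeg_add_eq k k[X][X] (A := B)
    rw [Polynomial.trdeg_of_isDomain, Polynomial.trdeg_of_isDomain] at h1
    rw [← h1, one_add_one_eq_two] at h2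
    rw [← h2] at htr
    have h3 : Algebra.trdeg k[X][X] B < Cardinal.aleph0 :=
      (le_add_self.trans htr).trans_lt (by exact_mod_cast (Cardinal.natCast_lt_aleph0 (n := 2)))
    obtain ⟨n, hn⟩ := Cardinal.lt_aleph0.1 h3
    rw [hn] at htr ⊢
    have : 2 + n ≤ 2 := by exact_mod_cast htr
    exact_mod_cast (by omega : n = 0)
  refine finiteType_of_isBasisMod_of_isIntegrallyClosed k (t := (X : k[X][X])) prime_X hbasis E ?_
  simpa only [hX] using hE

end TorsionFreeReduction

section Places
open Polynomial
universe u
variable {k B : Type u} {V : Type*} [Field k] [CharZero k] [CommRing B] [IsDomain B] [Algebra k B]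
  [IsIntegrallyClosed B] [Finite V]
  {F : V → Type*} [∀ v, Field (F v)] [∀ v, Algebra k (F v)] [∀ v, Algebra.EssFiniteType k (F v)]
  {P : ∀ v, Place k B (F v)} {t : B}

theorem finiteType_of_isMinimalPlaces (htr : Algebra.trdeg k B ≤ 2) (htu : ¬ IsUnit t)
    (ht : t ≠ 0) (hP : ControlsDvd P t) (hmin : IsMinimalPlaces P t)
    (E : Finset B) (hE : ∀ b : B, ∃ N : ℕ, t ^ N * b ∈ Algebra.adjoin k (E : Set B)) :
    Algebra.FiniteType k B := by
  obtain ⟨s, hs⟩ := Place.exists_isIntegral_ρ (P := P)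
  have hst : ∀ v, Transcendental k ((P v).ρ s) := by
    intro v h
    obtain ⟨x, hx⟩ := Place.exists_transcendental_ρ ht hP hmin v
    exact hx (isAlgebraic_of_isIntegral_adjoin_singleton h (hs v x))
  have hP1 : ∀ b, (∀ v, (P v).v t ≤ (P v).v b) → t ∣ b := fun b hb => by
    simpa using hP 1 b (by simpa using hb)
  refine finiteType_of_isTorsionFree_quotient htr htu ht s ?_ ?_ E hE
  · let : Algebra k[X] B := (aeval s : k[X] →ₐ[k] B).toAlgebra
    have hmap : ∀ p : k[X], algebraMap k[X] B p = aeval s p := fun _ => rfl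
    have : IsScalarTower k k[X] B := .of_algebraMap_eq fun c => by
      rw [hmap, Polynomial.algebraMap_eq, aeval_C]
    have hX : algebraMap k[X] B X = s := by rw [hmap, aeval_X]
    have hm : ∀ v, ∃ m : ℕ, (P v).v t = m := fun v => by
      obtain ⟨m, hm⟩ := ENat.ne_top_iff_exists.1
        (fun h => ht ((P v).eq_zero_of_v t h) : (P v).v t ≠ ⊤)
      exact ⟨m, hm.symm⟩
    choose m hm using hm
    have hN : ∀ v, IsNoetherian k[X] (B ⧸ (P v).level k (m v)) := fun v =>
      Place.isNoetherian_quotient_level ht hP hmin v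
        (Place.isNoetherian_quotient_ker v (by rw [hX]; exact hs v) (by rw [hX]; exact hst v)) _
    let I : Submodule k[X] B := (Ideal.span {t}).restrictScalars k[X]
    let g : B →ₗ[k[X]] (∀ v, B ⧸ (P v).level k (m v)) :=
      LinearMap.pi fun v => ((P v).level k (m v)).mkQ
    have hker : LinearMap.ker g ≤ I := by
      intro x hx
      refine Ideal.mem_span_singleton.2 (hP1 x fun v => ?_)
      have h1 := congrFun (LinearMap.mem_ker.1 hx) v
      have h2 : x ∈ (P v).level k (m v) := (Submodule.Quotient.mk_eq_zero _).1 h1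
      rw [hm]; exact h2
    have hB : IsNoetherian k[X] (B ⧸ LinearMap.ker g) :=
      isNoetherian_of_injective ((LinearMap.ker g).liftQ g le_rfl)
        (LinearMap.ker_eq_bot.1 (Submodule.ker_liftQ_eq_bot _ _ _ le_rfl))
    have hB' : IsNoetherian k[X] (B ⧸ I) :=
      isNoetherian_of_surjective (Submodule.factor hker)
        (LinearMap.range_eq_top.2 (Submodule.factor_surjective _))
    obtain ⟨G, hG⟩ := hB'.noetherian ⊤
    classical
    choose lift hlift using Submodule.Quotient.mk_surjective I
    refine ⟨G.image lift, fun b => ?_⟩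
    have hb : (Submodule.Quotient.mk b : B ⧸ I) ∈ Submodule.span k[X] (G : Set (B ⧸ I)) := by
      rw [hG]; trivial
    obtain ⟨p, hp⟩ := Submodule.mem_span_finset'.1 hb
    refine ⟨fun x => if h : Submodule.Quotient.mk x ∈ G then p ⟨_, h⟩ else 0, ?_⟩
    have h1 : b - ∑ x ∈ G.image lift,
        aeval s ((fun x => if h : (Submodule.Quotient.mk x : B ⧸ I) ∈ G then p ⟨_, h⟩ else 0) x) * x
        ∈ I := by
      rw [← Submodule.Quotient.mk_eq_zero, Submodule.Quotient.mk_sub, ← hp, sub_eq_zero,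
        ← Submodule.mkQ_apply, map_sum, Finset.sum_image fun x _ y _ h => by
          rw [← hlift x, ← hlift y, h], ← Finset.sum_coe_sort G]
      refine Finset.sum_congr rfl fun x _ => ?_
      simp only []
      rw [← hmap, ← Algebra.smul_def, map_smul, Submodule.mkQ_apply, hlift, dif_pos x.2]
    exact Ideal.mem_span_singleton.1 h1
  · intro p b hp hpb
    refine hP1 b fun v => ?_
    obtain ⟨c, hc⟩ := hpb
    have h1 := congrArg (P v).v hc
    rw [AddValuation.map_mul, AddValuation.map_mul] at h1
    have h2 : (P v).v (aeval s p) = 0 := by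
      by_contra h
      rw [← ne_eq, ← (P v).ρ_eq_zero, ← aeval_algHom_apply] at h
      exact hp ((transcendental_iff.1 (hst v)) p h)
    rw [h2, zero_add] at h1
    rw [h1]
    exact le_self_add

end Places

section Places
universe u
variable {k B : Type u} {V : Type*} [Field k] [CharZero k] [CommRing B] [IsDomain B] [Algebra k B]
  [IsIntegrallyClosed B] [Finite V]
  {F : V → Type*} [∀ v, Field (F v)] [∀ v, Algebra k (F v)] [∀ v, Algebra.EssFiniteType k (F v)]
  {P : ∀ v, Place k B (F v)} {t : B}

/-- An integrally closed domain of transcendence degree at most two, in which divisibility by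
powers of `t` is governed by finitely many places, is finitely generated as soon as it is so after
inverting `t`. -/
theorem finiteType_of_controlsDvd (htr : Algebra.trdeg k B ≤ 2)
    (ht : t ≠ 0) (hP : ControlsDvd P t)
    (E : Finset B) (hE : ∀ b : B, ∃ N : ℕ, t ^ N * b ∈ Algebra.adjoin k (E : Set B)) :
    Algebra.FiniteType k B := by
  classical
  by_cases htu : IsUnit t
  · obtain ⟨s, hs⟩ := htu.exists_left_inv
    refine ⟨⟨insert s E, eq_top_iff.2 fun b _ => ?_⟩⟩
    obtain ⟨N, hN⟩ := hE b
    have h1 : b = s ^ N * (t ^ N * b) := by rw [← mul_assoc, ← mul_pow, hs, one_pow, one_mul]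
    rw [h1]
    refine mul_mem (pow_mem (Algebra.subset_adjoin (by simp)) _) ?_
    exact Algebra.adjoin_mono (by simp) hN
  · obtain ⟨W, hW⟩ := exists_minimal_of_wellFoundedLT
      (fun W : Set V => ControlsDvd (fun v : W => P v) t) ⟨Set.univ, fun N b hb =>
        hP N b fun v => hb ⟨v, trivial⟩⟩
    refine finiteType_of_isMinimalPlaces htr htu ht hW.prop ?_ E hE
    intro v
    have h1 : ¬ ControlsDvd (fun w : (W \ {v.1} : Set V) => P w) t := fun h =>
      (hW.le_of_le h Set.sdiff_subset v.2).2 rfl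
    simp only [ControlsDvd] at h1
    push Not at h1
    obtain ⟨N, b, hb, hnd⟩ := h1
    refine ⟨N, b, fun w hw => hb ⟨w, w.2, fun h => hw (Subtype.ext h)⟩, ?_⟩
    by_contra hv
    refine hnd (hW.prop N b fun w => ?_)
    by_cases hw : w = v
    · rw [hw]; exact not_lt.1 hv
    · exact hb ⟨w, w.2, fun h => hw (Subtype.ext h)⟩

end Places

section QuotientTrdeg
open Polynomial
variable {k : Type*} {A : Type*} [Field k] [CommRing A] [IsDomain A] [Algebra k A]

theorem transcendental_adjoin_of_algebraicIndependent_quotient {π : A} (hπ : π ≠ 0) {ι : Type*}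
    {x : ι → A}
    (hx : AlgebraicIndependent k fun i => Ideal.Quotient.mkₐ k (Ideal.span {π}) (x i)) :
    Transcendental (Algebra.adjoin k (Set.range x)) π := by
  rw [transcendental_iff]
  have key : ∀ n (p : (Algebra.adjoin k (Set.range x))[X]), p.natDegree ≤ n →
      aeval π p = 0 → p = 0 := by
    have h0 : ∀ p : (Algebra.adjoin k (Set.range x))[X], aeval π p = 0 → p.coeff 0 = 0 := by
      intro p h
      have h1 : π ∣ ((p.coeff 0 : Algebra.adjoin k (Set.range x)) : A) := by
        rw [← X_mul_divX_add p, map_add, map_mul, aeval_X, aeval_C] at h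
        exact ⟨-aeval π p.divX, by
          change _ + ((p.coeff 0 : Algebra.adjoin k (Set.range x)) : A) = 0 at h
          linear_combination h⟩
      obtain ⟨q, hq⟩ := (Algebra.adjoin_range_eq_range_aeval k x).le (p.coeff 0).2
      rw [← Ideal.mem_span_singleton, ← Ideal.Quotient.eq_zero_iff_mem] at h1
      have h3 : MvPolynomial.aeval (fun i => Ideal.Quotient.mkₐ k (Ideal.span {π}) (x i)) q
          = 0 := by
        rw [← h1, ← hq, ← MvPolynomial.comp_aeval_apply]; rfl
      have h4 := (injective_iff_map_eq_zero _).1 hx q h3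
      rw [h4] at hq
      exact Subtype.ext (by simpa using hq.symm)
    intro n
    induction n with
    | zero =>
      intro p hp h
      rw [eq_C_of_natDegree_le_zero hp, h0 p h, C_0]
    | succ n ih =>
      intro p hp h
      have h1 : p = X * p.divX := by
        conv_lhs => rw [← X_mul_divX_add p, h0 p h, C_0, add_zero]
      rw [h1, map_mul, aeval_X] at h
      rw [h1, ih p.divX (by rw [natDegree_divX_eq_natDegree_tsub_one]; omega)
        ((mul_eq_zero.1 h).resolve_left hπ), mul_zero]
  exact fun p => key _ p le_rfl

theorem trdeg_quotient_span_singleton_add_one_le {π : A} (hπ : Prime π) :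
    Algebra.trdeg k (A ⧸ Ideal.span {π}) + 1 ≤ Algebra.trdeg k A := by
  have : (Ideal.span {π}).IsPrime := (Ideal.span_singleton_prime hπ.ne_zero).2 hπ
  have : FaithfulSMul k (A ⧸ Ideal.span {π}) :=
    (faithfulSMul_iff_algebraMap_injective _ _).2 (algebraMap k _).injective
  obtain ⟨s, hs⟩ := exists_isTranscendenceBasis k (A ⧸ Ideal.span {π})
  choose l hl using Ideal.Quotient.mkₐ_surjective k (Ideal.span {π})
  have h1 : AlgebraicIndependent k
      fun i : s => Ideal.Quotient.mkₐ k (Ideal.span {π}) (l i) := by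
    simpa only [hl] using hs.1
  have h2 := transcendental_adjoin_of_algebraicIndependent_quotient hπ.ne_zero h1
  have h3 : AlgebraicIndependent k (fun i : s => l i) :=
    AlgebraicIndependent.of_comp (Ideal.Quotient.mkₐ k (Ideal.span {π})) h1
  have h4 := (h3.option_iff_transcendental π).2 h2
  have h5 := h4.cardinalMk_le_trdeg
  rw [Cardinal.mk_option, hs.cardinalMk_eq_trdeg] at h5
  exact h5

end QuotientTrdeg

section PlaceOfPrime
open Polynomial
variable {k B A E F : Type*} [Field k]

theorem exists_forall_isIntegral_adjoin_singleton {E : Type*} [CommRing E] [IsDomain E]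
    [Algebra k E] [Algebra.FiniteType k E] (h : Algebra.trdeg k E ≤ 1) [CommRing F]
    [Algebra k F] (f : E →ₐ[k] F) :
    ∃ y : F, ∀ e, IsIntegral (Algebra.adjoin k {y}) (f e) := by
  obtain ⟨s, g, hinj, hfin⟩ := exists_finite_inj_algHom_of_fg k E
  have hs : Subsingleton (Fin s) := by
    have h1 := lift_trdeg_le_of_injective g hinj
    rw [MvPolynomial.trdeg_of_isDomain] at h1
    have h2 := h1.trans (Cardinal.lift_le.2 h)
    rw [← Fintype.card_le_one_iff_subsingleton]
    simpa using h2
  classical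
  let y : F := if h : Nonempty (Fin s) then f (g (MvPolynomial.X h.some)) else 0
  have hy : ∀ i, f (g (MvPolynomial.X i)) = y := fun i => by
    have : Nonempty (Fin s) := ⟨i⟩
    simp only [y, dif_pos this]
    rw [Subsingleton.elim i]
  have hmem : ∀ p, (f.comp g) p ∈ Algebra.adjoin k {y} := by
    intro p
    induction p using MvPolynomial.induction_on with
    | C a => 
      rw [← MvPolynomial.algebraMap_eq, AlgHom.commutes]; exact Subalgebra.algebraMap_mem _ _
    | add p q hp hq => rw [map_add]; exact add_mem hp hq
    | mul_X p i hp =>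
      rw [map_mul]
      refine mul_mem hp ?_
      rw [AlgHom.comp_apply, hy]
      exact Algebra.subset_adjoin rfl
  refine ⟨y, fun e => ?_⟩
  obtain ⟨p, hp, hpe⟩ := hfin.to_isIntegral e
  refine ⟨p.map ((f.comp g).codRestrict _ hmem).toRingHom, hp.map _, ?_⟩
  rw [eval₂_map]
  have h1 : (algebraMap (Algebra.adjoin k {y}) F).comp
      ((f.comp g).codRestrict _ hmem).toRingHom = f.toRingHom.comp g.toRingHom := rfl
  rw [h1]
  have h2 := hom_eval₂ p g.toRingHom f.toRingHom e
  have h3 : eval₂ g.toRingHom e p = 0 := hpe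
  rw [h3, map_zero] at h2
  exact h2.symm

theorem isAlgebraic_adjoin_singleton_of_transcendental [Field F] [Algebra k F]
    (h : Algebra.trdeg k F ≤ 1) {s : F} (hs : Transcendental k s) :
    Algebra.IsAlgebraic (Algebra.adjoin k {s}) F := by
  have h1 : AlgebraicIndependent k fun _ : Unit => s :=
    algebraicIndependent_unique_type_iff.2 hs
  have h2 := h1.isTranscendenceBasis_of_lift_trdeg_le_of_finite (by simpa using h)
  have := h2.isAlgebraic
  rwa [Set.range_const] at this

theorem exists_transcendental_div_of_eval₂_eq_zero [CommRing B] [CommRing A] [IsDomain A]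
    [IsNoetherianRing A] [Algebra k A] [Field F] [Algebra k F] (φ : B →+* A)
    (hφ : Function.Injective φ) {π : A} (hπ : Prime π)
    (r : A →ₐ[k] F) (hr : ∀ a, r a = 0 ↔ π ∣ a) {z : A} (hz : Transcendental k (r z))
    {p : B[X]} (hp : p ≠ 0) (hpz : p.eval₂ φ z = 0) :
    ∃ (a c : B) (n : ℕ) (d e : A), c ≠ 0 ∧ φ a = π ^ n * d ∧ φ c = π ^ n * e ∧
      r e ≠ 0 ∧ Transcendental k (r d / r e) := by
  classical
  have hfin : ∀ i ∈ p.support, FiniteMultiplicity π (φ (p.coeff i)) := fun i hi =>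
    FiniteMultiplicity.of_not_isUnit hπ.not_isUnit
      fun h => mem_support_iff.1 hi (hφ (by rw [h, map_zero]))
  obtain ⟨j, hj, hmin⟩ := p.support.exists_min_image (fun i => multiplicity π (φ (p.coeff i)))
    (support_nonempty.2 hp)
  set n := multiplicity π (φ (p.coeff j))
  have hd : ∀ i, ∃ d, φ (p.coeff i) = π ^ n * d := by
    intro i
    by_cases hi : i ∈ p.support
    · exact pow_dvd_of_le_multiplicity (hmin i hi)
    · exact ⟨0, by rw [notMem_support_iff.1 hi, map_zero, mul_zero]⟩
  choose d hd using hd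
  have hj0 : r (d j) ≠ 0 := by
    rw [ne_eq, hr]
    rintro ⟨e, he⟩
    refine (hfin j hj).not_pow_dvd_of_multiplicity_lt (Nat.lt_succ_self n) ⟨e, ?_⟩
    rw [hd, he, Nat.succ_eq_add_one]; ring
  have hsum : ∑ i ∈ p.support, r (d i) * r z ^ i = 0 := by
    have h1 : π ^ n * ∑ i ∈ p.support, d i * z ^ i = 0 := by
      rw [← hpz, eval₂_eq_sum, Polynomial.sum, Finset.mul_sum]
      exact Finset.sum_congr rfl fun i _ => by rw [hd]; ring
    have h2 := congrArg r ((mul_eq_zero.1 h1).resolve_left (pow_ne_zero _ hπ.ne_zero))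
    simpa using h2
  by_contra! hcon
  have halg : ∀ i, IsAlgebraic k (r (d i) / r (d j)) := by
    intro i
    by_contra hi
    exact hcon (p.coeff i) (p.coeff j) n (d i) (d j) (mem_support_iff.1 hj) (hd i) (hd j) hj0 hi
  let K := algebraicClosure k F
  let c : ℕ → K := fun i => ⟨r (d i) / r (d j), (mem_algebraicClosure_iff).2 (halg i)⟩
  have h1 : IsAlgebraic K (r z) := by
    refine ⟨∑ i ∈ p.support, C (c i) * X ^ i, ?_, ?_⟩
    · intro h
      have h2 := congrArg (coeff · j) h
      simp only [finsetSum_coeff, coeff_C_mul_X_pow, coeff_zero] at h2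
      rw [Finset.sum_ite_eq, if_pos hj] at h2
      have h3 := congrArg (algebraMap K F) h2
      change r (d j) / r (d j) = _ at h3
      rw [div_self hj0, map_zero] at h3
      exact one_ne_zero h3
    · rw [map_sum]
      have h2 : ∀ i, aeval (r z) (C (c i) * X ^ i) = (r (d j))⁻¹ * (r (d i) * r z ^ i) := by
        intro i
        rw [map_mul, map_pow, aeval_X, aeval_C]
        change r (d i) / r (d j) * _ = _
        ring
      rw [Finset.sum_congr rfl fun i _ => h2 i, ← Finset.mul_sum, hsum, mul_zero]
  exact hz (h1.restrictScalars k)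

theorem trdeg_fractionRing [CommRing E] [IsDomain E] [Algebra k E] :
    Algebra.trdeg k (FractionRing E) = Algebra.trdeg k E := by
  have : FaithfulSMul k E :=
    (faithfulSMul_iff_algebraMap_injective _ _).2 (algebraMap k _).injective
  have : Algebra.IsAlgebraic E (FractionRing E) := IsLocalization.isAlgebraic _ (nonZeroDivisors E)
  rw [← trdeg_add_eq k E (A := FractionRing E), trdeg_eq_zero (R := E), add_zero]

/-- A prime element of a surface algebra `A` containing `B` gives a place of `B`. -/
theorem exists_place_of_prime [CommRing B] [Algebra k B] [CommRing A] [IsDomain A]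
    [Algebra k A] [Algebra.FiniteType k A] (htr : Algebra.trdeg k A ≤ 2) (φ : B →ₐ[k] A)
    (hφ : Function.Injective φ) {π : A} (hπ : Prime π) [(Ideal.span {π}).IsPrime]
    {z : A} (hz : Transcendental k (Ideal.Quotient.mkₐ k (Ideal.span {π}) z))
    {p : B[X]} (hp : p ≠ 0) (hpz : p.eval₂ φ z = 0) :
    ∃ P : Place k B (FractionRing (A ⧸ Ideal.span {π})), ∀ b, P.v b = emultiplicity π (φ b) := by
  have : IsNoetherianRing A := Algebra.FiniteType.isNoetherianRing k A
  let F := FractionRing (A ⧸ Ideal.span {π})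
  have htr1 : Algebra.trdeg k (A ⧸ Ideal.span {π}) ≤ 1 := by
    have h := (trdeg_quotient_span_singleton_add_one_le (k := k) hπ).trans htr
    rwa [← one_add_one_eq_two, Cardinal.add_one_le_add_one_iff] at h
  let f : A ⧸ Ideal.span {π} →ₐ[k] F := IsScalarTower.toAlgHom k _ _
  have hf : Function.Injective f := IsFractionRing.injective _ _
  let r : A →ₐ[k] F := f.comp (Ideal.Quotient.mkₐ k _)
  have hr : ∀ a, r a = 0 ↔ π ∣ a := fun a => by
    rw [← Ideal.mem_span_singleton, ← Ideal.Quotient.eq_zero_iff_mem, ← map_eq_zero_iff f hf]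
    rfl
  obtain ⟨y, hy⟩ := exists_forall_isIntegral_adjoin_singleton htr1 f
  have hz' : Transcendental k (r z) := fun h => hz ((isAlgebraic_algHom_iff f hf).1 h)
  obtain ⟨a, c, n, d, e, hc, ha, hce, he, hde⟩ :=
    exists_transcendental_div_of_eval₂_eq_zero φ.toRingHom hφ hπ r hr hz' hp hpz
  have hv0 : ∀ a, emultiplicity π a ≠ 0 ↔ π ∣ a := fun a => by
    rw [ne_eq, emultiplicity_eq_zero, not_not]
  have hv : ∀ a, r a ≠ 0 → emultiplicity π (π ^ n * a) = n := fun a h => by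
    rw [emultiplicity_mul hπ, emultiplicity_pow_self hπ.ne_zero hπ.not_isUnit,
      not_not.1 (mt (hv0 a).1 (mt (hr a).2 h)), add_zero]
  refine ⟨{ v := (multiplicity_addValuation hπ).comap φ.toRingHom
            eq_zero_of_v := fun b hb => ?_
            ρ := r.comp φ
            ρ_eq_zero := fun b => (hr _).trans (hv0 _).symm
            y := y
            isIntegral_ρ := fun b => hy _
            isAlgebraic := fun s hs => isAlgebraic_adjoin_singleton_of_transcendental
              (by rwa [trdeg_fractionRing]) hs
            exists_transcendental := ⟨a, c, ?_, hc, fun a₁ c₁ h1 h2 h => ?_⟩ }, fun b => rfl⟩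
  · by_contra h
    exact finiteMultiplicity_iff_emultiplicity_ne_top.1 (FiniteMultiplicity.of_not_isUnit hπ.not_isUnit
      fun h' => h (hφ (h'.trans (map_zero φ).symm))) hb
  · have hd0 : r d ≠ 0 := by
      intro h
      rw [h, zero_div] at hde
      exact hde isAlgebraic_zero
    change emultiplicity π (φ.toRingHom a) = emultiplicity π (φ.toRingHom c)
    rw [ha, hce, hv d hd0, hv e he]
  · have h3 := congrArg φ.toRingHom h
    rw [map_mul, map_mul, ha, hce, mul_assoc, mul_assoc] at h3
    have h4 := congrArg r (mul_left_cancel₀ (pow_ne_zero _ hπ.ne_zero) h3)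
    rw [map_mul, map_mul] at h4
    have h5 : r (φ c₁) ≠ 0 := fun h' => (hv0 _).2 ((hr _).1 h') h2
    convert hde using 1
    change r (φ a₁) / r (φ c₁) = _
    rw [div_eq_div_iff h5 he]
    change r d * r (φ c₁) = r e * r (φ a₁) at h4
    rw [h4, mul_comm]

end PlaceOfPrime

section SurfaceCharts
open MvPolynomial

theorem pow_dvd_of_forall_emultiplicity_le {R : Type*} [CommRing R] [IsDomain R]
    [UniqueFactorizationMonoid R] {t b : R} (ht : t ≠ 0) {N : ℕ}
    (h : ∀ q ∈ UniqueFactorizationMonoid.factors t,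
      N • emultiplicity q t ≤ emultiplicity q b) : t ^ N ∣ b := by
  rw [UniqueFactorizationMonoid.dvd_iff_emultiplicity_le (pow_ne_zero _ ht)]
  intro p hp
  rw [emultiplicity_pow hp]
  by_cases hpt : p ∣ t
  · obtain ⟨q, hq, hpq⟩ := UniqueFactorizationMonoid.exists_mem_factors_of_dvd ht hp.irreducible hpt
    rw [← emultiplicity_eq_of_associated_left hpq, ← emultiplicity_eq_of_associated_left hpq,
      ← nsmul_eq_mul]
    exact h q hq
  · rw [emultiplicity_eq_zero.2 hpt, mul_zero]; exact zero_le

variable {k : Type*} [Field k]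

theorem exists_transcendental_mk_X {π : MvPolynomial (Fin 2) k} (hπ : Prime π) :
    ∃ j, Transcendental k (Ideal.Quotient.mkₐ k (Ideal.span {π}) (X j)) := by
  by_contra! h
  have key : ∀ j, ∃ p : Polynomial k, p ≠ 0 ∧ π ∣ Polynomial.aeval (X j) p := by
    intro j
    obtain ⟨p, hp, hpz⟩ := not_not.1 (h j)
    refine ⟨p, hp, ?_⟩
    rwa [Polynomial.aeval_algHom_apply, Ideal.Quotient.mkₐ_eq_mk,
      Ideal.Quotient.eq_zero_iff_mem, Ideal.mem_span_singleton] at hpz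
  have hdeg : ∀ j, π.degreeOf j = 0 := by
    intro j
    obtain ⟨p, hp, c, hc⟩ := key (j + 1)
    have hne : Polynomial.aeval (X (j + 1)) p ≠ (0 : MvPolynomial (Fin 2) k) := by
      intro h0
      exact hp ((transcendental_iff.1 (transcendental_X (R := k) (j + 1))) p h0)
    have h1 : (Polynomial.aeval (X (j + 1)) p : MvPolynomial (Fin 2) k).degreeOf j = 0 := by
      rw [Polynomial.aeval_eq_sum_range]
      refine Nat.le_zero.1 ((degreeOf_sum_le _ _ _).trans (Finset.sup_le fun i _ => ?_))
      rw [smul_eq_C_mul]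
      refine (degreeOf_C_mul_le _ _ _).trans ?_
      refine (degreeOf_pow_le _ _ _).trans ?_
      rw [degreeOf_X, if_neg (by fin_cases j <;> decide), mul_zero]
    rw [hc] at h1 hne
    rw [degreeOf_mul_eq (left_ne_zero_of_mul hne) (right_ne_zero_of_mul hne)] at h1
    omega
  have h2 : π = C (π.coeff 0) := by
    rw [← totalDegree_eq_zero_iff_eq_C]
    rw [totalDegree_eq_zero_iff]
    intro m hm j
    exact Nat.le_zero.1 ((monomial_le_degreeOf j hm).trans (hdeg j).le)
  refine hπ.not_isUnit ?_
  rw [h2]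
  refine (IsUnit.mk0 _ fun h0 => hπ.ne_zero ?_).map C
  rw [h2, h0, C_0]

theorem exists_eval₂_eq_zero_of_trdeg_eq {B A : Type*} [CommRing B] [IsDomain B] [Algebra k B] [CommRing A] [IsDomain A]
    [Algebra k A] (hB : Algebra.trdeg k B = 2) (hA : Algebra.trdeg k A = 2)
    {φ : B →ₐ[k] A} (hφ : Function.Injective φ) (z : A) :
    ∃ p : Polynomial B, p ≠ 0 ∧ p.eval₂ φ z = 0 := by
  let : Algebra B A := φ.toRingHom.toAlgebra
  have : IsScalarTower k B A := .of_algebraMap_eq fun c => (φ.commutes c).symm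
  have : FaithfulSMul k B :=
    (faithfulSMul_iff_algebraMap_injective _ _).2 (algebraMap k _).injective
  have : FaithfulSMul B A :=
    (faithfulSMul_iff_algebraMap_injective _ _).2 hφ
  have h := lift_trdeg_add_eq k B A
  rw [hB, hA] at h
  have h1 : Algebra.trdeg B A = 0 := by
    simp only [Cardinal.lift_ofNat] at h
    have h3 := Cardinal.eq_of_add_eq_add_left (h.trans (add_zero _).symm)
      (by exact_mod_cast (Cardinal.natCast_lt_aleph0 (n := 2)))
    simpa using h3
  have h4 := trdeg_eq_zero_iff.1 h1
  exact h4.isAlgebraic z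

end SurfaceCharts

section SurfaceCharts
open MvPolynomial
universe u
variable {k : Type u} [Field k] {ι : Type*}
  {φ : ι → MvPolynomial (Fin 2) k →ₐ[k] FractionRing (MvPolynomial (Fin 2) k)}
  {B : Subalgebra k (MvPolynomial (Fin 2) k)}

theorem mem_of_isIntegral_of_charts
    (hB : ∀ f, f ∈ B ↔ ∀ i, ∃ r,
      algebraMap (MvPolynomial (Fin 2) k) (FractionRing (MvPolynomial (Fin 2) k)) r = φ i f)
    {f : MvPolynomial (Fin 2) k} (hf : IsIntegral B f) : f ∈ B := by
  rw [hB]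
  intro i
  let R := MvPolynomial (Fin 2) k
  let K := FractionRing (MvPolynomial (Fin 2) k)
  refine IsIntegrallyClosed.algebraMap_eq_of_integral (R := R) (K := K) ?_
  choose r hr using fun b : B => (hB b).1 b.2 i
  have hinj : Function.Injective (algebraMap R K) := IsFractionRing.injective _ _
  let g : B →+* R :=
    { toFun := r
      map_one' := hinj (by rw [hr]; simp)
      map_zero' := hinj (by rw [hr]; simp)
      map_add' := fun a b => hinj (by rw [map_add, hr, hr, hr]; simp)
      map_mul' := fun a b => hinj (by rw [map_mul, hr, hr, hr]; simp) }
  obtain ⟨p, hp, hpf⟩ := hf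
  refine ⟨p.map g, hp.map _, ?_⟩
  rw [Polynomial.eval₂_map]
  have h1 : (algebraMap R K).comp g = (φ i).toRingHom.comp (algebraMap B R) :=
    RingHom.ext fun b => hr b
  rw [h1]
  have h2 := Polynomial.hom_eval₂ p (algebraMap B R) (φ i).toRingHom f
  rw [hpf, map_zero] at h2
  exact h2.symm

theorem isIntegrallyClosed_of_charts
    (hB : ∀ f, f ∈ B ↔ ∀ i, ∃ r,
      algebraMap (MvPolynomial (Fin 2) k) (FractionRing (MvPolynomial (Fin 2) k)) r = φ i f) :
    IsIntegrallyClosed B := by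
  let R := MvPolynomial (Fin 2) k
  let K := FractionRing (MvPolynomial (Fin 2) k)
  have hinj : Function.Injective (algebraMap R K) := IsFractionRing.injective _ _
  refine (isIntegrallyClosed_iff (FractionRing B)).2 fun {x} hx => ?_
  have hinj' : Function.Injective ((algebraMap R K).comp (algebraMap B R)) :=
    hinj.comp Subtype.val_injective
  let g : FractionRing B →+* K := IsFractionRing.lift hinj'
  have hg : ∀ b, g (algebraMap B _ b) = algebraMap R K b := fun b =>
    IsFractionRing.lift_algebraMap hinj' b
  obtain ⟨p, hp, hpx⟩ := hx
  have hpg : Polynomial.eval₂ ((algebraMap R K).comp (algebraMap B R)) (g x) p = 0 := by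
    have h2 := Polynomial.hom_eval₂ p (algebraMap B (FractionRing B)) g x
    rw [hpx, map_zero] at h2
    rw [h2]
    congr 1
    exact RingHom.ext fun b => (hg b).symm
  obtain ⟨r, hr⟩ := IsIntegrallyClosed.algebraMap_eq_of_integral (R := R) (K := K) (x := g x)
    ⟨p.map (algebraMap B R), hp.map _, by rw [Polynomial.eval₂_map]; exact hpg⟩
  have hrB : r ∈ B := mem_of_isIntegral_of_charts hB ⟨p, hp, hinj (by
    rw [Polynomial.hom_eval₂, hr, hpg, map_zero])⟩
  exact ⟨⟨r, hrB⟩, g.injective (by rw [hg]; exact hr)⟩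

theorem finiteType_of_charts_of_isAlgebraic [CharZero k] [Finite ι]
    (hφ : ∀ i, Function.Injective (φ i))
    (hlaurent : ∀ i f, ∃ (m : ℕ) (r : MvPolynomial (Fin 2) k),
      algebraMap (MvPolynomial (Fin 2) k) (FractionRing (MvPolynomial (Fin 2) k)) (X 1) ^ m * φ i f
        = algebraMap _ _ r)
    (hB : ∀ f, f ∈ B ↔ ∀ i, ∃ r,
      algebraMap (MvPolynomial (Fin 2) k) (FractionRing (MvPolynomial (Fin 2) k)) r = φ i f)
    [Algebra.IsAlgebraic B (MvPolynomial (Fin 2) k)] : Algebra.FiniteType k B := by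
  classical
  let R := MvPolynomial (Fin 2) k
  let K := FractionRing (MvPolynomial (Fin 2) k)
  have hinj : Function.Injective (algebraMap R K) := IsFractionRing.injective _ _
  have : IsIntegrallyClosed B := isIntegrallyClosed_of_charts hB
  have hR : Algebra.trdeg k R = 2 := by
    rw [MvPolynomial.trdeg_of_isDomain]; simp
  have : FaithfulSMul k B :=
    (faithfulSMul_iff_algebraMap_injective _ _).2 (algebraMap k _).injective
  have htr : Algebra.trdeg k B = 2 := by
    rw [← hR, ← trdeg_add_eq k B (A := R), trdeg_eq_zero (R := B), add_zero]
  have hmul : ∀ j : Fin 2, ∃ d : B, d ≠ 0 ∧ (d : R) * X j ∈ B := fun j => by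
    obtain ⟨d, hd, hdi⟩ :=
      (Algebra.IsAlgebraic.isAlgebraic (R := B) (X j : R)).exists_integral_multiple
    exact ⟨d, hd, mem_of_isIntegral_of_charts hB hdi⟩
  choose d hd0 hdX using hmul
  let t : B := d 0 * d 1
  have ht0 : t ≠ 0 := mul_ne_zero (hd0 0) (hd0 1)
  have htX : ∀ j : Fin 2, (t : R) * X j ∈ B := by
    intro j
    fin_cases j
    · have : (t : R) * X 0 = (d 1 : R) * ((d 0 : R) * X 0) := by simp only [t, Subalgebra.coe_mul]; ring
      exact this ▸ mul_mem (d 1).2 (hdX 0)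
    · have : (t : R) * X 1 = (d 0 : R) * ((d 1 : R) * X 1) := by simp only [t, Subalgebra.coe_mul]; ring
      exact this ▸ mul_mem (d 0).2 (hdX 1)
  let E : Finset B := {t, ⟨_, htX 0⟩, ⟨_, htX 1⟩}
  have hE : ∀ b : B, ∃ N : ℕ, t ^ N * b ∈ Algebra.adjoin k (E : Set B) := by
    have key : ∀ f : R, ∃ N : ℕ, ∃ e ∈ Algebra.adjoin k (E : Set B), (e : R) = (t : R) ^ N * f := by
      have htE : t ∈ Algebra.adjoin k (E : Set B) := Algebra.subset_adjoin (by simp [E])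
      intro f
      induction f using MvPolynomial.induction_on with
      | C a => exact ⟨0, algebraMap k B a, Subalgebra.algebraMap_mem _ _, by
          rw [pow_zero, one_mul]; rfl⟩
      | add f g hf hg =>
        obtain ⟨N, e, he, h⟩ := hf
        obtain ⟨N', e', he', h'⟩ := hg
        refine ⟨N + N', t ^ N' * e + t ^ N * e', add_mem (mul_mem (pow_mem htE _) he)
          (mul_mem (pow_mem htE _) he'), ?_⟩
        simp only [Subalgebra.coe_add, Subalgebra.coe_mul, Subalgebra.coe_pow, h, h']
        ring
      | mul_X f j hf =>
        obtain ⟨N, e, he, h⟩ := hf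
        refine ⟨N + 1, e * ⟨_, htX j⟩, mul_mem he (Algebra.subset_adjoin ?_), ?_⟩
        · fin_cases j <;> simp [E]
        · simp only [Subalgebra.coe_mul, h]; ring
    intro b
    obtain ⟨N, e, he, h⟩ := key b
    refine ⟨N, ?_⟩
    have : t ^ N * b = e := Subtype.ext (by rw [h]; simp)
    rwa [this]
  choose r hr using fun (i : ι) (b : B) => (hB b).1 b.2 i
  let ψ : ι → B →ₐ[k] R := fun i =>
    { toFun := r i
      map_one' := hinj (by rw [hr]; simp)
      map_zero' := hinj (by rw [hr]; simp)
      map_add' := fun a b => hinj (by rw [map_add, hr, hr, hr]; simp)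
      map_mul' := fun a b => hinj (by rw [map_mul, hr, hr, hr]; simp)
      commutes' := fun c => hinj (by
        rw [hr, ← IsScalarTower.algebraMap_apply]
        exact (φ i).commutes c) }
  have hψ : ∀ i b, algebraMap R K (ψ i b) = φ i b := hr
  let Q := (UniqueFactorizationMonoid.factors (t : R)).toFinset
  let V := ι ⊕ Q
  let π : V → R := Sum.elim (fun _ => X 1) fun q => q
  have hπ : ∀ v, Prime (π v) := by
    rintro (i | q)
    · exact MvPolynomial.X_prime
    · exact UniqueFactorizationMonoid.prime_of_factor _ (Multiset.mem_toFinset.1 q.2)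
  let χ : V → B →ₐ[k] R := Sum.elim ψ fun _ => B.val
  have hχ : ∀ v, Function.Injective (χ v) := by
    rintro (i | q)
    · intro a b hab
      refine Subtype.ext (hφ i ?_)
      rw [← hψ, ← hψ]
      exact congrArg _ hab
    · exact Subtype.val_injective
  have hprime : ∀ v, (Ideal.span {π v}).IsPrime := fun v =>
    (Ideal.span_singleton_prime (hπ v).ne_zero).2 (hπ v)
  have hP : ∀ v, ∃ P : Place k B (FractionRing (R ⧸ Ideal.span {π v})),
      ∀ b, P.v b = emultiplicity (π v) (χ v b) := fun v => by
    obtain ⟨j, hj⟩ := exists_transcendental_mk_X (hπ v)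
    obtain ⟨p, hp, hpz⟩ := exists_eval₂_eq_zero_of_trdeg_eq htr hR (hχ v) (X j)
    exact exists_place_of_prime hR.le (χ v) (hχ v) (hπ v) hj hp hpz
  choose P hP using hP
  refine finiteType_of_controlsDvd (P := P) htr.le ht0 ?_ E hE
  intro N b hb
  simp only [hP] at hb
  obtain ⟨f, hf⟩ : (t : R) ^ N ∣ b := by
    refine pow_dvd_of_forall_emultiplicity_le (fun h => ht0 (Subtype.ext h)) fun q hq => ?_
    exact hb (Sum.inr ⟨q, Multiset.mem_toFinset.2 hq⟩)
  have hfB : f ∈ B := by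
    rw [hB]
    intro i
    obtain ⟨m, s, hs⟩ := hlaurent i f
    have h1 : (X 1 : R) ^ m * ψ i b = ψ i t ^ N * s := hinj (by
      rw [map_mul, map_mul, map_pow, map_pow, hψ, hψ, hf, map_mul, map_pow, ← hs]; ring)
    have h2 := hb (Sum.inl i)
    change N • emultiplicity (X 1 : R) (ψ i t) ≤ emultiplicity (X 1) (ψ i b) at h2
    have hX : Prime (X 1 : R) := MvPolynomial.X_prime
    have h3 := congrArg (emultiplicity (X 1 : R)) h1
    rw [emultiplicity_mul hX, emultiplicity_mul hX, emultiplicity_pow hX (a := ψ i t),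
      emultiplicity_pow_self hX.ne_zero hX.not_isUnit, ← nsmul_eq_mul] at h3
    have hfin : N • emultiplicity (X 1 : R) (ψ i t) ≠ ⊤ := by
      rw [nsmul_eq_mul, ← emultiplicity_pow hX]
      refine finiteMultiplicity_iff_emultiplicity_ne_top.1
        (FiniteMultiplicity.of_not_isUnit hX.not_isUnit (pow_ne_zero _ fun h => ht0 ?_))
      exact hχ (Sum.inl i) (h.trans (map_zero _).symm)
    have h4 : (m : ℕ∞) ≤ emultiplicity (X 1 : R) s := by
      rw [← ENat.add_le_add_iff_left hfin, ← h3, add_comm]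
      gcongr
    obtain ⟨s', hs'⟩ := pow_dvd_of_le_emultiplicity h4
    refine ⟨s', mul_left_cancel₀ (pow_ne_zero m ((map_ne_zero_iff _ hinj).2 hX.ne_zero)) ?_⟩
    rw [hs, hs', map_mul, map_pow]
  exact ⟨⟨f, hfB⟩, Subtype.ext hf⟩

end SurfaceCharts

section LineRestriction
open Polynomial

theorem RingHom.Finite.of_injective_comp {R B A : Type*} [CommRing R] [IsNoetherianRing R]
    [CommRing B] [CommRing A] {g : R →+* B} {χ : B →+* A} (hχ : Function.Injective χ)
    (h : (χ.comp g).Finite) : g.Finite := by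
  let := g.toAlgebra
  let := (χ.comp g).toAlgebra
  have : Module.Finite R A := h
  let χ' : B →ₐ[R] A := { χ with commutes' := fun _ => rfl }
  exact Module.Finite.of_injective χ'.toLinearMap hχ

theorem finite_aeval_of_natDegree_pos {k : Type*} [Field k] {g : k[X]} (hg : 0 < g.natDegree) :
    (aeval g : k[X] →ₐ[k] k[X]).toRingHom.Finite := by
  let φ : k[X] →+* k[X] := (aeval g : k[X] →ₐ[k] k[X]).toRingHom
  have hφ : ∀ p, φ p = aeval g p := fun p => rfl
  have hφC : φ.comp C = C := RingHom.ext fun c => by simp [hφ]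
  have hg0 : g.leadingCoeff ≠ 0 := leadingCoeff_ne_zero.2 (by rintro rfl; simp at hg)
  have hX : φ.IsIntegralElem X := by
    let q : k[X] := C g.leadingCoeff⁻¹ * g
    have hq : q.Monic := by
      simp [q, Monic, leadingCoeff_mul, hg0]
    have hqd : 0 < q.degree := by
      rw [degree_C_mul (inv_ne_zero hg0)]; exact natDegree_pos_iff_degree_pos.1 hg
    refine ⟨q.map C - C (C g.leadingCoeff⁻¹ * X), ?_, ?_⟩
    · refine (hq.map C).sub_of_left (lt_of_le_of_lt degree_C_le ?_)
      rwa [degree_map_eq_of_injective C_injective]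
    · rw [eval₂_sub, eval₂_C, eval₂_map, hφC, eval₂_C_X]
      simp [q, hφ]
  have hint : φ.IsIntegral := fun p => by
    induction p using Polynomial.induction_on' with
    | add p q hp hq => exact hp.add φ hq
    | monomial n a =>
      rw [← C_mul_X_pow_eq_monomial]
      have : C a = φ (C a) := by simp [hφ]
      rw [this]
      refine RingHom.IsIntegralElem.mul φ φ.isIntegralElem_map ?_
      induction n with
      | zero => rw [pow_zero]; exact φ.isIntegralElem_one
      | succ n ih => rw [pow_succ]; exact ih.mul φ hX
  refine hint.to_finite (RingHom.FiniteType.of_comp_finiteType (f := C) ?_)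
  change (φ.comp C).FiniteType
  rw [hφC]
  rw [← Polynomial.algebraMap_eq, RingHom.finiteType_algebraMap]
  infer_instance

theorem exists_algHom_polynomial_natDegree_pos {k σ : Type*} [Field k] [Infinite k]
    {f : MvPolynomial σ k} (hf : ∀ c, f ≠ MvPolynomial.C c) :
    ∃ ψ : MvPolynomial σ k →ₐ[k] k[X], 0 < (ψ f).natDegree := by
  obtain ⟨p, hp⟩ : ∃ p, MvPolynomial.eval p f ≠ MvPolynomial.eval 0 f := by
    by_contra! h
    exact hf (MvPolynomial.eval 0 f) (MvPolynomial.funext fun p => by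
      rw [h, MvPolynomial.eval_C])
  refine ⟨MvPolynomial.aeval fun j => C (p j) * X, Nat.pos_of_ne_zero fun h => hp ?_⟩
  obtain ⟨c, hc⟩ := natDegree_eq_zero.1 h
  have key : ∀ a : k, MvPolynomial.eval (fun j => p j * a) f = c := fun a => by
    have h1 := congrArg (eval a) hc
    rw [eval_C, ← coe_evalRingHom, MvPolynomial.aeval_def, MvPolynomial.hom_eval₂] at h1
    rw [h1, MvPolynomial.eval, MvPolynomial.coe_eval₂Hom]
    congr 1
    · ext; simp
    · ext; simp
  have h1 := key 1
  have h0 := key 0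
  simp only [mul_one, mul_zero] at h1 h0
  exact h1.trans h0.symm

theorem finiteType_of_trdeg_le_one {k σ : Type*} [Field k] [Infinite k]
    (B : Subalgebra k (MvPolynomial σ k)) (hB : Algebra.trdeg k B ≤ 1) :
    Algebra.FiniteType k B := by
  by_cases hconst : ∀ f ∈ B, ∃ c, f = MvPolynomial.C c
  · have : B = ⊥ := by
      refine eq_bot_iff.2 fun f hf => ?_
      obtain ⟨c, rfl⟩ := hconst f hf
      exact Subalgebra.algebraMap_mem _ c
    rw [← Subalgebra.fg_iff_finiteType, this]
    exact Subalgebra.fg_bot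
  push Not at hconst
  obtain ⟨f, hfB, hf⟩ := hconst
  obtain ⟨ψ, hψ⟩ := exists_algHom_polynomial_natDegree_pos hf
  let g : k[X] →ₐ[k] B := aeval ⟨f, hfB⟩
  let χ : B →ₐ[k] k[X] := ψ.comp B.val
  have hχg : χ.comp g = aeval (ψ f) := by
    ext; simp [χ, g]
  have hψinj : Function.Injective (aeval (ψ f) : k[X] →ₐ[k] k[X]) := by
    refine transcendental_iff_injective.1 ?_
    have h := (Polynomial.transcendental_X k).aeval (ψ f) hψ.ne'
      (mem_nonZeroDivisors_of_ne_zero (leadingCoeff_ne_zero.2 fun h => by simp [h] at hψ))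
    rwa [aeval_X_left_apply] at h
  have hg : Function.Injective g := fun a b hab => hψinj (by
    rw [← hχg, AlgHom.comp_apply, hab, ← AlgHom.comp_apply])
  have hftr : Transcendental k (⟨f, hfB⟩ : B) := transcendental_iff_injective.2 hg
  have halg : ∀ b : B, IsAlgebraic (Algebra.adjoin k {(⟨f, hfB⟩ : B)}) b := by
    have h1 : AlgebraicIndependent k fun _ : Unit => (⟨f, hfB⟩ : B) :=
      algebraicIndependent_unique_type_iff.2 hftr
    have h2 := (h1.isTranscendenceBasis_of_lift_trdeg_le_of_finite (by simpa using hB)).isAlgebraic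
    rw [Set.range_const] at h2
    exact h2.isAlgebraic
  have hχ : Function.Injective χ := by
    rw [injective_iff_map_eq_zero]
    intro b hb
    by_contra hb0
    obtain ⟨a, ha, c, hc⟩ := (halg b).exists_nonzero_dvd (mem_nonZeroDivisors_of_ne_zero hb0)
    obtain ⟨⟨a, haf⟩, rfl⟩ : ∃ a', a' = a := ⟨_, rfl⟩
    rw [Algebra.adjoin_singleton_eq_range_aeval] at haf
    obtain ⟨p, rfl⟩ := haf
    have h1 : χ (g p) = 0 := by
      have h2 := congrArg χ hc
      rw [map_mul, hb, zero_mul] at h2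
      exact h2
    rw [← AlgHom.comp_apply, hχg, map_eq_zero_iff _ hψinj] at h1
    subst h1
    exact ha (Subtype.ext (by simp))
  have hfin := finite_aeval_of_natDegree_pos hψ
  have hgfin : g.toRingHom.Finite := by
    refine RingHom.Finite.of_injective_comp (χ := χ.toRingHom) hχ ?_
    convert hfin using 1
    rw [← hχg]
    rfl
  rw [← RingHom.finiteType_algebraMap]
  have h3 : (algebraMap k B) = g.toRingHom.comp C := RingHom.ext fun c => by simp [g]
  rw [h3]
  refine hgfin.finiteType.comp ?_
  rw [← Polynomial.algebraMap_eq, RingHom.finiteType_algebraMap]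
  infer_instance

end LineRestriction

section SurfaceCharts
open MvPolynomial
universe u

theorem finiteType_of_charts {k : Type u} [Field k] {ι : Type*}
    {φ : ι → MvPolynomial (Fin 2) k →ₐ[k] FractionRing (MvPolynomial (Fin 2) k)}
    {B : Subalgebra k (MvPolynomial (Fin 2) k)} [CharZero k] [Finite ι]
    (hφ : ∀ i, Function.Injective (φ i))
    (hlaurent : ∀ i f, ∃ (m : ℕ) (r : MvPolynomial (Fin 2) k),
      algebraMap (MvPolynomial (Fin 2) k) (FractionRing (MvPolynomial (Fin 2) k)) (X 1) ^ m * φ i f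
        = algebraMap _ _ r)
    (hB : ∀ f, f ∈ B ↔ ∀ i, ∃ r,
      algebraMap (MvPolynomial (Fin 2) k) (FractionRing (MvPolynomial (Fin 2) k)) r = φ i f) :
    Algebra.FiniteType k B := by
  by_cases h : Algebra.IsAlgebraic B (MvPolynomial (Fin 2) k)
  · exact finiteType_of_charts_of_isAlgebraic hφ hlaurent hB
  have hR : Algebra.trdeg k (MvPolynomial (Fin 2) k) = 2 := by
    rw [MvPolynomial.trdeg_of_isDomain]; simp
  have : FaithfulSMul k B :=
    (faithfulSMul_iff_algebraMap_injective _ _).2 (algebraMap k _).injective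
  refine finiteType_of_trdeg_le_one B ?_
  rw [← trdeg_eq_zero_iff, ← Ne, ← Cardinal.one_le_iff_ne_zero] at h
  have hadd := trdeg_add_eq k B (A := MvPolynomial (Fin 2) k)
  rw [hR] at hadd
  have h1 : Algebra.trdeg k B + 1 ≤ 2 := hadd ▸ (by gcongr)
  have hlt : Algebra.trdeg k B < Cardinal.aleph0 :=
    lt_of_le_of_lt (le_self_add.trans h1) (Cardinal.natCast_lt_aleph0 (n := 2))
  obtain ⟨n, hn⟩ := Cardinal.lt_aleph0.1 hlt
  rw [hn] at h1 ⊢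
  have h2 : ((n + 1 : ℕ) : Cardinal.{u}) ≤ (2 : ℕ) := by exact_mod_cast h1
  have h3 := Nat.cast_le.1 h2
  have h4 : n ≤ 1 := by omega
  exact_mod_cast h4

end SurfaceCharts

section HalfPlane
open Polynomial

/-- The value of a bivariate polynomial at `(u, τ)`, where `u` is the outer variable. -/
noncomputable def bival (P : ℝ[X][X]) (z : ℝ × ℝ) : ℝ := P.evalEval z.2 z.1

@[simp] theorem bival_add (P Q : ℝ[X][X]) (z : ℝ × ℝ) : bival (P + Q) z = bival P z + bival Q z :=
  evalEval_add ..

@[simp] theorem bival_mul (P Q : ℝ[X][X]) (z : ℝ × ℝ) : bival (P * Q) z = bival P z * bival Q z :=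
  evalEval_mul ..

@[simp] theorem bival_pow (P : ℝ[X][X]) (n : ℕ) (z : ℝ × ℝ) : bival (P ^ n) z = bival P z ^ n :=
  evalEval_pow ..

@[simp] theorem bival_zero (z : ℝ × ℝ) : bival 0 z = 0 := evalEval_zero ..

@[simp] theorem bival_one (z : ℝ × ℝ) : bival 1 z = 1 := evalEval_one ..

@[simp] theorem bival_C (c : ℝ[X]) (z : ℝ × ℝ) : bival (C c) z = c.eval z.2 := evalEval_C ..

@[simp] theorem bival_X (z : ℝ × ℝ) : bival X z = z.1 := evalEval_X ..

theorem bival_eq_eval_map (P : ℝ[X][X]) (z : ℝ × ℝ) :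
    bival P z = (P.map (evalRingHom z.2)).eval z.1 :=
  (map_evalRingHom_eval ..).symm

theorem bival_eq_sum (P : ℝ[X][X]) (z : ℝ × ℝ) :
    bival P z = ∑ i ∈ Finset.range (P.natDegree + 1), (P.coeff i).eval z.2 * z.1 ^ i := by
  rw [bival_eq_eval_map, eval_eq_sum_range' (n := P.natDegree + 1)]
  · simp
  · exact Nat.lt_succ_of_le natDegree_map_le

theorem continuous_bival (P : ℝ[X][X]) : Continuous (bival P) := by
  rw [show bival P = fun z => ∑ i ∈ Finset.range (P.natDegree + 1), (P.coeff i).eval z.2 * z.1 ^ i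
    from funext (bival_eq_sum P)]
  fun_prop

/-- Substitution of `p` for the outer variable and `X ^ n` for the inner one. -/
noncomputable def bisubst (p : ℝ[X][X]) (n : ℕ) : ℝ[X][X] →+* ℝ[X][X] :=
  eval₂RingHom (C.comp (expand ℝ n).toRingHom) p

@[simp] theorem bisubst_X (p : ℝ[X][X]) (n : ℕ) : bisubst p n X = p := by simp [bisubst]

@[simp] theorem bisubst_C (p : ℝ[X][X]) (n : ℕ) (c : ℝ[X]) :
    bisubst p n (C c) = C (expand ℝ n c) := by simp [bisubst]

theorem bival_bisubst (p : ℝ[X][X]) (n : ℕ) (P : ℝ[X][X]) (z : ℝ × ℝ) :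
    bival (bisubst p n P) z = bival P (bival p z, z.2 ^ n) := by
  induction P using Polynomial.induction_on' with
  | add P Q hP hQ => rw [map_add, bival_add, hP, hQ, bival_add]
  | monomial i c =>
    rw [← C_mul_X_pow_eq_monomial, map_mul, map_pow, bisubst_X, bisubst_C]
    simp [expand_eval]

/-- Functions on the half-plane `τ > 0` given by a polynomial in `u`, `τ` divided by a power
of `τ`. -/
def IsLaurent (g : ℝ × ℝ → ℝ) : Prop :=
  ∃ (N : ℕ) (r : ℝ[X][X]), ∀ z : ℝ × ℝ, 0 < z.2 → z.2 ^ N * g z = bival r z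

/-- Functions on the half-plane `τ > 0` given by a polynomial in `u`, `τ`. -/
def IsRegularAtBoundary (g : ℝ × ℝ → ℝ) : Prop :=
  ∃ r : ℝ[X][X], ∀ z : ℝ × ℝ, 0 < z.2 → g z = bival r z

/-- Polynomial maps of the half-plane `τ > 0` onto itself whose second component is a power
of `τ`. -/
structure IsTransition (θ : ℝ × ℝ → ℝ × ℝ) : Prop where
  exists_eq : ∃ (p : ℝ[X][X]) (n : ℕ), n ≠ 0 ∧ ∀ z, θ z = (bival p z, z.2 ^ n)
  exists_preimage : ∀ w : ℝ × ℝ, 0 < w.2 → ∃ z : ℝ × ℝ, 0 < z.2 ∧ θ z = w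

theorem IsTransition.comp {θ θ' : ℝ × ℝ → ℝ × ℝ} (h : IsTransition θ) (h' : IsTransition θ') :
    IsTransition (θ ∘ θ') := by
  obtain ⟨p, n, hn, hp⟩ := h.exists_eq
  obtain ⟨p', n', hn', hp'⟩ := h'.exists_eq
  refine ⟨⟨bisubst p' n' p, n' * n, mul_ne_zero hn' hn, fun z => ?_⟩, fun w hw => ?_⟩
  · rw [bival_bisubst, Function.comp_apply, hp, hp', pow_mul]
  · obtain ⟨z, hz, rfl⟩ := h.exists_preimage w hw
    obtain ⟨z', hz', rfl⟩ := h'.exists_preimage z hz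
    exact ⟨z', hz', rfl⟩

theorem IsTransition.id : IsTransition id :=
  ⟨⟨X, 1, one_ne_zero, fun z => by simp⟩, fun w hw => ⟨w, hw, rfl⟩⟩

theorem isTransition_add_mul_pow (c : ℝ) (a : ℕ) {n : ℕ} (hn : n ≠ 0) :
    IsTransition fun z => (c + z.1 * z.2 ^ a, z.2 ^ n) := by
  refine ⟨⟨C (C c) + X * C (X ^ a), n, hn, fun z => by simp⟩, fun w hw => ?_⟩
  have h1 : 0 < w.2 ^ (n⁻¹ : ℝ) := Real.rpow_pos_of_pos hw _
  refine ⟨((w.1 - c) / (w.2 ^ (n⁻¹ : ℝ)) ^ a, w.2 ^ (n⁻¹ : ℝ)), h1, Prod.ext ?_ ?_⟩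
  · dsimp only
    rw [div_mul_cancel₀ _ (pow_pos h1 a).ne']
    ring
  · exact Real.rpow_inv_natCast_pow hw.le hn

theorem IsTransition.continuous {θ : ℝ × ℝ → ℝ × ℝ} (h : IsTransition θ) : Continuous θ := by
  obtain ⟨p, n, -, hp⟩ := h.exists_eq
  rw [funext hp]
  exact (continuous_bival p).prodMk (continuous_snd.pow n)

theorem IsTransition.snd_pos {θ : ℝ × ℝ → ℝ × ℝ} (h : IsTransition θ) {z : ℝ × ℝ} (hz : 0 < z.2) :
    0 < (θ z).2 := by
  obtain ⟨p, n, -, hp⟩ := h.exists_eq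
  rw [hp]
  exact pow_pos hz n

theorem IsLaurent.comp {g : ℝ × ℝ → ℝ} (hg : IsLaurent g) {θ : ℝ × ℝ → ℝ × ℝ}
    (h : IsTransition θ) : IsLaurent (g ∘ θ) := by
  obtain ⟨p, n, -, hp⟩ := h.exists_eq
  obtain ⟨N, r, hr⟩ := hg
  refine ⟨n * N, bisubst p n r, fun z hz => ?_⟩
  rw [bival_bisubst, ← hp, ← hr _ (h.snd_pos hz), pow_mul, Function.comp_apply, hp]

theorem IsRegularAtBoundary.exists_le {g : ℝ × ℝ → ℝ} (hg : IsRegularAtBoundary g) (M : ℝ) :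
    ∃ B, ∀ z : ℝ × ℝ, 0 < z.2 → |z.1| ≤ M → z.2 ≤ M → |g z| ≤ B := by
  obtain ⟨r, hr⟩ := hg
  obtain ⟨B, hB⟩ := ((isCompact_Icc (a := -M) (b := M)).prod
    (isCompact_Icc (a := (0 : ℝ)) (b := M))).exists_bound_of_continuousOn
    (continuous_bival r).continuousOn
  refine ⟨B, fun z hz h1 h2 => ?_⟩
  rw [hr z hz]
  exact hB z ⟨abs_le.1 h1, hz.le, h2⟩

theorem IsLaurent.exists_le {g : ℝ × ℝ → ℝ} (hg : IsLaurent g) (M : ℝ) {ε : ℝ} (hε : 0 < ε) :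
    ∃ B, ∀ z : ℝ × ℝ, |z.1| ≤ M → ε ≤ z.2 → z.2 ≤ M → |g z| ≤ B := by
  obtain ⟨N, r, hr⟩ := hg
  obtain ⟨B, hB⟩ := ((isCompact_Icc (a := -M) (b := M)).prod
    (isCompact_Icc (a := ε) (b := M))).exists_bound_of_continuousOn (f := fun z => bival r z / z.2 ^ N)
    ((continuous_bival r).continuousOn.div (continuous_snd.pow N).continuousOn
      fun z hz => (pow_pos (hε.trans_le hz.2.1) N).ne')
  refine ⟨B, fun z h1 h2 h3 => ?_⟩
  have h4 : 0 < z.2 := hε.trans_le h2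
  have h5 := hB z ⟨abs_le.1 h1, h2, h3⟩
  rw [← hr z h4, mul_div_cancel_left₀ _ (pow_pos h4 N).ne'] at h5
  exact h5

theorem IsLaurent.isRegularAtBoundary_of_le {g : ℝ × ℝ → ℝ} (hg : IsLaurent g) {u ε B : ℝ}
    (hε : 0 < ε) (hB : ∀ z : ℝ × ℝ, |z.1 - u| < ε → 0 < z.2 → z.2 < ε → |g z| ≤ B) :
    IsRegularAtBoundary g := by
  obtain ⟨N, r, hr⟩ := hg
  induction N generalizing r with
  | zero => exact ⟨r, fun z hz => by simpa using hr z hz⟩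
  | succ N ih =>
    have hzero : ∀ v, |v - u| < ε → bival r (v, 0) = 0 := by
      intro v hv
      have h1 : Filter.Tendsto (fun τ : ℝ => bival r (v, τ)) (nhdsWithin 0 (Set.Ioi 0))
          (nhds (bival r (v, 0))) :=
        (((continuous_bival r).comp (Continuous.prodMk_right v)).tendsto 0).mono_left
          nhdsWithin_le_nhds
      refine tendsto_nhds_unique h1 (squeeze_zero_norm' (a := fun τ : ℝ => τ ^ (N + 1) * B) ?_ ?_)
      · filter_upwards [Ioo_mem_nhdsGT hε] with τ hτ
        rw [← hr (v, τ) hτ.1, norm_mul, Real.norm_eq_abs, Real.norm_eq_abs,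
          abs_of_pos (pow_pos hτ.1 _)]
        exact mul_le_mul_of_nonneg_left (hB (v, τ) hv hτ.1 hτ.2) (pow_pos hτ.1 _).le
      · have h2 : Filter.Tendsto (fun τ : ℝ => τ ^ (N + 1) * B) (nhds 0)
            (nhds ((0 : ℝ) ^ (N + 1) * B)) := Continuous.tendsto (by fun_prop) 0
        simp only [ne_eq, Nat.add_eq_zero_iff, one_ne_zero, and_false, not_false_eq_true, zero_pow,
          zero_mul] at h2
        exact h2.mono_left nhdsWithin_le_nhds
    have hmap : r.map (evalRingHom 0) = 0 := by
      refine Polynomial.eq_zero_of_infinite_isRoot _ (Set.Infinite.mono ?_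
        (Set.Ioo_infinite (show u - ε < u + ε by linarith)))
      intro v hv
      have := hzero v (abs_lt.2 ⟨by linarith [hv.1], by linarith [hv.2]⟩)
      rwa [bival_eq_eval_map] at this
    obtain ⟨r', rfl⟩ : C X ∣ r := by
      refine (C_dvd_iff_dvd_coeff _ _).2 fun i => X_dvd_iff.2 ?_
      rw [coeff_zero_eq_eval_zero]
      have := congrArg (coeff · i) hmap
      simpa using this
    refine ih r' fun z hz => mul_left_cancel₀ hz.ne' ?_
    have := hr z hz
    rw [bival_mul, bival_C, eval_X] at this
    rw [← this]
    ring

end HalfPlane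

section Tame
open Polynomial

/-- Boundedness of Laurent functions on `S` is detected by regularity after finitely many
transitions. -/
def IsTame (S : Set (ℝ × ℝ)) : Prop :=
  ∃ Ψ : Set (ℝ × ℝ → ℝ × ℝ), Ψ.Finite ∧ (∀ θ ∈ Ψ, IsTransition θ) ∧
    ∀ g, IsLaurent g → ((∃ B, ∀ z ∈ S, |g z| ≤ B) ↔ ∀ θ ∈ Ψ, IsRegularAtBoundary (g ∘ θ))

theorem isTame_empty : IsTame ∅ :=
  ⟨∅, Set.finite_empty, by simp, fun g _ => by simp⟩

theorem IsTame.union {S T : Set (ℝ × ℝ)} (hS : IsTame S) (hT : IsTame T) : IsTame (S ∪ T) := by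
  obtain ⟨Ψ, hΨ, hθ, h⟩ := hS
  obtain ⟨Ψ', hΨ', hθ', h'⟩ := hT
  refine ⟨Ψ ∪ Ψ', hΨ.union hΨ', fun θ hθΨ => hθΨ.elim (hθ θ) (hθ' θ), fun g hg => ?_⟩
  simp only [Set.mem_union, or_imp, forall_and]
  rw [← h g hg, ← h' g hg]
  constructor
  · rintro ⟨B, hB⟩
    exact ⟨⟨B, hB.1⟩, ⟨B, hB.2⟩⟩
  · rintro ⟨⟨B, hB⟩, ⟨B', hB'⟩⟩
    exact ⟨max B B', fun z hz => (hB z hz).trans (le_max_left ..),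
      fun z hz => (hB' z hz).trans (le_max_right ..)⟩

theorem IsTame.biUnion {ι : Type*} (s : Finset ι) {S : ι → Set (ℝ × ℝ)}
    (h : ∀ i ∈ s, IsTame (S i)) : IsTame (⋃ i ∈ s, S i) := by
  classical
  induction s using Finset.induction_on with
  | empty => simpa using isTame_empty
  | insert a s ha ih =>
    rw [Finset.set_biUnion_insert]
    exact (h a (Finset.mem_insert_self a s)).union
      (ih fun i hi => h i (Finset.mem_insert_of_mem hi))

theorem IsTame.image {S : Set (ℝ × ℝ)} (hS : IsTame S) {θ : ℝ × ℝ → ℝ × ℝ}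
    (h : IsTransition θ) : IsTame (θ '' S) := by
  obtain ⟨Ψ, hΨ, hθ, hg⟩ := hS
  refine ⟨(fun θ' => θ ∘ θ') '' Ψ, hΨ.image _, ?_, fun g hgL => ?_⟩
  · rintro _ ⟨θ', hθ', rfl⟩
    exact h.comp (hθ θ' hθ')
  · rw [Set.forall_mem_image]
    simp only [Set.forall_mem_image]
    exact hg _ (hgL.comp h)

theorem IsTame.of_subset_union {S T : Set (ℝ × ℝ)} (hT : IsTame T) {M ε : ℝ} (hε : 0 < ε)
    (hST : ∀ z ∈ S, z ∈ T ∨ |z.1| ≤ M ∧ ε ≤ z.2 ∧ z.2 ≤ M)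
    (hTS : ∀ z ∈ T, z ∈ S ∨ |z.1| ≤ M ∧ ε ≤ z.2 ∧ z.2 ≤ M) : IsTame S := by
  obtain ⟨Ψ, hΨ, hθ, h⟩ := hT
  refine ⟨Ψ, hΨ, hθ, fun g hg => ?_⟩
  rw [← h g hg]
  obtain ⟨B', hB'⟩ := hg.exists_le M hε
  constructor
  · rintro ⟨B, hB⟩
    refine ⟨max B B', fun z hz => (hTS z hz).elim (fun h => (hB z h).trans (le_max_left ..)) ?_⟩
    exact fun h => (hB' z h.1 h.2.1 h.2.2).trans (le_max_right ..)
  · rintro ⟨B, hB⟩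
    refine ⟨max B B', fun z hz => (hST z hz).elim (fun h => (hB z h).trans (le_max_left ..)) ?_⟩
    exact fun h => (hB' z h.1 h.2.1 h.2.2).trans (le_max_right ..)

theorem isTame_of_box_subset {S : Set (ℝ × ℝ)} {M u ε : ℝ} (hε : 0 < ε)
    (hS : ∀ z ∈ S, |z.1| ≤ M ∧ 0 < z.2 ∧ z.2 ≤ M)
    (hbox : ∀ z : ℝ × ℝ, |z.1 - u| < ε → 0 < z.2 → z.2 < ε → z ∈ S) : IsTame S := by
  refine ⟨{id}, Set.finite_singleton _, by simpa using IsTransition.id, fun g hg => ?_⟩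
  simp only [Set.mem_singleton_iff, forall_eq, Function.comp_id]
  constructor
  · rintro ⟨B, hB⟩
    exact hg.isRegularAtBoundary_of_le hε fun z h1 h2 h3 => hB z (hbox z h1 h2 h3)
  · intro hreg
    obtain ⟨B, hB⟩ := IsRegularAtBoundary.exists_le hreg M
    exact ⟨B, fun z hz => hB z (hS z hz).2.1 (hS z hz).1 (hS z hz).2.2⟩

/-- The part of `S` in a box around the boundary point `(u, 0)`. -/
def boxPart (S : Set (ℝ × ℝ)) (u η ε : ℝ) : Set (ℝ × ℝ) :=
  {z | z ∈ S ∧ |z.1 - u| < η ∧ 0 < z.2 ∧ z.2 < ε}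

/-- `S` is tame near the boundary point `(u, 0)`. -/
def IsTameAt (S : Set (ℝ × ℝ)) (u : ℝ) : Prop :=
  ∃ η > 0, ∃ ε > 0, IsTame (boxPart S u η ε)

theorem exists_isTame_of_forall_isTameAt {S : Set (ℝ × ℝ)} {C : ℝ}
    (h : ∀ u, |u| ≤ C → IsTameAt S u) :
    ∃ T, IsTame T ∧ ∃ ε > 0, ∃ M, (∀ z ∈ S, |z.1| ≤ C → 0 < z.2 → z.2 < ε → z ∈ T) ∧
      ∀ z ∈ T, z ∈ S ∧ |z.1| ≤ M ∧ 0 < z.2 ∧ z.2 ≤ M := by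
  classical
  have h' : ∀ u : Set.Icc (-C) C, IsTameAt S u := fun u => h u (abs_le.2 u.2)
  choose η hη ε hε ht using h'
  obtain ⟨s, hs⟩ := (isCompact_Icc (a := -C) (b := C)).elim_finite_subcover
    (fun u : Set.Icc (-C) C => Metric.ball (u : ℝ) (η u)) (fun u => Metric.isOpen_ball)
    (fun u hu => Set.mem_iUnion.2 ⟨⟨u, hu⟩, Metric.mem_ball_self (hη _)⟩)
  refine ⟨⋃ u ∈ s, boxPart S u (η u) (ε u), IsTame.biUnion s fun u _ => ht u, ?_⟩
  have hε' : ∃ ε' > 0, ∀ u ∈ s, ε' ≤ ε u := by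
    rcases s.eq_empty_or_nonempty with rfl | hne
    · exact ⟨1, one_pos, by simp⟩
    · obtain ⟨u, hu, hmin⟩ := s.exists_min_image ε hne
      exact ⟨ε u, hε u, hmin⟩
  obtain ⟨ε', hε'0, hε'⟩ := hε'
  refine ⟨ε', hε'0, ∑ u ∈ s, (|(u : ℝ)| + η u + ε u), fun z hz h1 h2 h3 => ?_, fun z hz => ?_⟩
  · obtain ⟨u, hus, hu⟩ := Set.mem_iUnion₂.1 (hs (abs_le.1 h1))
    exact Set.mem_iUnion₂.2 ⟨u, hus, hz, by rwa [Metric.mem_ball, Real.dist_eq] at hu, h2,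
      h3.trans_le (hε' u hus)⟩
  · obtain ⟨u, hus, hzS, hu, h2, h3⟩ := Set.mem_iUnion₂.1 hz
    have hle : |(u : ℝ)| + η u + ε u ≤ ∑ u ∈ s, (|(u : ℝ)| + η u + ε u) :=
      Finset.single_le_sum (f := fun u : Set.Icc (-C) C => |(u : ℝ)| + η u + ε u)
        (fun v _ => by have := hη v; have := hε v; positivity) hus
    have h4 : |z.1| ≤ |z.1 - u| + |(u : ℝ)| := by simpa using abs_add_le (z.1 - u) u
    have := hε u
    have := hη u
    have := abs_nonneg (u : ℝ)
    exact ⟨hzS, by linarith, h2, by linarith⟩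

end Tame

section Separated
open Polynomial

/-- Near `τ = 0` the set `S` is a union of connected components of the complement of the
curve `P = 0`. -/
structure IsSeparatedBy (S : Set (ℝ × ℝ)) (P : ℝ[X][X]) (δ : ℝ) : Prop where
  subset_of_isPreconnected : ∀ D : Set (ℝ × ℝ), IsPreconnected D →
    (∀ z ∈ D, 0 < z.2 ∧ z.2 < δ ∧ bival P z ≠ 0) → (D ∩ S).Nonempty → D ⊆ S
  ne_zero : ∀ z ∈ S, 0 < z.2 → z.2 < δ → bival P z ≠ 0

variable {S : Set (ℝ × ℝ)} {P : ℝ[X][X]} {δ : ℝ}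

theorem IsSeparatedBy.mem_horizontal (h : IsSeparatedBy S P δ) {u u' τ : ℝ} (hτ : 0 < τ)
    (hτδ : τ < δ) (hne : ∀ t ∈ Set.uIcc u u', bival P (t, τ) ≠ 0) (hu : (u, τ) ∈ S) :
    (u', τ) ∈ S := by
  refine h.subset_of_isPreconnected ((fun t => (t, τ)) '' Set.uIcc u u')
    (isPreconnected_uIcc.image _ (by fun_prop)) ?_ ⟨(u, τ), ⟨u, Set.left_mem_uIcc, rfl⟩, hu⟩
    ⟨u', Set.right_mem_uIcc, rfl⟩
  rintro _ ⟨t, ht, rfl⟩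
  exact ⟨hτ, hτδ, hne t ht⟩

theorem IsSeparatedBy.mem_vertical (h : IsSeparatedBy S P δ) {u τ τ' : ℝ} (hτ : 0 < τ)
    (hτδ : τ < δ) (hτ' : 0 < τ') (hτδ' : τ' < δ)
    (hne : ∀ t ∈ Set.uIcc τ τ', bival P (u, t) ≠ 0) (hu : (u, τ) ∈ S) :
    (u, τ') ∈ S := by
  refine h.subset_of_isPreconnected ((fun t => (u, t)) '' Set.uIcc τ τ')
    (isPreconnected_uIcc.image _ (by fun_prop)) ?_ ⟨(u, τ), ⟨τ, Set.left_mem_uIcc, rfl⟩, hu⟩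
    ⟨τ', Set.right_mem_uIcc, rfl⟩
  rintro _ ⟨t, ht, rfl⟩
  exact ⟨(lt_min hτ hτ').trans_le ht.1, ht.2.trans_lt (max_lt hτδ hτδ'), hne t ht⟩

theorem IsSeparatedBy.preimage (h : IsSeparatedBy S P δ) {θ : ℝ × ℝ → ℝ × ℝ}
    (hθ : Continuous θ) {p : ℝ[X][X]} {n : ℕ} (hn : n ≠ 0)
    (hp : ∀ z, θ z = (bival p z, z.2 ^ n)) {e : ℕ} {P₁ : ℝ[X][X]}
    (hP : bisubst p n P = C (X ^ e) * P₁) : IsSeparatedBy (θ ⁻¹' S) P₁ (min δ 1) := by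
  have hval : ∀ z, bival P (θ z) = z.2 ^ e * bival P₁ z := fun z => by
    rw [hp, ← bival_bisubst, hP]; simp
  have hsnd : ∀ z : ℝ × ℝ, 0 < z.2 → z.2 < min δ 1 → 0 < (θ z).2 ∧ (θ z).2 < δ := by
    intro z h1 h2
    rw [hp]
    exact ⟨pow_pos h1 n, (pow_le_of_le_one h1.le (h2.trans_le (min_le_right ..)).le hn).trans_lt
      (h2.trans_le (min_le_left ..))⟩
  constructor
  · rintro D hD hne ⟨z, hzD, hzS⟩
    refine Set.image_subset_iff.1 (h.subset_of_isPreconnected (θ '' D)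
      (hD.image _ hθ.continuousOn) ?_ ⟨θ z, ⟨z, hzD, rfl⟩, hzS⟩)
    rintro _ ⟨w, hw, rfl⟩
    obtain ⟨h1, h2, h3⟩ := hne w hw
    refine ⟨(hsnd w h1 h2).1, (hsnd w h1 h2).2, ?_⟩
    rw [hval]
    exact mul_ne_zero (pow_pos h1 e).ne' h3
  · intro z hz h1 h2 h3
    refine h.ne_zero _ hz (hsnd z h1 h2).1 (hsnd z h1 h2).2 ?_
    rw [hval, h3, mul_zero]

theorem bival_zero_zero (P : ℝ[X][X]) : bival P (0, 0) = (P.coeff 0).eval 0 := by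
  rw [bival_eq_eval_map, ← coeff_zero_eq_eval_zero, coeff_map]
  rfl

theorem hasDerivAt_bival (P : ℝ[X][X]) (u τ : ℝ) :
    HasDerivAt (fun t => bival P (t, τ)) (bival (derivative P) (u, τ)) u := by
  simp only [bival_eq_eval_map, ← derivative_map]
  exact Polynomial.hasDerivAt _ _

theorem exists_forall_bival_pos {P : ℝ[X][X]} {u τ : ℝ} (h : 0 < bival P (u, τ)) :
    ∃ η > 0, ∀ z : ℝ × ℝ, |z.1 - u| < η → |z.2 - τ| < η → 0 < bival P z := by
  obtain ⟨η, hη, hball⟩ := Metric.eventually_nhds_iff.1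
    ((continuous_bival P).continuousAt.eventually_const_lt h)
  refine ⟨η, hη, fun z h1 h2 => hball ?_⟩
  rw [Prod.dist_eq, Real.dist_eq, Real.dist_eq]
  exact max_lt h1 h2

theorem exists_forall_bival_ne_zero {P : ℝ[X][X]} {u τ : ℝ} (h : bival P (u, τ) ≠ 0) :
    ∃ η > 0, ∀ z : ℝ × ℝ, |z.1 - u| < η → |z.2 - τ| < η → bival P z ≠ 0 := by
  have hsq : 0 < bival (P ^ 2) (u, τ) := by
    rw [bival_pow]; positivity
  obtain ⟨η, hη, hpos⟩ := exists_forall_bival_pos hsq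
  exact ⟨η, hη, fun z h1 h2 h3 => by simpa [h3] using hpos z h1 h2⟩

theorem isTame_boxPart_of_box_subset {S : Set (ℝ × ℝ)} {η ε u r : ℝ}
    (hr : 0 < r) (hbox : ∀ z : ℝ × ℝ, |z.1 - u| < r → 0 < z.2 → z.2 < r → z ∈ boxPart S 0 η ε) :
    IsTame (boxPart S 0 η ε) := by
  refine isTame_of_box_subset (M := max η ε) hr (fun z hz => ?_) hbox
  have h1 := hz.2.1
  rw [sub_zero] at h1
  exact ⟨h1.le.trans (le_max_left ..), hz.2.2.1, hz.2.2.2.le.trans (le_max_right ..)⟩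

theorem IsSeparatedBy.isTameAt_of_ne_zero (h : IsSeparatedBy S P δ) (hδ : 0 < δ)
    (hP : (P.coeff 0).eval 0 ≠ 0) : IsTameAt S 0 := by
  rw [← bival_zero_zero] at hP
  obtain ⟨η₀, hη₀, hne⟩ := exists_forall_bival_ne_zero hP
  simp only [sub_zero] at hne
  set η := min η₀ δ
  have hη : 0 < η := lt_min hη₀ hδ
  refine ⟨η, hη, η, hη, ?_⟩
  rcases (boxPart S 0 η η).eq_empty_or_nonempty with he | ⟨z, hzS, hz⟩
  · rw [he]
    exact isTame_empty
  have hsub : Set.Ioo (-η) η ×ˢ Set.Ioo 0 η ⊆ S := by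
    refine h.subset_of_isPreconnected _ (isPreconnected_Ioo.prod isPreconnected_Ioo) ?_
      ⟨z, ⟨abs_lt.1 (by simpa using hz.1), hz.2⟩, hzS⟩
    rintro w ⟨h1, h2⟩
    refine ⟨h2.1, h2.2.trans_le (min_le_right ..), hne w ((abs_lt.2 h1).trans_le (min_le_left ..)) ?_⟩
    rw [abs_of_pos h2.1]
    exact h2.2.trans_le (min_le_left ..)
  exact isTame_boxPart_of_box_subset (u := 0) hη fun w h1 h2 h3 =>
    ⟨hsub ⟨abs_lt.1 (by simpa using h1), h2, h3⟩, h1, h2, h3⟩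

theorem IsSeparatedBy.exists_box_subset (h : IsSeparatedBy S P δ) {η : ℝ}
    (hderiv : ∀ z : ℝ × ℝ, |z.1| < η → 0 ≤ z.2 → z.2 < η → 0 < bival (derivative P) z)
    (hP : bival P (0, 0) = 0) (hη : 0 < η) (hδ : 0 < δ) :
    ∃ r > 0, r ≤ η / 4 ∧ ∀ z ∈ boxPart S 0 η r, 0 < bival P z →
      ∀ w : ℝ × ℝ, |w.1 - η / 2| < r → 0 < w.2 → w.2 < r → w ∈ S := by
  have hmono : ∀ τ, 0 ≤ τ → τ < η →
      StrictMonoOn (fun t => bival P (t, τ)) (Set.Ioo (-η) η) := by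
    intro τ hτ hτη
    refine strictMonoOn_of_deriv_pos (convex_Ioo _ _)
      ((continuous_bival P).comp (Continuous.prodMk_left τ)).continuousOn fun t ht => ?_
    rw [(hasDerivAt_bival P t τ).deriv]
    rw [interior_Ioo] at ht
    exact hderiv (t, τ) (abs_lt.2 ht) hτ hτη
  have hpos : 0 < bival P (η / 2, 0) := by
    refine hP.symm.trans_lt (hmono 0 le_rfl hη (a := 0) (b := η / 2) ⟨?_, hη⟩ ⟨?_, ?_⟩ ?_) <;>
      linarith
  obtain ⟨r₀, hr₀, hr⟩ := exists_forall_bival_pos hpos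
  refine ⟨min r₀ (min (η / 4) δ), by positivity, (min_le_right ..).trans (min_le_left ..), ?_⟩
  rintro ⟨u, τ⟩ ⟨hzS, hu, hτ, hτr⟩ hz ⟨u', τ'⟩ hu' hτ' hτr'
  simp only [lt_min_iff, sub_zero] at *
  obtain ⟨hu1, hu2⟩ := abs_lt.1 hu
  have hbox : ∀ v t, |v - η / 2| < r₀ → 0 < t → t < r₀ → 0 < bival P (v, t) := by
    intro v t h1 h2 h3
    exact hr (v, t) h1 (by simpa [abs_of_pos h2] using h3)
  have h1 : (η / 2, τ) ∈ S := by
    refine h.mem_horizontal hτ hτr.2.2 (fun t ht => ?_) hzS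
    have hmin : 0 < bival P (min u (η / 2), τ) := by
      rcases min_choice u (η / 2) with he | he <;> rw [he]
      · exact hz
      · exact hbox _ _ (by simpa using hr₀) hτ hτr.1
    have hτη : τ < η := by linarith [hτr.2.1]
    refine (hmin.trans_le ((hmono τ hτ.le hτη).monotoneOn ⟨?_, ?_⟩
      ⟨?_, ?_⟩ ht.1)).ne'
    · exact lt_min (by linarith) (by linarith)
    · exact (min_le_left ..).trans_lt hu2
    · exact (lt_min (by linarith) (by linarith)).trans_le ht.1
    · exact ht.2.trans_lt (max_lt hu2 (by linarith))
  have h2 : (η / 2, τ') ∈ S := by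
    refine h.mem_vertical hτ hτr.2.2 hτ' hτr'.2.2 (fun t ht => (hbox _ _ (by simpa using hr₀)
      ((lt_min hτ hτ').trans_le ht.1) (ht.2.trans_lt (max_lt hτr.1 hτr'.1))).ne') h1
  refine h.mem_horizontal hτ' hτr'.2.2 (fun t ht => (hbox _ _ ?_ hτ' hτr'.1).ne') h2
  have h3 := Set.abs_sub_left_of_mem_uIcc ht
  exact h3.trans_lt hu'.1

theorem IsSeparatedBy.neg (h : IsSeparatedBy S P δ) : IsSeparatedBy S (-P) δ := by
  have hneg : ∀ z, bival (-P) z = - bival P z := fun z => evalEval_neg ..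
  refine ⟨fun D hD hne => h.subset_of_isPreconnected D hD fun z hz => ?_, fun z hz h1 h2 => ?_⟩
  · simpa [hneg] using hne z hz
  · rw [hneg, neg_ne_zero]
    exact h.ne_zero z hz h1 h2

theorem IsSeparatedBy.reflect (h : IsSeparatedBy S P δ) :
    IsSeparatedBy ((fun z : ℝ × ℝ => (-z.1, z.2)) ⁻¹' S) (bisubst (-X) 1 P) (min δ 1) := by
  refine h.preimage (p := -X) (n := 1) (e := 0) (by fun_prop) one_ne_zero (fun z => ?_) (by simp)
  have : bival (-X) z = - bival X z := evalEval_neg ..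
  simp [this]

theorem derivative_bisubst (p : ℝ[X][X]) (n : ℕ) (P : ℝ[X][X]) :
    derivative (bisubst p n P) = bisubst p n (derivative P) * derivative p := by
  induction P using Polynomial.induction_on' with
  | add P Q hP hQ => simp only [map_add, hP, hQ, add_mul]
  | monomial i c =>
    rw [← C_mul_X_pow_eq_monomial]
    simp only [map_mul, map_pow, bisubst_X, bisubst_C, derivative_C_mul, derivative_pow,
      derivative_X, mul_one, bisubst_C, map_natCast]
    ring

theorem IsSeparatedBy.isTameAt_of_derivative_pos (h : IsSeparatedBy S P δ) (hδ : 0 < δ)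
    (hP : bival P (0, 0) = 0) (hd : 0 < bival (derivative P) (0, 0)) : IsTameAt S 0 := by
  obtain ⟨η, hη, hpos⟩ := exists_forall_bival_pos hd
  simp only [sub_zero] at hpos
  obtain ⟨r, hr, hrη, hbox⟩ := h.exists_box_subset (fun z h1 h2 h3 => hpos z h1
    (by rwa [abs_of_nonneg h2])) hP hη hδ
  have hneg : ∀ (Q : ℝ[X][X]) z, bival (-Q) z = - bival Q z := fun Q z => evalEval_neg ..
  have hval : ∀ z : ℝ × ℝ, bival (-bisubst (-X) 1 P) z = -bival P (-z.1, z.2) := fun z => by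
    rw [hneg, bival_bisubst, hneg, bival_X, pow_one]
  have hval' : ∀ z : ℝ × ℝ, bival (derivative (-bisubst (-X) 1 P)) z =
      bival (derivative P) (-z.1, z.2) := fun z => by
    rw [derivative_neg, hneg, derivative_bisubst, bival_mul, derivative_neg, hneg, bival_bisubst,
      hneg, bival_X, pow_one, derivative_X, bival_one]
    ring
  obtain ⟨r', hr', hrη', hbox'⟩ := h.reflect.neg.exists_box_subset (fun z h1 h2 h3 => by
    rw [hval']
    exact hpos _ (by rwa [abs_neg]) (by rwa [abs_of_nonneg h2]))
    (by rw [hval]; simpa using hP) hη (lt_min hδ one_pos)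
  set ρ := min (min r r') (δ / 2)
  have hρr : ρ ≤ r := (min_le_left ..).trans (min_le_left ..)
  have hρr' : ρ ≤ r' := (min_le_left ..).trans (min_le_right ..)
  have hρδ : ρ < δ := (min_le_right ..).trans_lt (by linarith)
  have hρ : 0 < ρ := by positivity
  refine ⟨η, hη, ρ, hρ, ?_⟩
  rcases (boxPart S 0 η ρ).eq_empty_or_nonempty with he | ⟨z, hzS, hzη, hz0, hzρ⟩
  · rw [he]
    exact isTame_empty
  rcases (h.ne_zero z hzS hz0 (hzρ.trans hρδ)).lt_or_gt with hz | hz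
  · refine isTame_boxPart_of_box_subset (u := -(η / 2)) hρ fun w h1 h2 h3 => ⟨?_, ?_, h2, h3⟩
    · have := hbox' (-z.1, z.2) ⟨by simpa using hzS, by simpa using hzη, hz0, hzρ.trans_le hρr'⟩
        (by rw [hval]; simpa using hz) (-w.1, w.2) (by
          rw [← abs_neg]; exact (lt_of_eq_of_lt (by congr 1; simp; ring) h1).trans_le hρr') h2
          (h3.trans_le hρr')
      simpa using this
    · obtain ⟨h4, h5⟩ := abs_lt.1 h1
      rw [sub_zero, abs_lt]
      constructor <;> linarith
  · refine isTame_boxPart_of_box_subset (u := η / 2) hρ fun w h1 h2 h3 => ⟨?_, ?_, h2, h3⟩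
    · exact hbox z ⟨hzS, hzη, hz0, hzρ.trans_le hρr⟩ hz w (h1.trans_le hρr) h2 (h3.trans_le hρr)
    · obtain ⟨h4, h5⟩ := abs_lt.1 h1
      rw [sub_zero, abs_lt]
      constructor <;> linarith

theorem IsSeparatedBy.isTameAt_of_coeff_one_ne_zero (h : IsSeparatedBy S P δ) (hδ : 0 < δ)
    (hP : (P.coeff 0).eval 0 = 0) (hd : (P.coeff 1).eval 0 ≠ 0) : IsTameAt S 0 := by
  rw [← bival_zero_zero] at hP
  have hd' : bival (derivative P) (0, 0) ≠ 0 := by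
    rw [bival_zero_zero, coeff_derivative]
    simpa using hd
  have hneg : ∀ (Q : ℝ[X][X]) z, bival (-Q) z = - bival Q z := fun Q z => evalEval_neg ..
  rcases hd'.lt_or_gt with hlt | hgt
  · refine h.neg.isTameAt_of_derivative_pos hδ (by rw [hneg, hP, neg_zero]) ?_
    rw [derivative_neg, hneg]
    linarith
  · exact h.isTameAt_of_derivative_pos hδ hP hgt

end Separated

section NewtonStep
open Polynomial

theorem exists_eq_X_pow_mul_of_ne_zero {c : ℝ[X]} (hc : c ≠ 0) :
    ∃ (o : ℕ) (d : ℝ[X]), c = X ^ o * d ∧ d.eval 0 ≠ 0 := by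
  obtain ⟨d, hd, hXd⟩ := (FiniteMultiplicity.of_prime_left prime_X hc).exists_eq_pow_mul_and_not_dvd
  refine ⟨_, d, hd, fun h => hXd (X_dvd_iff.2 ?_)⟩
  rwa [coeff_zero_eq_eval_zero]

theorem eval_zero_expand (c : ℝ[X]) {n : ℕ} (hn : n ≠ 0) : (expand ℝ n c).eval 0 = c.eval 0 := by
  rw [expand_eval, zero_pow hn]

theorem exists_newton_slope (c : ℕ → ℝ[X]) {m : ℕ} (h0 : ∀ i < m, (c i).eval 0 = 0)
    (hne : ∃ i < m, c i ≠ 0) :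
    ∃ a n : ℕ, a ≠ 0 ∧ n ≠ 0 ∧ (∀ i < m, X ^ (a * (m - i)) ∣ expand ℝ n (c i)) ∧
      (∃ i < m, ∀ d, expand ℝ n (c i) = X ^ (a * (m - i)) * d → d.eval 0 ≠ 0) ∧
      (n = 1 ∨ ∀ d, expand ℝ n (c (m - 1)) = X ^ a * d → d.eval 0 = 0) := by
  classical
  have hfact : ∀ i, ∃ (o : ℕ) (d : ℝ[X]), c i ≠ 0 → c i = X ^ o * d ∧ d.eval 0 ≠ 0 := fun i => by
    by_cases h : c i = 0
    · exact ⟨0, 0, fun h' => absurd h h'⟩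
    · obtain ⟨o, d, h1⟩ := exists_eq_X_pow_mul_of_ne_zero h
      exact ⟨o, d, fun _ => h1⟩
  choose o d hod using hfact
  have hexp : ∀ (n i : ℕ), c i ≠ 0 → expand ℝ n (c i) = X ^ (n * o i) * expand ℝ n (d i) := by
    intro n i hi
    conv_lhs => rw [(hod i hi).1]
    rw [map_mul, map_pow, expand_X, pow_mul]
  have ho : ∀ i < m, c i ≠ 0 → o i ≠ 0 := by
    intro i him hi hoi
    have := h0 i him
    rw [(hod i hi).1, hoi, pow_zero, one_mul] at this
    exact (hod i hi).2 this
  let T := (Finset.range m).filter fun i => c i ≠ 0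
  have hT : ∀ i, i ∈ T ↔ i < m ∧ c i ≠ 0 := fun i => by simp [T]
  have hcase : ∃ i₀ ∈ T, (∀ i ∈ T, o i₀ * (m - i) ≤ o i * (m - i₀)) ∧
      (m - i₀ = 1 ∨ ∀ h : m - 1 ∈ T, o i₀ < o (m - 1) * (m - i₀)) := by
    obtain ⟨i₁, hi₁, hmin⟩ := T.exists_min_image (fun i => (o i : ℚ) / ((m - i : ℕ) : ℚ))
      (hne.imp fun i hi => (hT i).2 hi)
    have hpos : ∀ i ∈ T, (0 : ℚ) < ((m - i : ℕ) : ℚ) := fun i hi => by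
      exact_mod_cast Nat.sub_pos_of_lt ((hT i).1 hi).1
    have hmin' : ∀ i ∈ T, o i₁ * (m - i) ≤ o i * (m - i₁) := fun i hi => by
      have := hmin i hi
      rw [div_le_div_iff₀ (hpos i₁ hi₁) (hpos i hi)] at this
      exact_mod_cast this
    by_cases hlast : ∃ h : m - 1 ∈ T, o (m - 1) * (m - i₁) ≤ o i₁
    · obtain ⟨hl, hle⟩ := hlast
      have h1 := ((hT _).1 hl).1
      have h2 : m - (m - 1) = 1 := by omega
      refine ⟨m - 1, hl, fun i hi => ?_, Or.inl h2⟩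
      rw [h2, mul_one]
      have h3 := hmin' i hi
      have h4 : 0 < m - i₁ := Nat.sub_pos_of_lt ((hT i₁).1 hi₁).1
      refine Nat.le_of_mul_le_mul_right (le_trans ?_ h3) h4
      calc o (m - 1) * (m - i) * (m - i₁) = o (m - 1) * (m - i₁) * (m - i) := by ring
        _ ≤ o i₁ * (m - i) := Nat.mul_le_mul_right _ hle
    · push Not at hlast
      exact ⟨i₁, hi₁, hmin', Or.inr hlast⟩
  obtain ⟨i₀, hi₀, hmin, hlast⟩ := hcase
  obtain ⟨hi₀m, hci₀⟩ := (hT i₀).1 hi₀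
  have hn : m - i₀ ≠ 0 := by omega
  have hX : ∀ k : ℕ, (X : ℝ[X]) ^ k ≠ 0 := fun k => pow_ne_zero k X_ne_zero
  refine ⟨o i₀, m - i₀, ho i₀ hi₀m hci₀, hn, fun i hi => ?_, ⟨i₀, hi₀m, fun e he => ?_⟩, ?_⟩
  · by_cases hci : c i = 0
    · rw [hci, map_zero]
      exact dvd_zero _
    · rw [hexp _ _ hci, mul_comm (m - i₀)]
      exact Dvd.dvd.mul_right (pow_dvd_pow X (hmin i ((hT i).2 ⟨hi, hci⟩))) _
  · rw [hexp _ _ hci₀, mul_comm (m - i₀)] at he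
    rw [← mul_left_cancel₀ (hX _) he, eval_zero_expand _ hn]
    exact (hod i₀ hci₀).2
  · refine hlast.imp_right fun h e he => ?_
    by_cases hcm : c (m - 1) = 0
    · rw [hcm, map_zero, eq_comm, mul_eq_zero] at he
      rw [he.resolve_left (hX _), eval_zero]
    · have hlt := h ((hT _).2 ⟨by omega, hcm⟩)
      obtain ⟨k, hk⟩ := Nat.exists_eq_add_of_lt hlt
      rw [hexp _ _ hcm, mul_comm (m - i₀), hk, add_assoc, pow_add, mul_assoc] at he
      rw [← mul_left_cancel₀ (hX _) he, eval_mul]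
      simp

theorem coeff_bisubst_X_mul_C (a n : ℕ) (P : ℝ[X][X]) (i : ℕ) :
    (bisubst (X * C (X ^ a)) n P).coeff i = X ^ (a * i) * expand ℝ n (P.coeff i) := by
  induction P using Polynomial.induction_on' with
  | add P Q hP hQ => simp only [map_add, coeff_add, hP, hQ, mul_add]
  | monomial j c =>
    rw [← C_mul_X_pow_eq_monomial, map_mul, map_pow (bisubst _ _), bisubst_X, bisubst_C, mul_pow,
      ← C_pow, mul_comm (X ^ j), ← mul_assoc, ← C_mul, coeff_C_mul_X_pow, coeff_C_mul_X_pow]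
    split_ifs with h
    · subst h; ring
    · simp

theorem exists_bisubst_eq_C_mul {P : ℝ[X][X]} {m a n : ℕ}
    (h : ∀ i < m, X ^ (a * (m - i)) ∣ expand ℝ n (P.coeff i)) :
    ∃ P₁ : ℝ[X][X], bisubst (X * C (X ^ a)) n P = C (X ^ (a * m)) * P₁ ∧
      (∀ i < m, expand ℝ n (P.coeff i) = X ^ (a * (m - i)) * P₁.coeff i) ∧
      ∀ j, P₁.coeff (m + j) = X ^ (a * j) * expand ℝ n (P.coeff (m + j)) := by
  have hX : ∀ k : ℕ, (X : ℝ[X]) ^ k ≠ 0 := fun k => pow_ne_zero k X_ne_zero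
  obtain ⟨P₁, hP₁⟩ : C (X ^ (a * m)) ∣ bisubst (X * C (X ^ a)) n P := by
    refine (C_dvd_iff_dvd_coeff _ _).2 fun i => ?_
    rw [coeff_bisubst_X_mul_C]
    rcases lt_or_ge i m with hi | hi
    · obtain ⟨d, hd⟩ := h i hi
      refine ⟨d, ?_⟩
      rw [hd, ← mul_assoc, ← pow_add, ← mul_add]
      congr 3
      omega
    · exact Dvd.dvd.mul_right (pow_dvd_pow X (Nat.mul_le_mul_left a hi)) _
  have hco : ∀ i, X ^ (a * i) * expand ℝ n (P.coeff i) = X ^ (a * m) * P₁.coeff i := fun i => by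
    rw [← coeff_bisubst_X_mul_C, hP₁, coeff_C_mul]
  refine ⟨P₁, hP₁, fun i hi => mul_left_cancel₀ (hX (a * i)) ?_,
    fun j => mul_left_cancel₀ (hX (a * m)) ?_⟩
  · rw [hco, ← mul_assoc, ← pow_add, ← mul_add]
    congr 3
    omega
  · rw [← hco, mul_add, pow_add, mul_assoc]

/-- The discriminant condition: `P` and its derivative generate an ideal containing
`τ ^ K * ω(τ)` with `ω(0) ≠ 0`. -/
def HasBezout (P : ℝ[X][X]) (K : ℕ) : Prop :=
  ∃ (A B : ℝ[X][X]) (ω : ℝ[X]), ω.eval 0 ≠ 0 ∧ A * P + B * derivative P = C (X ^ K * ω)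

theorem HasBezout.exists_coeff_ne_zero {P : ℝ[X][X]} {K : ℕ} (h : HasBezout P K) :
    P.coeff 0 ≠ 0 ∨ P.coeff 1 ≠ 0 := by
  by_contra! h'
  obtain ⟨A, B, ω, hω, hb⟩ := h
  have h1 := congrArg (coeff · 0) hb
  simp only [coeff_add, mul_coeff_zero, coeff_derivative, h'.1, h'.2, coeff_C_zero] at h1
  simp only [mul_zero, zero_mul, add_zero] at h1
  rcases mul_eq_zero.1 h1.symm with h2 | h2
  · exact pow_ne_zero K X_ne_zero h2
  · simp [h2] at hω

theorem HasBezout.translate {P : ℝ[X][X]} {K : ℕ} (h : HasBezout P K) (c : ℝ) :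
    HasBezout (bisubst (X + C (C c)) 1 P) K := by
  obtain ⟨A, B, ω, hω, hb⟩ := h
  refine ⟨bisubst (X + C (C c)) 1 A, bisubst (X + C (C c)) 1 B, ω, hω, ?_⟩
  have h1 := congrArg (bisubst (X + C (C c)) 1) hb
  rw [map_add, map_mul, map_mul, bisubst_C, expand_one] at h1
  rw [derivative_bisubst, ← h1]
  simp

theorem HasBezout.blowup {P P₁ : ℝ[X][X]} {K m a n : ℕ} (h : HasBezout P K) (hm : m ≠ 0)
    (hn : n ≠ 0) (hP₁ : bisubst (X * C (X ^ a)) n P = C (X ^ (a * m)) * P₁) :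
    a * (m - 1) ≤ n * K ∧ HasBezout P₁ (n * K - a * (m - 1)) := by
  have hX : ∀ k : ℕ, (C ((X : ℝ[X]) ^ k) : ℝ[X][X]) ≠ 0 := fun k =>
    C_ne_zero.2 (pow_ne_zero k X_ne_zero)
  obtain ⟨A, B, ω, hω, hb⟩ := h
  have hm' : a * m = a * (m - 1) + a := by
    obtain ⟨k, rfl⟩ := Nat.exists_eq_succ_of_ne_zero hm
    simp [mul_add]
  have hder : bisubst (X * C (X ^ a)) n (derivative P) =
      C (X ^ (a * (m - 1))) * derivative P₁ := by
    have h1 := derivative_bisubst (X * C (X ^ a)) n P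
    rw [hP₁, derivative_C_mul, hm', derivative_mul, derivative_X, derivative_C, mul_zero, add_zero,
      one_mul, pow_add, C_mul] at h1
    refine mul_right_cancel₀ (hX a) ?_
    rw [← h1]
    ring
  have h1 := congrArg (bisubst (X * C (X ^ a)) n) hb
  rw [map_add, map_mul, map_mul, bisubst_C, hP₁, hder, map_mul,
    map_pow (expand ℝ n), expand_X, ← pow_mul, hm',
    pow_add, C_mul] at h1
  set A₁ := bisubst (X * C (X ^ a)) n A
  set B₁ := bisubst (X * C (X ^ a)) n B
  have h2 : C (X ^ (a * (m - 1))) * (C (X ^ a) * A₁ * P₁ + B₁ * derivative P₁) =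
      C (X ^ (n * K) * expand ℝ n ω) := by
    rw [← h1]; ring
  have hω' : (expand ℝ n ω).eval 0 ≠ 0 := by rwa [eval_zero_expand _ hn]
  have hle : a * (m - 1) ≤ n * K := by
    by_contra! hlt
    obtain ⟨k, hk⟩ := Nat.exists_eq_add_of_lt hlt
    have h3 : X ^ (a * (m - 1)) ∣ X ^ (n * K) * expand ℝ n ω := by
      have := (C_dvd_iff_dvd_coeff _ _).1 (Dvd.intro _ h2) 0
      rwa [coeff_C_zero] at this
    rw [hk, add_assoc, pow_add] at h3
    have h4 := (mul_dvd_mul_iff_left (pow_ne_zero (n * K) X_ne_zero)).1 h3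
    have h5 : X ∣ expand ℝ n ω := (dvd_pow_self X (Nat.succ_ne_zero k)).trans h4
    rw [X_dvd_iff, coeff_zero_eq_eval_zero] at h5
    exact hω' h5
  refine ⟨hle, C (X ^ a) * A₁, B₁, expand ℝ n ω, hω', mul_left_cancel₀ (hX (a * (m - 1))) ?_⟩
  rw [h2, ← C_mul, ← mul_assoc, ← pow_add, Nat.add_sub_cancel' hle]

theorem map_bisubst (p : ℝ[X][X]) {n : ℕ} (hn : n ≠ 0) (P : ℝ[X][X]) :
    (bisubst p n P).map (evalRingHom 0) = (P.map (evalRingHom 0)).comp (p.map (evalRingHom 0)) := by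
  induction P using Polynomial.induction_on' with
  | add P Q hP hQ => simp only [map_add, Polynomial.map_add, add_comp, hP, hQ]
  | monomial j c =>
    rw [← C_mul_X_pow_eq_monomial, map_mul, map_pow, bisubst_X, bisubst_C]
    simp [eval_zero_expand _ hn]

theorem exists_order_translate_le {P P₁ : ℝ[X][X]} {m a n : ℕ} (ha : a ≠ 0) (hn : n ≠ 0)
    (hPm : (P.coeff m).eval 0 ≠ 0)
    (hlt : ∀ i < m, expand ℝ n (P.coeff i) = X ^ (a * (m - i)) * P₁.coeff i)
    (hge : ∀ j, P₁.coeff (m + j) = X ^ (a * j) * expand ℝ n (P.coeff (m + j)))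
    (hedge : ∃ i < m, ∀ d, expand ℝ n (P.coeff i) = X ^ (a * (m - i)) * d → d.eval 0 ≠ 0)
    (hint : n = 1 ∨ ∀ d, expand ℝ n (P.coeff (m - 1)) = X ^ a * d → d.eval 0 = 0) (c : ℝ) :
    ∃ k ≤ m, (k = m → n = 1) ∧
      (∀ i < k, ((bisubst (X + C (C c)) 1 P₁).coeff i).eval 0 = 0) ∧
      ((bisubst (X + C (C c)) 1 P₁).coeff k).eval 0 ≠ 0 := by
  classical
  set F : ℝ[X] := P₁.map (evalRingHom 0) with hF
  have hFc : ∀ i, F.coeff i = (P₁.coeff i).eval 0 := fun i => by rw [hF, coeff_map]; rfl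
  have hFm : F.coeff m ≠ 0 := by
    have := hge 0
    rw [add_zero, mul_zero, pow_zero, one_mul] at this
    rw [hFc, this, eval_zero_expand _ hn]
    exact hPm
  have hFdeg : F.natDegree ≤ m := by
    refine natDegree_le_iff_coeff_eq_zero.2 fun i hi => ?_
    obtain ⟨j, rfl⟩ := Nat.exists_eq_add_of_lt hi
    rw [hFc, add_assoc, hge]
    simp [ha]
  have hG : ∀ i, ((bisubst (X + C (C c)) 1 P₁).coeff i).eval 0 = (taylor c F).coeff i := fun i => by
    have h1 := congrArg (coeff · i) (map_bisubst (X + C (C c)) one_ne_zero P₁)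
    rw [coeff_map] at h1
    rw [taylor_apply]
    simpa using h1
  simp only [hG]
  have hdeg : F.natDegree = m := le_antisymm hFdeg (le_natDegree_of_ne_zero hFm)
  have hGm : (taylor c F).coeff m ≠ 0 := by
    have : (taylor c F).leadingCoeff ≠ 0 := leadingCoeff_ne_zero.2 fun h => hFm (by
      rw [(taylor_injective c) (h.trans (map_zero (taylor c)).symm), coeff_zero])
    rwa [leadingCoeff, natDegree_taylor, hdeg] at this
  have hex : ∃ k, (taylor c F).coeff k ≠ 0 := ⟨m, hGm⟩
  refine ⟨Nat.find hex, Nat.find_min' hex hGm, fun hk => ?_,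
    fun i hi => not_not.1 (Nat.find_min hex hi), Nat.find_spec hex⟩
  by_contra hn1
  have hG0 : ∀ i < m, (taylor c F).coeff i = 0 := fun i hi =>
    not_not.1 (Nat.find_min hex (hk ▸ hi))
  set l := (taylor c F).coeff m
  have hmono : taylor c F = C l * X ^ m := by
    ext i
    rw [coeff_C_mul_X_pow]
    split_ifs with hi
    · rw [hi]
    · rcases lt_or_gt_of_ne hi with hi | hi
      · exact hG0 i hi
      · exact coeff_eq_zero_of_natDegree_lt (by rwa [natDegree_taylor, hdeg])
  have hFeq : F = C l * (X + C (-c)) ^ m := by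
    have h1 := congrArg (taylor (-c)) hmono
    rw [taylor_taylor] at h1
    simpa using h1
  obtain ⟨i, him, hi⟩ := hedge
  have hm : m ≠ 0 := by omega
  have h1 : F.coeff (m - 1) = 0 := by
    rw [hFc]
    refine hint.resolve_left hn1 _ ?_
    have := hlt (m - 1) (by omega)
    rwa [show m - (m - 1) = 1 by omega, mul_one] at this
  rw [hFeq, coeff_C_mul, coeff_X_add_C_pow, show m - (m - 1) = 1 by omega, pow_one] at h1
  have hchoose : ((m.choose (m - 1) : ℕ) : ℝ) ≠ 0 :=
    Nat.cast_ne_zero.2 (Nat.choose_pos (Nat.sub_le m 1)).ne'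
  have hc : -c = 0 := by
    rcases mul_eq_zero.1 h1 with h2 | h2
    · exact absurd h2 hGm
    · exact (mul_eq_zero.1 h2).resolve_right hchoose
  refine hi _ (hlt i him) ?_
  rw [← hFc, hFeq, hc, C_0, add_zero, coeff_C_mul_X_pow, if_neg him.ne]

end NewtonStep

section Induction
open Polynomial

theorem exists_forall_bival_ne_zero_of_large {P P₁ : ℝ[X][X]} {m a n : ℕ} (hn : n ≠ 0)
    (hPm : (P.coeff m).eval 0 ≠ 0)
    (hge : ∀ j, P₁.coeff (m + j) = X ^ (a * j) * expand ℝ n (P.coeff (m + j))) :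
    ∃ η > 0, ∀ v σ : ℝ, v ≠ 0 → |v⁻¹| < η → |v * σ ^ a| < η → |σ| < η →
      bival P₁ (v, σ) ≠ 0 := by
  set N := P₁.natDegree + 1 with hN
  let F : ℝ × ℝ × ℝ → ℝ := fun x =>
    ∑ i ∈ Finset.range m, (P₁.coeff i).eval x.2.2 * x.1 ^ (m - i) +
      ∑ j ∈ Finset.range N, (expand ℝ n (P.coeff (m + j))).eval x.2.2 * x.2.1 ^ j
  have hF : Continuous F := by
    have hc : ∀ c : ℝ[X], Continuous fun x : ℝ × ℝ × ℝ => c.eval x.2.2 := fun c =>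
      c.continuous.comp (by fun_prop)
    have h1 : ∀ i, Continuous fun x : ℝ × ℝ × ℝ => (P₁.coeff i).eval x.2.2 := fun i => hc _
    have h2 : ∀ j, Continuous fun x : ℝ × ℝ × ℝ =>
        (expand ℝ n (P.coeff (m + j))).eval x.2.2 := fun i => hc _
    exact (continuous_finsetSum _ fun i _ => (h1 i).mul (by fun_prop)).add
      (continuous_finsetSum _ fun j _ => (h2 j).mul (by fun_prop))
  have hF0 : F 0 ≠ 0 := by
    have h1 : ∀ i ∈ Finset.range m, (P₁.coeff i).eval 0 * (0 : ℝ) ^ (m - i) = 0 := fun i hi => by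
      rw [zero_pow (Nat.sub_ne_zero_of_lt (Finset.mem_range.1 hi)), mul_zero]
    simp only [F, Prod.fst_zero, Prod.snd_zero]
    rw [Finset.sum_eq_zero h1, hN, Finset.sum_range_succ', Finset.sum_eq_zero (by simp)]
    simpa [eval_zero_expand _ hn] using hPm
  obtain ⟨η, hη, hball⟩ := Metric.eventually_nhds_iff.1 (hF.continuousAt.eventually_ne hF0)
  refine ⟨η, hη, fun v σ hv h1 h2 h3 => ?_⟩
  have hval : bival P₁ (v, σ) = v ^ m * F (v⁻¹, v * σ ^ a, σ) := by
    rw [bival_eq_eval_map, eval_eq_sum_range' (n := m + N)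
      ((natDegree_map_le).trans_lt (by omega)), Finset.sum_range_add, mul_add, Finset.mul_sum,
      Finset.mul_sum]
    simp only [coeff_map, coe_evalRingHom]
    congr 1
    · refine Finset.sum_congr rfl fun i hi => ?_
      have hvm : v ^ m = v ^ i * v ^ (m - i) := by
        rw [← pow_add, Nat.add_sub_cancel' (Finset.mem_range.1 hi).le]
      rw [hvm, inv_pow]
      have := pow_ne_zero (m - i) hv
      field_simp
    · refine Finset.sum_congr rfl fun j _ => ?_
      rw [hge, eval_mul, eval_pow, eval_X, mul_pow, pow_add, pow_mul]
      ring
  rw [hval]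
  refine mul_ne_zero (pow_ne_zero m hv) (hball ?_)
  simp only [Prod.dist_eq, Prod.fst_zero, Prod.snd_zero, Real.dist_eq, sub_zero]
  exact max_lt h1 (max_lt h2 h3)

variable {S : Set (ℝ × ℝ)} {P P₁ : ℝ[X][X]} {δ δ₁ : ℝ}

theorem IsSeparatedBy.mem_of_mem_wedge (h : IsSeparatedBy S P δ) {a : ℕ} {η C s : ℝ}
    (hηδ : η ≤ δ) (hs : s = 1 ∨ s = -1)
    (hne : ∀ v σ : ℝ, C < |v| → 0 < σ → σ < η → |v * σ ^ a| < η → bival P (v, σ) ≠ 0)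
    {v σ v' σ' : ℝ} (hv : C < s * v) (hσ : 0 < σ) (hση : σ < η) (hvσ : |v * σ ^ a| < η)
    (hv' : C < s * v') (hσ' : 0 < σ') (hση' : σ' < η) (hvσ' : |v' * σ' ^ a| < η)
    (hmem : (v, σ) ∈ S) : (v', σ') ∈ S := by
  have habs : ∀ t : ℝ, C < s * t → C < |t| := fun t ht => by
    rcases hs with rfl | rfl
    · exact (by simpa using ht : C < t).trans_le (le_abs_self t)
    · exact (by simpa using ht : C < -t).trans_le (neg_le_abs t)
  have hmono : ∀ {t t₀ σ₀ : ℝ}, 0 < t → t ≤ t₀ → |σ₀ * t₀ ^ a| < η → |σ₀ * t ^ a| < η := by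
    intro t t₀ w h0 h1 h2
    refine lt_of_le_of_lt ?_ h2
    rw [abs_mul, abs_mul, abs_of_pos (pow_pos h0 a), abs_of_pos (pow_pos (h0.trans_le h1) a)]
    gcongr
  set ρ := min σ σ' with hρ
  have hρ0 : 0 < ρ := lt_min hσ hσ'
  have hρσ : ρ ≤ σ := min_le_left ..
  have hρσ' : ρ ≤ σ' := min_le_right ..
  have h1 : (v, ρ) ∈ S := by
    refine h.mem_vertical hσ (hση.trans_le hηδ) hρ0 (hρσ.trans_lt (hση.trans_le hηδ))
      (fun t ht => ?_) hmem
    rw [Set.uIcc_of_ge hρσ] at ht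
    exact hne v t (habs v hv) (hρ0.trans_le ht.1) (ht.2.trans_lt hση)
      (hmono (hρ0.trans_le ht.1) ht.2 hvσ)
  have h2 : (v', ρ) ∈ S := by
    refine h.mem_horizontal hρ0 (hρσ.trans_lt (hση.trans_le hηδ)) (fun t ht => ?_) h1
    refine hne t ρ (habs t ?_) hρ0 (hρσ.trans_lt hση) ?_
    · have hconv : Convex ℝ {x : ℝ | C < s * x} := by
        exact convex_halfSpace_gt (IsLinearMap.isLinearMap_smul s) C
      exact hconv.ordConnected.uIcc_subset hv hv' ht
    · have ht' : |t| ≤ max |v| |v'| := by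
        rcases le_total v v' with hvv | hvv
        · rw [Set.uIcc_of_le hvv] at ht
          exact abs_le_max_abs_abs ht.1 ht.2
        · rw [Set.uIcc_of_ge hvv] at ht
          rw [max_comm]
          exact abs_le_max_abs_abs ht.1 ht.2
      have e1 := hmono hρ0 hρσ hvσ
      have e2 := hmono hρ0 hρσ' hvσ'
      rw [abs_mul] at e1 e2 ⊢
      rcases le_max_iff.1 ht' with h3 | h3
      · exact (mul_le_mul_of_nonneg_right h3 (abs_nonneg _)).trans_lt e1
      · exact (mul_le_mul_of_nonneg_right h3 (abs_nonneg _)).trans_lt e2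
  refine h.mem_vertical hρ0 (hρσ.trans_lt (hση.trans_le hηδ)) hσ' (hση'.trans_le hηδ)
      (fun t ht => ?_) h2
  rw [Set.uIcc_of_le hρσ'] at ht
  exact hne v' t (habs v' hv') (hρ0.trans_le ht.1) (ht.2.trans_lt hση')
    (hmono (hρ0.trans_le ht.1) ht.2 hvσ')

theorem exists_pow_eq_of_pos {n : ℕ} (hn : n ≠ 0) {τ : ℝ} (hτ : 0 < τ) :
    ∃ σ : ℝ, 0 < σ ∧ σ ^ n = τ :=
  ⟨τ ^ (n⁻¹ : ℝ), Real.rpow_pos_of_pos hτ _, Real.rpow_inv_natCast_pow hτ.le hn⟩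

theorem isTameAt_of_blowup {a n : ℕ} (ha : a ≠ 0) (hn : n ≠ 0) {S₁ : Set (ℝ × ℝ)}
    (hS₁ : ∀ z, z ∈ S₁ ↔ (z.1 * z.2 ^ a, z.2 ^ n) ∈ S) (h : IsSeparatedBy S₁ P₁ δ₁)
    (hδ₁ : 0 < δ₁)
    (hW : ∃ η > 0, ∀ v σ : ℝ, v ≠ 0 → |v⁻¹| < η → |v * σ ^ a| < η → |σ| < η →
      bival P₁ (v, σ) ≠ 0)
    (ht : ∀ v, IsTameAt S₁ v) : IsTameAt S 0 := by
  obtain ⟨η₀, hη₀, hW⟩ := hW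
  obtain ⟨η, hη, hηη₀, hηδ, hη1⟩ : ∃ η > 0, η ≤ η₀ ∧ η ≤ δ₁ ∧ η ≤ 1 :=
    ⟨min η₀ (min δ₁ 1), by positivity, min_le_left .., (min_le_right ..).trans (min_le_left ..),
      (min_le_right ..).trans (min_le_right ..)⟩
  set C := η⁻¹ with hC
  have hC0 : 0 < C := inv_pos.2 hη
  have hne : ∀ v σ : ℝ, C < |v| → 0 < σ → σ < η → |v * σ ^ a| < η → bival P₁ (v, σ) ≠ 0 := by
    intro v σ h1 h2 h3 h4
    refine hW v σ (abs_pos.1 (hC0.trans h1)) ?_ (h4.trans_le hηη₀)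
      (by rw [abs_of_pos h2]; exact h3.trans_le hηη₀)
    rw [abs_inv]
    exact (inv_lt_of_inv_lt₀ hη h1).trans_le hηη₀
  have hpow_le : ∀ σ : ℝ, 0 < σ → σ ≤ 1 → σ ^ a ≤ σ := fun σ h1 h2 => pow_le_of_le_one h1.le h2 ha
  by_cases hfat : ∃ s : ℝ, (s = 1 ∨ s = -1) ∧ ∃ v σ, C < s * v ∧ 0 < σ ∧ σ < η ∧
      |v * σ ^ a| < η ∧ (v, σ) ∈ S₁
  · obtain ⟨s, hs, v₀, σ₀, hv₀, hσ₀, hση₀, hvσ₀, hmem⟩ := hfat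
    refine ⟨η, hη, η ^ n, by positivity, ?_⟩
    set r' := min η (η / (4 * (C + 1))) with hr'
    have hr'0 : 0 < r' := by positivity
    refine isTame_boxPart_of_box_subset (u := s * (η / 2)) (r := min (η / 4) (r' ^ n))
      (by positivity) ?_
    rintro ⟨u, τ⟩ hu hτ hτr
    obtain ⟨σ, hσ, rfl⟩ := exists_pow_eq_of_pos hn hτ
    simp only at hu hτ hτr
    have hσr : σ < r' := lt_of_pow_lt_pow_left₀ n hr'0.le (hτr.trans_le (min_le_right ..))
    have hση : σ < η := hσr.trans_le (min_le_left ..)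
    have hσC : σ * (4 * (C + 1)) < η := by
      rw [← lt_div_iff₀ (by positivity)]
      exact hσr.trans_le (min_le_right ..)
    have hsu : η / 4 < s * u ∧ |u| < η := by
      obtain ⟨h1, h2⟩ := abs_lt.1 (hu.trans_le (min_le_left ..))
      rcases hs with rfl | rfl
      · exact ⟨by linarith, abs_lt.2 ⟨by linarith, by linarith⟩⟩
      · exact ⟨by linarith, abs_lt.2 ⟨by linarith, by linarith⟩⟩
    have hσa : 0 < σ ^ a := pow_pos hσ a
    have huv : u / σ ^ a * σ ^ a = u := div_mul_cancel₀ _ hσa.ne'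
    have hmem' : (u / σ ^ a, σ) ∈ S₁ := by
      refine h.mem_of_mem_wedge hηδ hs hne hv₀ hσ₀ hση₀ hvσ₀ ?_ hσ hση (by rw [huv]; exact hsu.2) hmem
      rw [← mul_div_assoc, lt_div_iff₀ hσa]
      have := hpow_le σ hσ (hση.le.trans hη1)
      nlinarith
    rw [hS₁] at hmem'
    simp only [huv] at hmem'
    exact ⟨hmem', by simpa using hsu.2, hτ, pow_lt_pow_left₀ hση hσ.le hn⟩
  · have hthin : ∀ v σ, 0 < σ → σ < η → |v * σ ^ a| < η → (v, σ) ∈ S₁ → |v| ≤ C := by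
      intro v σ h1 h2 h3 h4
      by_contra! h5
      rcases lt_abs.1 h5 with h6 | h6
      · exact hfat ⟨1, .inl rfl, v, σ, by simpa using h6, h1, h2, h3, h4⟩
      · exact hfat ⟨-1, .inr rfl, v, σ, by simpa using h6, h1, h2, h3, h4⟩
    obtain ⟨T, hT, ε, hε, M, hST, hTS⟩ := exists_isTame_of_forall_isTameAt (C := C)
      fun v _ => ht v
    refine ⟨η, hη, η ^ n, by positivity, ?_⟩
    have hθ := isTransition_add_mul_pow 0 a hn
    set ε' := min ε (min η (η / (|M| + 1))) with hε'
    have hε'0 : 0 < ε' := by positivity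
    refine (hT.image hθ).of_subset_union (M := η + η ^ n + |M| * |M| ^ a + |M| ^ n)
      (ε := ε' ^ n) (by positivity) ?_ ?_
    · rintro ⟨u, τ⟩ ⟨hzS, hu, hτ, hτη⟩
      obtain ⟨σ, hσ, rfl⟩ := exists_pow_eq_of_pos hn hτ
      simp only [sub_zero] at hu hτ hτη
      have hση : σ < η := lt_of_pow_lt_pow_left₀ n hη.le hτη
      have hσa : 0 < σ ^ a := pow_pos hσ a
      have huv : u / σ ^ a * σ ^ a = u := div_mul_cancel₀ _ hσa.ne'
      have hmem : (u / σ ^ a, σ) ∈ S₁ := by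
        rw [hS₁]
        simpa only [huv] using hzS
      have hvC := hthin _ σ hσ hση (by rw [huv]; exact hu) hmem
      rcases lt_or_ge σ ε with hσε | hσε
      · refine .inl ⟨(u / σ ^ a, σ), hST _ hmem hvC hσ hσε, ?_⟩
        simp [huv]
      · refine .inr ⟨?_, ?_, ?_⟩
        · have : 0 ≤ η ^ n + |M| * |M| ^ a + |M| ^ n := by positivity
          simp only; linarith
        · exact pow_le_pow_left₀ hε'0.le ((min_le_left ..).trans hσε) n
        · have : 0 ≤ η + |M| * |M| ^ a + |M| ^ n := by positivity
          simp only; linarith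
    · rintro _ ⟨⟨v, σ⟩, hz, rfl⟩
      obtain ⟨hzS, hv, hσ, hσM⟩ := hTS _ hz
      simp only [zero_add] at hv hσ hσM ⊢
      have hvM : |v| ≤ |M| := hv.trans (le_abs_self M)
      have hσM' : σ ≤ |M| := hσM.trans (le_abs_self M)
      have habs : |v * σ ^ a| = |v| * σ ^ a := by rw [abs_mul, abs_of_pos (pow_pos hσ a)]
      rcases lt_or_ge σ ε' with hσε | hσε
      · refine .inl ⟨(hS₁ _).1 hzS, ?_, pow_pos hσ n, ?_⟩
        · have hση : σ < η := hσε.trans_le ((min_le_right ..).trans (min_le_left ..))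
          have h1 : σ * (|M| + 1) < η := by
            rw [← lt_div_iff₀ (by positivity)]
            exact hσε.trans_le ((min_le_right ..).trans (min_le_right ..))
          simp only [sub_zero]
          rw [habs]
          calc |v| * σ ^ a ≤ |M| * σ := by
                gcongr
                exact hpow_le σ hσ (hση.le.trans hη1)
            _ < η := by nlinarith
        · exact pow_lt_pow_left₀ (hσε.trans_le ((min_le_right ..).trans (min_le_left ..))) hσ.le hn
      · refine .inr ⟨?_, pow_le_pow_left₀ hε'0.le hσε n, ?_⟩
        · rw [habs]
          have h1 : |v| * σ ^ a ≤ |M| * |M| ^ a := by gcongr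
          have : 0 ≤ η + η ^ n + |M| ^ n := by positivity
          linarith
        · have h1 : σ ^ n ≤ |M| ^ n := by gcongr
          have : 0 ≤ η + η ^ n + |M| * |M| ^ a := by positivity
          linarith

theorem isTameAt_of_translate {c : ℝ} (h : IsTameAt ((fun z : ℝ × ℝ => (c + z.1, z.2)) ⁻¹' S) 0) :
    IsTameAt S c := by
  obtain ⟨η, hη, ε, hε, ht⟩ := h
  refine ⟨η, hη, ε, hε, ?_⟩
  convert ht.image (isTransition_add_mul_pow c 0 one_ne_zero) using 1
  ext ⟨u, τ⟩
  constructor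
  · rintro ⟨h1, h2, h3, h4⟩
    exact ⟨(u - c, τ), ⟨by simpa using h1, by simpa using h2, h3, h4⟩, by simp⟩
  · rintro ⟨⟨v, σ⟩, ⟨h1, h2, h3, h4⟩, h5⟩
    simp only [pow_zero, mul_one, pow_one, Prod.mk.injEq] at h5
    obtain ⟨rfl, rfl⟩ := h5
    exact ⟨h1, by simpa using h2, h3, h4⟩

theorem IsSeparatedBy.translate (h : IsSeparatedBy S P δ) (c : ℝ) :
    IsSeparatedBy ((fun z : ℝ × ℝ => (c + z.1, z.2)) ⁻¹' S) (bisubst (X + C (C c)) 1 P)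
      (min δ 1) :=
  h.preimage (p := X + C (C c)) (n := 1) (e := 0) (by fun_prop) one_ne_zero
    (fun z => by simp [add_comm]) (by simp)

theorem IsSeparatedBy.isTameAt_zero (m K : ℕ) : ∀ {S : Set (ℝ × ℝ)} {P : ℝ[X][X]} {δ : ℝ},
    0 < δ → IsSeparatedBy S P δ → HasBezout P K → (∀ i < m, (P.coeff i).eval 0 = 0) →
      (P.coeff m).eval 0 ≠ 0 → IsTameAt S 0 := by
  induction m using Nat.strong_induction_on generalizing K with
  | _ m ihm =>
  induction K using Nat.strong_induction_on with
  | _ K ihK =>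
  intro S P δ hδ hS hB h0 hm
  rcases lt_or_ge m 2 with hm2 | hm2
  · interval_cases m
    · exact hS.isTameAt_of_ne_zero hδ hm
    · exact hS.isTameAt_of_coeff_one_ne_zero hδ (h0 0 one_pos) hm
  obtain ⟨a, n, ha, hn, hdvd, hedge, hint⟩ := exists_newton_slope (fun i => P.coeff i) h0 <| by
    rcases hB.exists_coeff_ne_zero with h | h
    · exact ⟨0, by omega, h⟩
    · exact ⟨1, by omega, h⟩
  obtain ⟨P₁, hP₁, hlt, hge⟩ := exists_bisubst_eq_C_mul hdvd
  obtain ⟨hK, hB₁⟩ := hB.blowup (by omega) hn hP₁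
  have hθ := isTransition_add_mul_pow 0 a hn
  have hS₁ := hS.preimage (p := X * C (X ^ a)) hθ.continuous hn (fun z => by simp) hP₁
  have hδ₁ : 0 < min δ 1 := by positivity
  refine isTameAt_of_blowup ha hn (fun z => by simp) hS₁ hδ₁
    (exists_forall_bival_ne_zero_of_large hn hm hge) fun c => isTameAt_of_translate ?_
  obtain ⟨k, hkm, hk, hk0, hkne⟩ := exists_order_translate_le ha hn hm hlt hge hedge hint c
  have hS₂ := hS₁.translate c
  have hB₂ := hB₁.translate c
  rcases hkm.lt_or_eq with hkm | rfl
  · exact ihm k hkm _ (by positivity) hS₂ hB₂ hk0 hkne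
  · have hn1 := hk rfl
    subst hn1
    refine ihK _ ?_ (by positivity) hS₂ hB₂ hk0 hkne
    have : 0 < a * (k - 1) := Nat.mul_pos (by omega) (by omega)
    omega

theorem IsSeparatedBy.isTameAt {K : ℕ} (hδ : 0 < δ) (hS : IsSeparatedBy S P δ)
    (hB : HasBezout P K) (hP : P.map (evalRingHom 0) ≠ 0) (u : ℝ) : IsTameAt S u := by
  refine isTameAt_of_translate ?_
  have hne : (bisubst (X + C (C u)) 1 P).map (evalRingHom 0) ≠ 0 := by
    rw [map_bisubst _ one_ne_zero]
    simpa using (comp_X_add_C_ne_zero_iff (t := u)).2 hP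
  classical
  have hex : ∃ i, ((bisubst (X + C (C u)) 1 P).coeff i).eval 0 ≠ 0 := by
    by_contra! h
    exact hne (Polynomial.ext fun i => by simpa using h i)
  exact IsSeparatedBy.isTameAt_zero (Nat.find hex) K (by positivity) (hS.translate u)
    (hB.translate u) (fun i hi => by simpa using Nat.find_min hex hi) (Nat.find_spec hex)

end Induction

section Bezout
open Polynomial

theorem exists_C_mul_map_eq (F : (FractionRing ℝ[X])[X]) :
    ∃ (b : ℝ[X]) (Q : ℝ[X][X]), b ≠ 0 ∧
      Q.map (algebraMap ℝ[X] (FractionRing ℝ[X])) = C (algebraMap _ _ b) * F := by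
  obtain ⟨b, hbM, hb⟩ := IsLocalization.integerNormalization_spec (nonZeroDivisors ℝ[X]) F
  refine ⟨b, _, nonZeroDivisors.ne_zero hbM, hb.trans ?_⟩
  rw [Algebra.smul_def, IsScalarTower.algebraMap_apply ℝ[X] (FractionRing ℝ[X]),
    Polynomial.algebraMap_apply]
  rfl

theorem exists_C_mul_eq_of_map_dvd {P Q : ℝ[X][X]}
    (h : P.map (algebraMap ℝ[X] (FractionRing ℝ[X])) ∣ Q.map (algebraMap _ _)) :
    ∃ (b : ℝ[X]) (A : ℝ[X][X]), b ≠ 0 ∧ C b * Q = P * A := by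
  obtain ⟨F, hF⟩ := h
  obtain ⟨b, A, hb, hA⟩ := exists_C_mul_map_eq F
  refine ⟨b, A, hb, map_injective _ (FaithfulSMul.algebraMap_injective ℝ[X] (FractionRing ℝ[X])) ?_⟩
  rw [Polynomial.map_mul, Polynomial.map_mul, hF, hA, map_C]
  ring

theorem exists_forall_eval_ne_zero {c : ℝ[X]} (hc : c ≠ 0) :
    ∃ δ > 0, ∀ τ, 0 < τ → τ < δ → c.eval τ ≠ 0 := by
  obtain ⟨o, d, rfl, hd⟩ := exists_eq_X_pow_mul_of_ne_zero hc
  obtain ⟨δ, hδ, h⟩ := Metric.eventually_nhds_iff.1 (d.continuous.continuousAt.eventually_ne hd)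
  refine ⟨δ, hδ, fun τ h1 h2 => ?_⟩
  rw [eval_mul, eval_pow, eval_X]
  exact mul_ne_zero (pow_pos h1 o).ne' (h (by rwa [Real.dist_eq, sub_zero, abs_of_pos h1]))

theorem exists_hasBezout {P : ℝ[X][X]} (hP : P ≠ 0) :
    ∃ (Q : ℝ[X][X]) (K : ℕ), HasBezout Q K ∧ Q.map (evalRingHom 0) ≠ 0 ∧
      ∃ δ > 0, ∀ z : ℝ × ℝ, 0 < z.2 → z.2 < δ → (bival P z = 0 ↔ bival Q z = 0) := by
  classical
  set ι := algebraMap ℝ[X] (FractionRing ℝ[X]) with hι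
  have hinj : Function.Injective ι := FaithfulSMul.algebraMap_injective ℝ[X] _
  have hf : P.map ι ≠ 0 := (Polynomial.map_ne_zero_iff hinj).2 hP
  set R := UniqueFactorizationMonoid.radical (P.map ι) with hR
  obtain ⟨b, Q₀, hb, hQ₀⟩ := exists_C_mul_map_eq R
  rw [← hι] at hQ₀
  have hR0 : R ≠ 0 := UniqueFactorizationMonoid.radical_ne_zero
  have hιb : ι b ≠ 0 := by simpa using (map_ne_zero_iff ι hinj).2 hb
  have hQ₀0 : Q₀ ≠ 0 := by
    rintro rfl
    rw [Polynomial.map_zero] at hQ₀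
    exact mul_ne_zero (C_ne_zero.2 hιb) hR0 hQ₀.symm
  have hprime : Prime (C (X : ℝ[X]) : ℝ[X][X]) := prime_C_iff.2 prime_X
  obtain ⟨Q, hQ, hdvd⟩ := (FiniteMultiplicity.of_prime_left hprime hQ₀0).exists_eq_pow_mul_and_not_dvd
  set e := multiplicity (C (X : ℝ[X])) Q₀
  have hιX : ι X ≠ 0 := (map_ne_zero_iff ι hinj).2 X_ne_zero
  have hassoc : Associated (Q.map ι) R := by
    have hu : IsUnit (C (ι X ^ e)) := isUnit_C.2 (pow_ne_zero e hιX).isUnit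
    have hu' : IsUnit (C (ι b)) := isUnit_C.2 hιb.isUnit
    have heq : C (ι X ^ e) * Q.map ι = C (ι b) * R := by
      rw [← hQ₀, hQ]
      simp
    have h1 : Associated (C (ι X ^ e) * Q.map ι) (Q.map ι) := associated_unit_mul_left _ _ hu
    have h2 : Associated (C (ι b) * R) R := associated_unit_mul_left _ _ hu'
    exact h1.symm.trans (heq ▸ h2)
  have hsep : (Q.map ι).Separable := by
    rw [PerfectField.separable_iff_squarefree]
    refine (hassoc.squarefree_iff).2 ?_
    exact UniqueFactorizationMonoid.squarefree_radical
  obtain ⟨α, β, hαβ⟩ := hsep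
  obtain ⟨bα, A, hbα, hA⟩ := exists_C_mul_map_eq α
  obtain ⟨bβ, B, hbβ, hB⟩ := exists_C_mul_map_eq β
  rw [← hι] at hA hB
  obtain ⟨K, ω, hω, hω0⟩ := exists_eq_X_pow_mul_of_ne_zero (mul_ne_zero hbα hbβ)
  obtain ⟨b₁, A₁, hb₁, hA₁⟩ := exists_C_mul_eq_of_map_dvd
    (hassoc.dvd.trans UniqueFactorizationMonoid.radical_dvd_self : Q.map ι ∣ P.map ι)
  obtain ⟨N, hN⟩ := UniqueFactorizationMonoid.exists_dvd_radical_self_pow hf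
  obtain ⟨b₂, A₂, hb₂, hA₂⟩ := exists_C_mul_eq_of_map_dvd (P := P) (Q := Q ^ N) <| by
    rw [Polynomial.map_pow]
    exact hN.trans (pow_dvd_pow_of_dvd hassoc.symm.dvd N)
  obtain ⟨δ₁, hδ₁, h₁⟩ := exists_forall_eval_ne_zero hb₁
  obtain ⟨δ₂, hδ₂, h₂⟩ := exists_forall_eval_ne_zero hb₂
  refine ⟨Q, K, ⟨C bβ * A, C bα * B, ω, hω0, ?_⟩, fun h => hdvd ?_, min δ₁ δ₂, by positivity,
    fun z hz hzδ => ⟨fun h => ?_, fun h => ?_⟩⟩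
  · refine map_injective ι hinj ?_
    simp only [Polynomial.map_add, Polynomial.map_mul, map_C, hA, hB, ← derivative_map, ← hω]
    rw [map_mul, C_mul]
    linear_combination (C (ι bα) * C (ι bβ)) * hαβ
  · refine (C_dvd_iff_dvd_coeff _ _).2 fun i => X_dvd_iff.2 ?_
    rw [coeff_zero_eq_eval_zero]
    simpa using congrArg (coeff · i) h
  · have h3 := congrArg (bival · z) hA₂
    simp only [bival_mul, bival_C, bival_pow, h, zero_mul] at h3
    exact eq_zero_of_pow_eq_zero ((mul_eq_zero.1 h3).resolve_left
      (h₂ _ hz (hzδ.trans_le (min_le_right ..))))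
  · have h3 := congrArg (bival · z) hA₁
    simp only [bival_mul, bival_C, h, zero_mul] at h3
    exact (mul_eq_zero.1 h3).resolve_left (h₁ _ hz (hzδ.trans_le (min_le_left ..)))

end Bezout

section Transfer
open MvPolynomial

/-- A bivariate polynomial over `ℝ[X]` as a polynomial in two variables, the outer variable
becoming `X 0`. -/
noncomputable def toMvPoly : Polynomial (Polynomial ℝ) →+* MvPolynomial (Fin 2) ℝ :=
  Polynomial.eval₂RingHom (Polynomial.aeval (X 1 : MvPolynomial (Fin 2) ℝ)).toRingHom (X 0)

theorem eval_toMvPoly (P : Polynomial (Polynomial ℝ)) (z : ℝ × ℝ) :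
    eval ![z.1, z.2] (toMvPoly P) = bival P z := by
  have : ((eval ![z.1, z.2]).comp toMvPoly) = Polynomial.evalEvalRingHom z.2 z.1 := by
    ext x <;> simp [toMvPoly]
  exact congrArg (· P) (congrArg DFunLike.coe this)

theorem exists_bival_eq_eval (r : MvPolynomial (Fin 2) ℝ) :
    ∃ P : Polynomial (Polynomial ℝ), ∀ z : ℝ × ℝ, bival P z = eval ![z.1, z.2] r := by
  induction r using MvPolynomial.induction_on with
  | C c => exact ⟨Polynomial.C (Polynomial.C c), fun z => by simp⟩
  | add p q hp hq =>
    obtain ⟨P, hP⟩ := hp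
    obtain ⟨Q, hQ⟩ := hq
    exact ⟨P + Q, fun z => by simp [hP, hQ]⟩
  | mul_X p i hp =>
    obtain ⟨P, hP⟩ := hp
    fin_cases i
    · exact ⟨P * Polynomial.X, fun z => by simp [hP]⟩
    · exact ⟨P * Polynomial.C Polynomial.X, fun z => by simp [hP]⟩

theorem eq_zero_of_forall_mul_pos {p : MvPolynomial (Fin 2) ℝ} {j : Fin 2} {s : ℝ} (hs : s ≠ 0)
    (h : ∀ x : Fin 2 → ℝ, 0 < s * x j → eval x p = 0) : p = 0 := by
  classical
  have hinf : {t : ℝ | 0 < s * t}.Infinite := by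
    rcases hs.lt_or_gt with hs | hs
    · refine (Set.Iio_infinite (0 : ℝ)).mono fun t ht => mul_pos_of_neg_of_neg hs ht
    · refine (Set.Ioi_infinite (0 : ℝ)).mono fun t ht => mul_pos hs ht
  refine funext_set (fun i => if i = j then {t : ℝ | 0 < s * t} else Set.univ) (fun i => ?_)
    fun x hx => ?_
  · split_ifs
    · exact hinf
    · exact Set.infinite_univ
  · rw [map_zero]
    exact h x (by simpa using hx j (Set.mem_univ j))

theorem eq_of_forall_eval_eq {p q : MvPolynomial (Fin 2) ℝ}
    (h : ∀ z : ℝ × ℝ, 0 < z.2 → eval ![z.1, z.2] p = eval ![z.1, z.2] q) : p = q := by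
  refine sub_eq_zero.1 (eq_zero_of_forall_mul_pos (j := 1) one_ne_zero fun x hx => ?_)
  have hx' : x = ![x 0, x 1] := by
    ext i; fin_cases i <;> rfl
  rw [map_sub, sub_eq_zero, hx']
  exact h (x 0, x 1) (by simpa using hx)

/-- A parametrization of a dense part of the plane by the upper half plane, by Laurent polynomials
with poles along the boundary. -/
structure IsPolarChart (h : ℝ × ℝ → Fin 2 → ℝ) : Prop where
  exists_eq : ∃ (n : ℕ) (r : Fin 2 → MvPolynomial (Fin 2) ℝ), ∀ z : ℝ × ℝ, 0 < z.2 → ∀ i,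
    z.2 ^ n * h z i = eval ![z.1, z.2] (r i)
  dense : ∀ f : MvPolynomial (Fin 2) ℝ, (∀ z : ℝ × ℝ, 0 < z.2 → eval (h z) f = 0) → f = 0

theorem IsPolarChart.exists_algHom {h : ℝ × ℝ → Fin 2 → ℝ} (hh : IsPolarChart h) :
    ∃ φ : MvPolynomial (Fin 2) ℝ →ₐ[ℝ] FractionRing (MvPolynomial (Fin 2) ℝ),
      ∀ f, ∃ (m : ℕ) (r : MvPolynomial (Fin 2) ℝ),
        algebraMap (MvPolynomial (Fin 2) ℝ) (FractionRing (MvPolynomial (Fin 2) ℝ)) (X 1) ^ m *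
          φ f = algebraMap _ _ r ∧
        ∀ z : ℝ × ℝ, 0 < z.2 → z.2 ^ m * eval (h z) f = eval ![z.1, z.2] r := by
  obtain ⟨n, r, hr⟩ := hh.exists_eq
  set t := algebraMap (MvPolynomial (Fin 2) ℝ) (FractionRing (MvPolynomial (Fin 2) ℝ)) (X 1)
    with ht
  have ht0 : t ≠ 0 := by
    rw [ht, map_ne_zero_iff _ (FaithfulSMul.algebraMap_injective _ _)]
    exact X_ne_zero 1
  refine ⟨aeval fun i => algebraMap _ _ (r i) / t ^ n, fun f => ?_⟩
  induction f using MvPolynomial.induction_on with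
  | C c =>
    refine ⟨0, C c, ?_, fun z _ => by simp⟩
    rw [pow_zero, one_mul, aeval_C, IsScalarTower.algebraMap_apply ℝ (MvPolynomial (Fin 2) ℝ)]
    rfl
  | add p q hp hq =>
    obtain ⟨m₁, r₁, h₁, e₁⟩ := hp
    obtain ⟨m₂, r₂, h₂, e₂⟩ := hq
    refine ⟨m₁ + m₂, X 1 ^ m₂ * r₁ + X 1 ^ m₁ * r₂, ?_, fun z hz => ?_⟩
    · simp only [map_add, map_mul, map_pow, ← h₁, ← h₂, ← ht]
      ring
    · simp only [map_add, map_mul, map_pow, ← e₁ z hz, ← e₂ z hz, eval_X, Matrix.cons_val_one,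
        Matrix.cons_val_fin_one]
      ring
  | mul_X p i hp =>
    obtain ⟨m, q, h₁, e₁⟩ := hp
    refine ⟨m + n, q * r i, ?_, fun z hz => ?_⟩
    · simp only [map_mul, ← h₁, aeval_X]
      field_simp
      ring
    · simp only [map_mul, ← e₁ z hz, ← hr z hz i, eval_X]
      ring

theorem IsPolarChart.isLaurent {h : ℝ × ℝ → Fin 2 → ℝ} (hh : IsPolarChart h)
    (f : MvPolynomial (Fin 2) ℝ) : IsLaurent fun z => eval (h z) f := by
  obtain ⟨φ, hφ⟩ := hh.exists_algHom
  obtain ⟨m, r, -, hr⟩ := hφ f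
  obtain ⟨P, hP⟩ := exists_bival_eq_eval r
  exact ⟨m, P, fun z hz => by rw [hP, hr z hz]⟩

theorem finiteType_of_isPolarChart {H : Set (ℝ × ℝ → Fin 2 → ℝ)} (hfin : H.Finite)
    (hH : ∀ h ∈ H, IsPolarChart h) {B : Subalgebra ℝ (MvPolynomial (Fin 2) ℝ)}
    (hB : ∀ f, f ∈ B ↔ ∀ h ∈ H, IsRegularAtBoundary fun z => eval (h z) f) :
    Algebra.FiniteType ℝ B := by
  have := hfin.to_subtype
  have hinj := FaithfulSMul.algebraMap_injective (MvPolynomial (Fin 2) ℝ)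
    (FractionRing (MvPolynomial (Fin 2) ℝ))
  choose φ hφ using fun h : H => (hH h h.2).exists_algHom
  refine finiteType_of_charts (φ := φ) (fun h => ?_) (fun h f => ?_) (fun f => ?_)
  · refine (injective_iff_map_eq_zero (φ h)).2 fun f hf => (hH h h.2).dense f fun z hz => ?_
    obtain ⟨m, r, h₁, h₂⟩ := hφ h f
    rw [hf, mul_zero] at h₁
    have hr : r = 0 := hinj (by rw [← h₁, map_zero])
    have h₃ := h₂ z hz
    rw [hr, map_zero] at h₃
    exact (mul_eq_zero.1 h₃).resolve_left (pow_pos hz m).ne'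
  · obtain ⟨m, r, h₁, -⟩ := hφ h f
    exact ⟨m, r, h₁⟩
  · rw [hB, SetCoe.forall']
    refine forall_congr' fun h => ?_
    obtain ⟨m, r, h₁, h₂⟩ := hφ h f
    constructor
    · rintro ⟨q, hq⟩
      refine ⟨toMvPoly q, ?_⟩
      have hr : r = X 1 ^ m * toMvPoly q := eq_of_forall_eval_eq fun z hz => by
        rw [← h₂ z hz, map_mul, eval_toMvPoly, ← hq z hz]
        simp
      rw [hr, map_mul, map_pow] at h₁
      refine (mul_left_cancel₀ (pow_ne_zero m ?_) h₁).symm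
      rw [map_ne_zero_iff _ hinj]
      exact X_ne_zero 1
    · rintro ⟨q, hq⟩
      rw [← hq, ← map_pow, ← map_mul] at h₁
      obtain ⟨P, hP⟩ := exists_bival_eq_eval q
      refine ⟨P, fun z hz => mul_left_cancel₀ (pow_pos hz m).ne' ?_⟩
      rw [h₂ z hz, hP, ← hinj h₁]
      simp

end Transfer

section Plane
open MvPolynomial

theorem IsSeparatedBy.isTameAt_of_ne_zero_poly {S : Set (ℝ × ℝ)}
    {P : Polynomial (Polynomial ℝ)} {δ : ℝ} (hδ : 0 < δ) (hS : IsSeparatedBy S P δ) (hP : P ≠ 0)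
    (u : ℝ) : IsTameAt S u := by
  obtain ⟨Q, K, hQ, hQ0, δ', hδ', hPQ⟩ := exists_hasBezout hP
  have hS' : IsSeparatedBy S Q (min δ δ') := by
    refine ⟨fun D hD hne => hS.subset_of_isPreconnected D hD fun z hz => ?_, fun z hz h1 h2 => ?_⟩
    · obtain ⟨h1, h2, h3⟩ := hne z hz
      refine ⟨h1, h2.trans_le (min_le_left ..), ?_⟩
      rwa [ne_eq, hPQ z h1 (h2.trans_le (min_le_right ..))]
    · rw [ne_eq, ← hPQ z h1 (h2.trans_le (min_le_right ..))]
      exact hS.ne_zero z hz h1 (h2.trans_le (min_le_left ..))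
  exact hS'.isTameAt (by positivity) hQ hQ0 u

/-- Coordinates near the line at infinity, with the coordinate `j` of sign `s` the large one. -/
noncomputable def infChart (j : Fin 2) (s : ℝ) (z : ℝ × ℝ) : Fin 2 → ℝ :=
  fun i => if i = j then s / z.2 else z.1 / z.2

theorem continuousOn_infChart (j : Fin 2) (s : ℝ) :
    ContinuousOn (infChart j s) {z | 0 < z.2} := by
  refine continuousOn_pi.2 fun i => ?_
  unfold infChart
  split_ifs
  · exact continuousOn_const.div (by fun_prop) fun z hz => (ne_of_gt hz)
  · exact ContinuousOn.div (by fun_prop) (by fun_prop) fun z hz => (ne_of_gt hz)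

theorem exists_infChart_eq {j : Fin 2} {s : ℝ} (hs : s * s = 1) {x : Fin 2 → ℝ}
    (hx : 0 < s * x j) : ∃ z : ℝ × ℝ, infChart j s z = x ∧ z.2 = (s * x j)⁻¹ ∧
      ∀ i ≠ j, z.1 = x i * z.2 := by
  have hs0 : s ≠ 0 := fun h => by simp [h] at hs
  have hxj : x j ≠ 0 := fun h => by simp [h] at hx
  refine ⟨(x (1 - j) * (s * x j)⁻¹, (s * x j)⁻¹), ?_, rfl, fun i hi => ?_⟩
  · ext i
    unfold infChart
    split_ifs with h
    · subst h
      simp only [div_inv_eq_mul]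
      rw [← mul_assoc, hs, one_mul]
    · have : 1 - j = i := by omega
      simp only [this]
      exact mul_div_cancel_right₀ _ (inv_pos.2 hx).ne'
  · have : 1 - j = i := by omega
    simp only [this]

theorem exists_infChart_eq_of_norm_ge {x : Fin 2 → ℝ} {R : ℝ} (hR : 0 < R) (hx : R < ‖x‖) :
    ∃ j : Fin 2, ∃ s : ℝ, (s = 1 ∨ s = -1) ∧ ∃ z : ℝ × ℝ, infChart j s z = x ∧ |z.1| ≤ 1 ∧
      0 < z.2 ∧ z.2 < R⁻¹ := by
  obtain ⟨j, hj⟩ : ∃ j, ∀ i, |x i| ≤ |x j| := Finite.exists_max fun i => |x i|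
  have hxj : R < |x j| := by
    by_contra! h
    refine hx.not_ge ((pi_norm_le_iff_of_nonneg hR.le).2 fun i => ?_)
    exact (hj i).trans h
  obtain ⟨s, hs, hsx⟩ : ∃ s : ℝ, (s = 1 ∨ s = -1) ∧ s * x j = |x j| := by
    rcases abs_choice (x j) with h | h
    · exact ⟨1, .inl rfl, by rw [h, one_mul]⟩
    · exact ⟨-1, .inr rfl, by rw [h]; ring⟩
  have hss : s * s = 1 := by rcases hs with rfl | rfl <;> norm_num
  have h0 : 0 < |x j| := hR.trans hxj
  obtain ⟨z, hz, hz2, hz1⟩ := exists_infChart_eq hss (hsx ▸ h0)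
  rw [hsx] at hz2
  refine ⟨j, s, hs, z, hz, ?_, hz2 ▸ inv_pos.2 h0, hz2 ▸ inv_strictAnti₀ hR hxj⟩
  obtain ⟨i, hi⟩ : ∃ i, i ≠ j := exists_ne j
  rw [hz1 i hi, hz2, abs_mul, abs_inv, abs_abs, ← div_eq_mul_inv, div_le_one h0]
  exact hj i

theorem IsTransition.isPolarChart_infChart {θ : ℝ × ℝ → ℝ × ℝ} (hθ : IsTransition θ) (j : Fin 2)
    {s : ℝ} (hs : s * s = 1) : IsPolarChart fun z => infChart j s (θ z) := by
  obtain ⟨⟨p, n, -, hp⟩, hsurj⟩ := hθ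
  refine ⟨⟨n, fun i => if i = j then C s else toMvPoly p, fun z hz i => ?_⟩, fun f hf => ?_⟩
  · have := (pow_pos hz n).ne'
    simp only [infChart, hp]
    split_ifs
    · simp only [eval_C]
      field_simp
    · rw [eval_toMvPoly]
      field_simp
  · have hs0 : s ≠ 0 := fun h => by simp [h] at hs
    refine eq_zero_of_forall_mul_pos (j := j) hs0 fun x hx => ?_
    obtain ⟨w, hw, hw2, -⟩ := exists_infChart_eq hs hx
    obtain ⟨z, hz, hzw⟩ := hsurj w (hw2 ▸ inv_pos.2 hx)
    have := hf z hz
    rwa [hzw, hw] at this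

theorem exists_isTame_infChart {S : Set (Fin 2 → ℝ)} {P : MvPolynomial (Fin 2) ℝ} (hP : P ≠ 0)
    (hSP : ∀ x ∈ S, eval x P ≠ 0)
    (hsep : ∀ D : Set (Fin 2 → ℝ), IsPreconnected D → (∀ x ∈ D, eval x P ≠ 0) →
      (D ∩ S).Nonempty → D ⊆ S) (j : Fin 2) {s : ℝ} (hs : s * s = 1) :
    ∃ T, IsTame T ∧ ∃ ε > 0, (∀ z, infChart j s z ∈ S → |z.1| ≤ 1 → 0 < z.2 → z.2 < ε → z ∈ T) ∧
      ∀ z ∈ T, infChart j s z ∈ S := by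
  have hchart := IsTransition.id.isPolarChart_infChart j hs
  obtain ⟨N, r, hr⟩ := hchart.isLaurent P
  simp only [id] at hr
  have hr0 : r ≠ 0 := by
    rintro rfl
    refine hP (hchart.dense P fun z hz => ?_)
    have := hr z hz
    rw [show bival 0 z = 0 by simp] at this
    exact (mul_eq_zero.1 this).resolve_left (pow_pos hz N).ne'
  have hiff : ∀ z : ℝ × ℝ, 0 < z.2 → (bival r z ≠ 0 ↔ eval (infChart j s z) P ≠ 0) := by
    intro z hz
    rw [← hr z hz]
    simp [(pow_pos hz N).ne']
  have hS : IsSeparatedBy (infChart j s ⁻¹' S) r 1 := by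
    refine ⟨fun D hD hne ⟨z, hzD, hzS⟩ => Set.image_subset_iff.1 (hsep _ (hD.image _
      ((continuousOn_infChart j s).mono fun w hw => (hne w hw).1)) ?_ ⟨_, ⟨z, hzD, rfl⟩, hzS⟩),
      fun z hz h1 _ => (hiff z h1).2 (hSP _ hz)⟩
    rintro _ ⟨w, hw, rfl⟩
    exact (hiff w (hne w hw).1).1 (hne w hw).2.2
  obtain ⟨T, hT, ε, hε, M, hST, hTS⟩ := exists_isTame_of_forall_isTameAt (C := 1)
    fun u _ => hS.isTameAt_of_ne_zero_poly one_pos hr0 u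
  exact ⟨T, hT, ε, hε, hST, fun z hz => (hTS z hz).1⟩

theorem exists_isPolarChart_of_separated {S : Set (Fin 2 → ℝ)} {P : MvPolynomial (Fin 2) ℝ}
    (hP : P ≠ 0) (hSP : ∀ x ∈ S, eval x P ≠ 0)
    (hsep : ∀ D : Set (Fin 2 → ℝ), IsPreconnected D → (∀ x ∈ D, eval x P ≠ 0) →
      (D ∩ S).Nonempty → D ⊆ S) :
    ∃ H : Set (ℝ × ℝ → Fin 2 → ℝ), H.Finite ∧ (∀ h ∈ H, IsPolarChart h) ∧
      ∀ f : MvPolynomial (Fin 2) ℝ, (∃ B, ∀ x ∈ S, |eval x f| ≤ B) ↔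
        ∀ h ∈ H, IsRegularAtBoundary fun z => eval (h z) f := by
  let σ : Bool → ℝ := fun b => if b then 1 else -1
  have hσ : ∀ b, σ b * σ b = 1 := fun b => by cases b <;> simp [σ]
  choose T hT ε hε hST hTS using fun k : Fin 2 × Bool =>
    exists_isTame_infChart hP hSP hsep k.1 (hσ k.2)
  choose Ψ hΨ hΨθ hΨT using hT
  refine ⟨⋃ k, (fun θ z => infChart k.1 (σ k.2) (θ z)) '' Ψ k,
    Set.finite_iUnion fun k => (hΨ k).image _, ?_, fun f => ?_⟩
  · intro h hh
    obtain ⟨k, θ, hθ, rfl⟩ := Set.mem_iUnion.1 hh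
    exact (hΨθ k θ hθ).isPolarChart_infChart k.1 (hσ k.2)
  · have key : ∀ k, (∃ B, ∀ z ∈ T k, |eval (infChart k.1 (σ k.2) z) f| ≤ B) ↔
        ∀ θ ∈ Ψ k, IsRegularAtBoundary fun z => eval (infChart k.1 (σ k.2) (θ z)) f := fun k =>
      hΨT k _ ((IsTransition.id.isPolarChart_infChart k.1 (hσ k.2)).isLaurent f)
    simp only [Set.mem_iUnion, forall_exists_index]
    rw [forall_comm]
    simp only [Set.forall_mem_image, ← key]
    constructor
    · rintro ⟨B, hB⟩ k
      exact ⟨B, fun z hz => hB _ (hTS k z hz)⟩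
    · intro h
      choose B hB using h
      obtain ⟨ε₀, hε₀, hεle⟩ : ∃ ε₀ > 0, ∀ k, ε₀ ≤ ε k := by
        obtain ⟨k, hk⟩ := Finite.exists_min ε
        exact ⟨ε k, hε k, hk⟩
      obtain ⟨B', hB'⟩ := (isCompact_closedBall (0 : Fin 2 → ℝ) ε₀⁻¹).exists_bound_of_continuousOn
        (f := fun x => eval x f) (continuous_eval f).continuousOn
      obtain ⟨k₀, hk₀⟩ := Finite.exists_max B
      refine ⟨max B' (B k₀), fun x hx => ?_⟩
      rcases le_or_gt ‖x‖ ε₀⁻¹ with hx' | hx'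
      · exact (hB' x (by simpa using hx')).trans (le_max_left ..)
      · obtain ⟨j, s, hs, z, rfl, h1, h2, h3⟩ := exists_infChart_eq_of_norm_ge (inv_pos.2 hε₀) hx'
        rw [inv_inv] at h3
        obtain ⟨b, rfl⟩ : ∃ b, s = σ b := by
          rcases hs with rfl | rfl
          · exact ⟨true, rfl⟩
          · exact ⟨false, rfl⟩
        exact (hB (j, b) z (hST (j, b) z hx h1 h2 (h3.trans_le (hεle _)))).trans
          ((hk₀ _).trans (le_max_right ..))

end Plane

section Main
open MvPolynomial

theorem dense_setOf_eval_ne_zero {P : MvPolynomial (Fin 2) ℝ} (hP : P ≠ 0) :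
    Dense {x : Fin 2 → ℝ | eval x P ≠ 0} := by
  rw [show {x : Fin 2 → ℝ | eval x P ≠ 0} = {x | eval x P = 0}ᶜ from rfl,
    ← interior_eq_empty_iff_dense_compl, Set.eq_empty_iff_forall_notMem]
  intro x hx
  obtain ⟨ε, hε, hball⟩ := Metric.isOpen_iff.1 isOpen_interior x hx
  refine hP (funext_set (fun i => Metric.ball (x i) ε) (fun i => ?_) fun y hy => ?_)
  · rw [Real.ball_eq_Ioo]
    exact Set.Ioo_infinite (by linarith)
  · rw [map_zero]
    have hy' : y ∈ Metric.ball x ε := by rwa [ball_pi _ hε]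
    exact (interior_subset (hball hy') : y ∈ {x | eval x P = 0})

theorem IsSemialgebraic.exists_separating {S : Set (Fin 2 → ℝ)} (hS : IsSemialgebraic S) :
    ∃ P : MvPolynomial (Fin 2) ℝ, P ≠ 0 ∧ ∀ D : Set (Fin 2 → ℝ), IsPreconnected D →
      (∀ x ∈ D, eval x P ≠ 0) → (D ∩ S).Nonempty → D ⊆ S := by
  classical
  obtain ⟨N, p, m, q, rfl⟩ := hS
  refine ⟨∏ i, (if p i = 0 then 1 else p i) * ∏ j, (if q i j = 0 then 1 else q i j), ?_, ?_⟩
  · refine Finset.prod_ne_zero_iff.2 fun i _ => mul_ne_zero ?_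
      (Finset.prod_ne_zero_iff.2 fun j _ => ?_) <;>
    · split_ifs with h
      · exact one_ne_zero
      · exact h
  · rintro D hD hne ⟨x, hxD, hx⟩
    simp only [map_prod, map_mul, ne_eq, Finset.prod_eq_zero_iff, Finset.mem_univ, true_and,
      not_exists, mul_eq_zero, not_or] at hne
    obtain ⟨i, hpi, hqi⟩ := Set.mem_iUnion.1 hx
    have hp0 : p i = 0 := by
      by_contra h
      have := (hne x hxD i).1
      rw [if_neg h] at this
      exact this hpi
    have hq0 : ∀ j, ∀ y ∈ D, eval y (q i j) ≠ 0 := fun j y hy => by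
      have h0 : q i j ≠ 0 := fun h => by simpa [h] using hqi j
      have := (hne y hy i).2 j
      rwa [if_neg h0] at this
    refine fun y hy => Set.mem_iUnion.2 ⟨i, by simp [hp0], fun j => ?_⟩
    by_contra! h
    obtain ⟨w, hw, hw0⟩ := hD.intermediate_value hy hxD
      (continuous_eval (q i j)).continuousOn ⟨h, (hqi j).le⟩
    exact hq0 j w hw hw0

theorem mem_polyBdd_iff {n : ℕ} {S : Set (Fin n → ℝ)} {f : MvPolynomial (Fin n) ℝ} :
    f ∈ polyBdd n S ↔ ∃ B, ∀ x ∈ S, |eval x f| ≤ B := by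
  change Bornology.IsBounded ((fun x => MvPolynomial.eval x f) '' S) ↔ _
  simp only [isBounded_iff_forall_norm_le, Set.forall_mem_image, Real.norm_eq_abs]

theorem polyBdd_union_of_isBounded {n : ℕ} {S T : Set (Fin n → ℝ)} (hS : Bornology.IsBounded S) :
    polyBdd n (S ∪ T) = polyBdd n T := by
  ext f
  simp only [mem_polyBdd_iff]
  refine ⟨fun ⟨B, hB⟩ => ⟨B, fun x hx => hB x (.inr hx)⟩, fun ⟨B, hB⟩ => ?_⟩
  obtain ⟨B', hB'⟩ := hS.isCompact_closure.exists_bound_of_continuousOn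
    (f := fun x => eval x f) (continuous_eval f).continuousOn
  refine ⟨max B B', fun x hx => hx.elim (fun h => ?_) fun h => ?_⟩
  · exact (hB' x (subset_closure h)).trans (le_max_right ..)
  · exact (hB x h).trans (le_max_left ..)

theorem polyBdd_eq_of_subset_closure {n : ℕ} {S T : Set (Fin n → ℝ)} (hST : S ⊆ T)
    (hTS : T ⊆ closure S) : polyBdd n S = polyBdd n T := by
  ext f
  simp only [mem_polyBdd_iff]
  refine exists_congr fun B => ⟨fun h x hx => ?_, fun h x hx => h x (hST hx)⟩
  have hcl : IsClosed {x : Fin n → ℝ | |eval x f| ≤ B} :=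
    isClosed_le (continuous_eval f).abs continuous_const
  exact closure_minimal (fun y hy => h y hy) hcl (hTS hx)

end Main

/-- Let `S ⊆ ℝ²` be a semialgebraic set that is regular at infinity:
`S = S₀ ∪ S₁` with `S₀, S₁` semialgebraic, `S₀` bounded, and
`S₁ ⊆ closure (interior S₁)`. Then the ring `B(S)` of polynomials in `ℝ[x,y]`
bounded on `S` is a finitely generated `ℝ`-algebra. -/
theorem boundedRing_fg_of_regular_at_infinity
    (S S₀ S₁ : Set (Fin 2 → ℝ))
    (hS : S = S₀ ∪ S₁)
    (h₀sa : IsSemialgebraic S₀) (h₁sa : IsSemialgebraic S₁)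
    (h₀bdd : Bornology.IsBounded S₀)
    (h₁reg : S₁ ⊆ closure (interior S₁)) :
    (polyBdd 2 S).FG := by
  obtain ⟨P, hP, hsep⟩ := h₁sa.exists_separating
  have hdense := dense_setOf_eval_ne_zero hP
  have hcl : S₁ ⊆ closure (S₁ ∩ {x | MvPolynomial.eval x P ≠ 0}) := by
    refine h₁reg.trans (closure_minimal ?_ isClosed_closure)
    exact (hdense.open_subset_closure_inter isOpen_interior).trans
      (closure_mono (Set.inter_subset_inter_left _ interior_subset))
  have hpoly : polyBdd 2 S = polyBdd 2 (S₁ ∩ {x | MvPolynomial.eval x P ≠ 0}) := by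
    rw [hS, polyBdd_union_of_isBounded h₀bdd,
      polyBdd_eq_of_subset_closure Set.inter_subset_left hcl]
  obtain ⟨H, hfin, hH, hB⟩ := exists_isPolarChart_of_separated
    (S := S₁ ∩ {x | MvPolynomial.eval x P ≠ 0}) hP (fun x hx => hx.2)
    fun D hD hne hDS => Set.subset_inter
      (hsep D hD hne (hDS.mono (Set.inter_subset_inter_right _ Set.inter_subset_left))) hne
  rw [hpoly, Subalgebra.fg_iff_finiteType]
  exact finiteType_of_isPolarChart hfin hH fun f => mem_polyBdd_iff.trans (hB f)
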